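/- Let D1 and D2 be good drawings of K_n in the sphere with the same rotation scheme, and orient all edges. If independent edges e and f cross, then the direction of the crossing (whether f crosses e left-to-right or right-to-left, relative to the orientation and traversal of e) is the same in D1 and D2. -/

import Mathlib

open Set unitInterval

noncomputable section

/-- The 2-sphere, realized as the unit sphere in `ℝ³`. -/
abbrev Sph : Type := ↥(Metric.sphere (0 : EuclideanSpace ℝ (Fin 3)) 1)

/-- A drawing of the complete graph `K_n` in the sphere: an injective placement of the
vertices together with, for each ordered pair of distinct vertices, a simple arc joining
them (the same arc in both directions), meeting the vertex set only at its endpoints. -/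
structure SphereDrawing (n : ℕ) where
  vert : Fin n → Sph
  vert_inj : Function.Injective vert
  edge : ∀ i j : Fin n, i ≠ j → Path (vert i) (vert j)
  edge_symm : ∀ (i j : Fin n) (h : i ≠ j), edge j i h.symm = (edge i j h).symm
  edge_inj : ∀ (i j : Fin n) (h : i ≠ j), Function.Injective ⇑(edge i j h)
  edge_vert : ∀ (i j : Fin n) (h : i ≠ j),
    Set.range ⇑(edge i j h) ∩ Set.range vert = {vert i, vert j}

namespace SphereDrawing

variable {n : ℕ}

/-- The point set of the edge between `i` and `j` (empty if `i = j`). -/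
def arc (D : SphereDrawing n) (i j : Fin n) : Set Sph :=
  ⋃ h : i ≠ j, Set.range ⇑(D.edge i j h)

/-- The open interior of an edge: its point set minus all vertices. -/
def inner (D : SphereDrawing n) (i j : Fin n) : Set Sph :=
  D.arc i j \ Set.range D.vert

/-- A good drawing: no two edges with a common end cross; no two (independent) edges
cross more than once; and no three edges pass through a common non-vertex point. -/
structure IsGood (D : SphereDrawing n) : Prop where
  adj : ∀ i j k : Fin n, j ≠ k → D.inner i j ∩ D.inner i k = ∅
  indep : ∀ i j k l : Fin n, ([i, j, k, l] : List (Fin n)).Nodup →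
    (D.inner i j ∩ D.inner k l).Subsingleton
  no_triple : ∀ p : Sph, p ∉ Set.range D.vert →
    {s : Fin n × Fin n | s.1 < s.2 ∧ p ∈ D.arc s.1 s.2}.encard ≤ 2

/-- Independent edges `ij` and `kl` cross: their interiors meet. -/
def Cross (D : SphereDrawing n) (i j k l : Fin n) : Prop :=
  (D.inner i j ∩ D.inner k l).Nonempty

end SphereDrawing

/-- A self-homeomorphism of the sphere is orientation preserving iff it is homotopic to
the identity (i.e. has degree `1`). -/
def OrientPres (h : Sph ≃ₜ Sph) : Prop :=
  ContinuousMap.Homotopic ⟨⇑h, h.continuous⟩ (ContinuousMap.id Sph)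

/-- Two drawings of `K_n` have the same rotation at `v` if some orientation-preserving
homeomorphism of the sphere carries the first drawing's germ at `v` (the vertex together
with initial pieces of all incident edges) into the second drawing's edges at `v`. -/
def SameRotationAt (D1 D2 : SphereDrawing n) (v : Fin n) : Prop :=
  ∃ h : Sph ≃ₜ Sph, OrientPres h ∧ h (D1.vert v) = D2.vert v ∧
    ∃ U ∈ nhds (D1.vert v), ∀ u : Fin n, u ≠ v →
      h '' (D1.arc v u ∩ U) ⊆ D2.arc v u

/-- Same rotation scheme: the same rotation at every vertex. -/
def SameRotation {n : ℕ} (D1 D2 : SphereDrawing n) : Prop :=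
  ∀ v : Fin n, SameRotationAt D1 D2 v

namespace PlaneTop

open Topology Metric Filter

/-- `f` has a continuous logarithm on `K`. -/
def HasLog {X : Type*} [TopologicalSpace X] (f : X → ℂ) (K : Set X) : Prop :=
  ∃ g : X → ℂ, ContinuousOn g K ∧ ∀ x ∈ K, Complex.exp (g x) = f x

section General

variable {X Y : Type*} [TopologicalSpace X] [TopologicalSpace Y] {f f' : X → ℂ} {K K' : Set X}

theorem HasLog.mono (h : HasLog f K) (hK : K' ⊆ K) : HasLog f K' :=
  let ⟨g, hg, he⟩ := h
  ⟨g, hg.mono hK, fun x hx => he x (hK hx)⟩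

theorem HasLog.congr (h : HasLog f K) (hf : ∀ x ∈ K, f x = f' x) : HasLog f' K :=
  let ⟨g, hg, he⟩ := h
  ⟨g, hg, fun x hx => (he x hx).trans (hf x hx)⟩

theorem HasLog.mul (h : HasLog f K) (h' : HasLog f' K) : HasLog (fun x => f x * f' x) K :=
  let ⟨g, hg, he⟩ := h
  let ⟨g', hg', he'⟩ := h'
  ⟨fun x => g x + g' x, hg.add hg', fun x hx => by rw [Complex.exp_add, he x hx, he' x hx]⟩

theorem HasLog.inv (h : HasLog f K) : HasLog (fun x => (f x)⁻¹) K :=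
  let ⟨g, hg, he⟩ := h
  ⟨fun x => -g x, hg.neg, fun x hx => by rw [Complex.exp_neg, he x hx]⟩

theorem HasLog.div (h : HasLog f K) (h' : HasLog f' K) : HasLog (fun x => f x / f' x) K := by
  simpa only [div_eq_mul_inv] using h.mul h'.inv

theorem HasLog.comp {φ : Y → X} {L : Set Y} (h : HasLog f K) (hφ : ContinuousOn φ L)
    (hm : MapsTo φ L K) : HasLog (fun y => f (φ y)) L :=
  let ⟨g, hg, he⟩ := h
  ⟨fun y => g (φ y), hg.comp hφ hm, fun _ hy => he _ (hm hy)⟩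

theorem HasLog.ne_zero (h : HasLog f K) {x : X} (hx : x ∈ K) : f x ≠ 0 := by
  obtain ⟨g, -, he⟩ := h
  rw [← he x hx]
  exact Complex.exp_ne_zero _

theorem hasLog_of_slitPlane (hf : ContinuousOn f K) (hs : ∀ x ∈ K, f x ∈ Complex.slitPlane) :
    HasLog f K :=
  ⟨fun x => Complex.log (f x), hf.clog hs,
    fun x hx => Complex.exp_log (Complex.slitPlane_ne_zero (hs x hx))⟩

theorem hasLog_const {c : ℂ} (hc : c ≠ 0) : HasLog (fun _ : X => c) K :=
  ⟨fun _ => Complex.log c, continuousOn_const, fun _ _ => Complex.exp_log hc⟩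

/-- Two continuous logarithms on a preconnected set differ by a constant. -/
theorem log_unique (hK : IsPreconnected K) {g g' : X → ℂ} (hg : ContinuousOn g K)
    (hg' : ContinuousOn g' K) (he : ∀ x ∈ K, Complex.exp (g x) = Complex.exp (g' x)) :
    ∃ c : ℂ, Complex.exp c = 1 ∧ ∀ x ∈ K, g x = g' x + c := by
  have key : ∀ x ∈ K, ∃ n : ℤ, g x - g' x = n * (2 * Real.pi * Complex.I) := fun x hx => by
    rw [← Complex.exp_eq_one_iff, Complex.exp_sub, he x hx, div_self (Complex.exp_ne_zero _)]
  have hd : IsDiscrete (range ((↑) : ℤ → ℝ)) := by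
    rw [isDiscrete_iff_discreteTopology]
    exact (Int.isClosedEmbedding_coe_real.isEmbedding.toHomeomorph.symm).isEmbedding.discreteTopology
  have hc : ContinuousOn (fun x => (g x - g' x).im / (2 * Real.pi)) K :=
    (Complex.continuous_im.comp_continuousOn (hg.sub hg')).div_const _
  have hval : ∀ x (n : ℤ), g x - g' x = n * (2 * Real.pi * Complex.I) →
      (g x - g' x).im / (2 * Real.pi) = n := fun x n hn => by
    rw [hn]
    have := Real.pi_ne_zero
    simp
  obtain ⟨y, ⟨m, rfl⟩, hm⟩ := hK.eqOn_const_of_mapsTo hd hc (fun x hx => by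
    obtain ⟨n, hn⟩ := key x hx
    exact ⟨n, (hval x n hn).symm⟩) ⟨_, 0, rfl⟩
  refine ⟨m * (2 * Real.pi * Complex.I), Complex.exp_eq_one_iff.2 ⟨m, rfl⟩, fun x hx => ?_⟩
  obtain ⟨n, hn⟩ := key x hx
  have h1 : (n : ℝ) = m := (hval x n hn).symm.trans (hm hx)
  have h2 : n = m := by exact_mod_cast h1
  rw [← h2, ← hn]
  ring

theorem HasLog.union (hK : IsClosed K) (hK' : IsClosed K') (hp : IsPreconnected (K ∩ K'))
    (h : HasLog f K) (h' : HasLog f K') : HasLog f (K ∪ K') := by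
  classical
  obtain ⟨g, hg, he⟩ := h
  obtain ⟨g', hg', he'⟩ := h'
  obtain ⟨c, hc, hgc⟩ := log_unique hp (hg.mono inter_subset_left) (hg'.mono inter_subset_right)
    (fun x hx => (he x hx.1).trans (he' x hx.2).symm)
  have e1 : EqOn (fun x => if x ∈ K then g x else g' x + c) g K := fun x hx => by simp [hx]
  have e2 : EqOn (fun x => if x ∈ K then g x else g' x + c) (fun x => g' x + c) K' := by
    intro x hx
    by_cases hxK : x ∈ K
    · simp [hxK, hgc x ⟨hxK, hx⟩]
    · simp [hxK]
  refine ⟨fun x => if x ∈ K then g x else g' x + c, ?_, ?_⟩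
  · exact (hg.congr e1).union_of_isClosed ((hg'.add continuousOn_const).congr e2) hK hK'
  · rintro x (hx | hx)
    · rw [e1 hx, he x hx]
    · rw [e2 hx, Complex.exp_add, hc, he' x hx, mul_one]

theorem hasLog_univ [SimplyConnectedSpace X] [LocallyPathConnectedSpace X] (hf : Continuous f)
    (h0 : ∀ x, f x ≠ 0) : HasLog f univ := by
  have x₀ : X := (PathConnectedSpace.nonempty (X := X)).some
  obtain ⟨F, ⟨-, hF⟩, -⟩ := Complex.isCoveringMapOn_exp.existsUnique_continuousMap_lifts
    ⟨f, hf⟩ (a₀ := x₀) (e₀ := Complex.log (f x₀)) (Complex.exp_log (h0 x₀)) (fun x => by simpa using h0 x)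
  exact ⟨F, F.continuous.continuousOn, fun x _ => congrFun hF x⟩

theorem continuousOn_invFunOn [Nonempty X] [T2Space Y] {φ : X → Y} (hK : IsCompact K)
    (hφ : ContinuousOn φ K) (hi : InjOn φ K) :
    ContinuousOn (Function.invFunOn φ K) (φ '' K) := by
  rw [continuousOn_iff_isClosed]
  intro t ht
  refine ⟨φ '' (t ∩ K), ((hK.inter_left ht).image_of_continuousOn
    (hφ.mono inter_subset_right)).isClosed, ?_⟩
  ext y
  constructor
  · rintro ⟨hy, x, hx, rfl⟩
    rw [mem_preimage, hi.leftInvOn_invFunOn hx] at hy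
    exact ⟨⟨x, ⟨hy, hx⟩, rfl⟩, x, hx, rfl⟩
  · rintro ⟨⟨x, ⟨hxt, hx⟩, rfl⟩, -⟩
    refine ⟨?_, x, hx, rfl⟩
    rwa [mem_preimage, hi.leftInvOn_invFunOn hx]

/-- Transport of logarithms along an injective parametrization of a compact set. -/
theorem HasLog.image [T2Space Y] {f : Y → ℂ} {φ : X → Y} (hK : IsCompact K)
    (hφ : ContinuousOn φ K) (hi : InjOn φ K) (h : HasLog (fun x => f (φ x)) K) :
    HasLog f (φ '' K) := by
  rcases K.eq_empty_or_nonempty with rfl | ⟨x₀, -⟩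
  · exact ⟨fun _ => 0, by simp, by simp⟩
  have : Nonempty X := ⟨x₀⟩
  obtain ⟨g, hg, he⟩ := h
  refine ⟨fun y => g (Function.invFunOn φ K y), ?_, ?_⟩
  · refine hg.comp (continuousOn_invFunOn hK hφ hi) ?_
    rintro y ⟨x, hx, rfl⟩
    rwa [hi.leftInvOn_invFunOn hx]
  · rintro y ⟨x, hx, rfl⟩
    simpa only [hi.leftInvOn_invFunOn hx] using he x hx

end General

theorem hasLog_Icc {f : ℝ → ℂ} {a b : ℝ} (hf : ContinuousOn f (Icc a b))
    (h0 : ∀ x ∈ Icc a b, f x ≠ 0) : HasLog f (Icc a b) := by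
  rcases lt_or_ge b a with hab | hab
  · exact ⟨fun _ => 0, by simp [hab], by simp [hab]⟩
  have h1 : Continuous (fun t : ℝ => f (projIcc a b hab t)) :=
    hf.domRestrict.comp continuous_projIcc
  refine ((hasLog_univ h1 fun t => h0 _ (projIcc a b hab t).2).mono (subset_univ _)).congr ?_
  intro x hx
  rw [projIcc_of_mem hab hx]

/-- The radial retraction of the plane onto the closed unit disc. -/
def clampDisc (z : ℂ) : ℂ := z / (max 1 ‖z‖ : ℝ)

theorem continuous_clampDisc : Continuous clampDisc := by
  unfold clampDisc
  refine continuous_id.div (Complex.continuous_ofReal.comp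
    (continuous_const.max continuous_norm)) fun z => ?_
  have : (0 : ℝ) < max 1 ‖z‖ := lt_of_lt_of_le one_pos (le_max_left _ _)
  exact_mod_cast this.ne'

theorem clampDisc_mem (z : ℂ) : clampDisc z ∈ closedBall (0 : ℂ) 1 := by
  have : (0 : ℝ) < max 1 ‖z‖ := lt_of_lt_of_le one_pos (le_max_left _ _)
  rw [mem_closedBall_zero_iff, clampDisc, norm_div, Complex.norm_real, Real.norm_eq_abs,
    abs_of_pos this, div_le_one this]
  exact le_max_right _ _

theorem clampDisc_of_mem {z : ℂ} (hz : z ∈ closedBall (0 : ℂ) 1) : clampDisc z = z := by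
  rw [mem_closedBall_zero_iff] at hz
  simp [clampDisc, max_eq_left hz]

theorem hasLog_closedBall {f : ℂ → ℂ} (hf : ContinuousOn f (closedBall 0 1))
    (h0 : ∀ x ∈ closedBall (0 : ℂ) 1, f x ≠ 0) : HasLog f (closedBall 0 1) := by
  have h1 : Continuous (fun z : ℂ => f (clampDisc z)) :=
    hf.comp_continuous continuous_clampDisc clampDisc_mem
  refine ((hasLog_univ h1 fun t => h0 _ (clampDisc_mem t)).mono (subset_univ _)).congr ?_
  intro x hx
  rw [clampDisc_of_mem hx]

/-- The coordinate on a circle around the origin has no logarithm. -/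
theorem not_hasLog_circle {R : ℝ} (hR : 0 < R) : ¬ HasLog (fun z : ℂ => z) (sphere 0 R) := by
  rintro ⟨L, hL, he⟩
  have hm : ∀ t : ℝ, (R : ℂ) * Complex.exp (t * Complex.I) ∈ sphere (0 : ℂ) R := fun t => by
    simp [Complex.norm_exp_ofReal_mul_I, abs_of_pos hR]
  obtain ⟨c, -, h⟩ := log_unique (K := (univ : Set ℝ)) isPreconnected_univ
    (g := fun t : ℝ => L (R * Complex.exp (t * Complex.I)))
    (g' := fun t : ℝ => (Real.log R : ℂ) + t * Complex.I)
    (hL.comp (by fun_prop) fun t _ => hm t) (by fun_prop) (fun t _ => by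
      rw [he _ (hm t), Complex.exp_add, ← Complex.ofReal_exp, Real.exp_log hR])
  have h0 := h 0 (mem_univ _)
  have h1 := h (2 * Real.pi) (mem_univ _)
  simp only [Complex.ofReal_zero, zero_mul, Complex.exp_zero] at h0
  simp only [Complex.ofReal_mul, Complex.ofReal_ofNat, Complex.exp_two_pi_mul_I] at h1
  rw [h0] at h1
  have : (2 : ℂ) * Real.pi * Complex.I = 0 := by linear_combination -h1
  exact Complex.two_pi_I_ne_zero this

section Planar

variable {O K : Set ℂ} {a b : ℂ}

theorem no_ext_of_frontier (hb : Bornology.IsBounded O) (ha : a ∈ O) {h : ℂ → ℂ}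
    (hc : ContinuousOn h (closure O)) (hnz : ∀ z ∈ closure O, h z ≠ 0)
    (hf : ∀ z ∈ frontier O, h z = z - a) : False := by
  classical
  have hF : Continuous (fun z => if z ∈ closure O then h z else z - a) := by
    refine continuous_if (fun z hz => ?_) ?_ (by fun_prop)
    · have : z ∈ frontier O := frontier_closure_subset hz
      exact hf z this
    · have : closure {x | x ∈ closure O} = closure O := isClosed_closure.closure_eq
      rwa [this]
  obtain ⟨L, hL, he⟩ := hasLog_univ hF fun z => by
    by_cases hz : z ∈ closure O
    · simpa [hz] using hnz z hz
    · simp only [hz, if_false]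
      exact sub_ne_zero.2 fun h => hz (h ▸ subset_closure ha)
  obtain ⟨R, hR0, hR⟩ := hb.closure.subset_ball_lt 0 a
  refine not_hasLog_circle hR0 ⟨fun z => L (a + z), (hL.comp (by fun_prop) (mapsTo_univ _ _)), ?_⟩
  intro z hz
  have : a + z ∉ closure O := fun hz' => by
    have := hR hz'
    rw [mem_sphere_zero_iff_norm] at hz
    simp [hz] at this
  simp [he _ (mem_univ _), this]

theorem exists_continuous_ext (hK : IsClosed K) {g : ℂ → ℂ} (hg : ContinuousOn g K) :
    ∃ G : ℂ → ℂ, Continuous G ∧ EqOn G g K := by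
  obtain ⟨G, hG⟩ := ContinuousMap.exists_restrict_eq hK ⟨K.domRestrict g, hg.domRestrict⟩
  exact ⟨G, G.continuous, fun x hx => congrArg (fun F : C(K, ℂ) => F ⟨x, hx⟩) hG⟩

theorem not_hasLog_frontier (hb : Bornology.IsBounded O) (ha : a ∈ O) :
    ¬ HasLog (fun z => z - a) (frontier O) := by
  rintro ⟨g, hg, he⟩
  obtain ⟨G, hG, hGg⟩ := exists_continuous_ext isClosed_frontier hg
  exact no_ext_of_frontier hb ha (h := fun z => Complex.exp (G z)) (by fun_prop)
    (fun z _ => Complex.exp_ne_zero _) fun z hz => by rw [hGg hz, he z hz]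

theorem not_hasLog_frontier_div (hb : Bornology.IsBounded O) (ha : a ∈ O)
    (hbO : b ∉ closure O) : ¬ HasLog (fun z => (z - a) / (z - b)) (frontier O) := by
  rintro ⟨g, hg, he⟩
  obtain ⟨G, hG, hGg⟩ := exists_continuous_ext isClosed_frontier hg
  have hne : ∀ z ∈ closure O, z - b ≠ 0 := fun z hz => sub_ne_zero.2 fun h => hbO (h ▸ hz)
  refine no_ext_of_frontier hb ha (h := fun z => (z - b) * Complex.exp (G z)) (by fun_prop)
    (fun z hz => mul_ne_zero (hne z hz) (Complex.exp_ne_zero _)) fun z hz => ?_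
  rw [hGg hz, he z hz, mul_div_cancel₀ _ (hne z (frontier_subset_closure hz))]

theorem hasLog_div_of_joined {T : Set ℂ} (hK : IsCompact K) (hT : IsPreconnected T)
    (hd : Disjoint T K) (ha : a ∈ T) (hb : b ∈ T) : HasLog (fun z => (z - a) / (z - b)) K := by
  have hne : ∀ x ∈ T, ∀ z ∈ K, z - x ≠ 0 := fun x hx z hz =>
    sub_ne_zero.2 fun h => hd.le_bot ⟨hx, h ▸ hz⟩
  refine hT.induction₂' (fun a b => HasLog (fun z => (z - a) / (z - b)) K) ?_ ?_ ha hb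
  · intro x hx
    have hxK : x ∈ Kᶜ := fun h => hd.le_bot ⟨hx, h⟩
    obtain ⟨ε, hε, hball⟩ := Metric.isOpen_iff.1 hK.isClosed.isOpen_compl x hxK
    have key : ∀ y ∈ T, dist y x < ε → HasLog (fun z => (z - y) / (z - x)) K := fun y hy hyx => by
      refine hasLog_of_slitPlane (ContinuousOn.div (by fun_prop) (by fun_prop) (hne x hx)) ?_
      intro z hz
      have h1 : (z - y) / (z - x) = 1 + (x - y) / (z - x) := by
        field_simp [hne x hx z hz]
        ring
      rw [h1]
      refine Complex.mem_slitPlane_of_norm_lt_one ?_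
      have h2 : ε ≤ ‖z - x‖ := by
        by_contra! h
        exact hball (by rwa [mem_ball, dist_eq_norm]) hz
      rw [norm_div, div_lt_one (hε.trans_le h2), ← norm_neg, neg_sub, ← dist_eq_norm]
      exact hyx.trans_le h2
    filter_upwards [self_mem_nhdsWithin, mem_nhdsWithin_of_mem_nhds (ball_mem_nhds x hε)]
      with y hy hyx
    refine ⟨(key y hy hyx).inv.congr fun z _ => inv_div _ _, key y hy hyx⟩
  · intro x y z hx hy hz h1 h2
    refine (h1.mul h2).congr fun w hw => ?_
    have := hne y hy w hw
    have := hne z hz w hw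
    field_simp

theorem hasLog_sub_of_joined {T : Set ℂ} (hK : IsCompact K) (hT : IsPreconnected T)
    (hd : Disjoint T K) (ha : a ∈ T) (hb : b ∈ T) (hbK : K ⊆ ball 0 ‖b‖) :
    HasLog (fun z => z - a) K := by
  have h1 : HasLog (fun z : ℂ => z - b) K := by
    rcases K.eq_empty_or_nonempty with rfl | ⟨x₀, hx₀⟩
    · exact ⟨fun _ => 0, by simp, by simp⟩
    have hb0 : 0 < ‖b‖ := (norm_nonneg _).trans_lt (mem_ball_zero_iff.1 (hbK hx₀))
    have hb0' : b ≠ 0 := norm_pos_iff.1 hb0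
    have h2 : HasLog (fun z : ℂ => 1 + (-z / b)) K := by
      refine hasLog_of_slitPlane (by fun_prop) fun z hz => Complex.mem_slitPlane_of_norm_lt_one ?_
      rw [norm_div, div_lt_one hb0, norm_neg]
      exact mem_ball_zero_iff.1 (hbK hz)
    refine ((hasLog_const (neg_ne_zero.2 hb0')).mul h2).congr fun z _ => ?_
    field_simp
    ring
  refine ((hasLog_div_of_joined hK hT hd ha hb).mul h1).congr fun z hz => ?_
  have : z - b ≠ 0 := sub_ne_zero.2 fun h => hd.le_bot ⟨hb, h ▸ hz⟩
  field_simp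

theorem janiszewski {K₁ K₂ T₁ T₂ : Set ℂ} (hK₁ : IsCompact K₁) (hK₂ : IsCompact K₂)
    (hK : IsPreconnected (K₁ ∩ K₂)) (hT₁ : IsPreconnected T₁) (hT₂ : IsPreconnected T₂)
    (hd₁ : Disjoint T₁ K₁) (hd₂ : Disjoint T₂ K₂) (ha₁ : a ∈ T₁) (hb₁ : b ∈ T₁)
    (ha₂ : a ∈ T₂) (hb₂ : b ∈ T₂) (hO : IsOpen O) (hOb : Bornology.IsBounded O)
    (hf : frontier O ⊆ K₁ ∪ K₂) (ha : a ∈ O) : b ∈ O := by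
  by_contra hb
  have hbc : b ∉ closure O := fun h => by
    rcases hf ⟨h, by rwa [hO.interior_eq]⟩ with h | h
    · exact hd₁.le_bot ⟨hb₁, h⟩
    · exact hd₂.le_bot ⟨hb₂, h⟩
  exact not_hasLog_frontier_div hOb ha hbc (((hasLog_div_of_joined hK₁ hT₁ hd₁ ha₁ hb₁).union
    hK₁.isClosed hK₂.isClosed hK (hasLog_div_of_joined hK₂ hT₂ hd₂ ha₂ hb₂)).mono hf)

/-- Logarithms on all compact subsets of a planar domain assemble to one on the domain. -/
theorem hasLog_of_compact {V : Set ℂ} (hV : IsOpen V) (hc : IsPreconnected V) {f : ℂ → ℂ}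
    (h : ∀ K ⊆ V, IsCompact K → HasLog f K) : HasLog f V := by
  classical
  rcases V.eq_empty_or_nonempty with rfl | ⟨z₀, hz₀⟩
  · exact ⟨fun _ => 0, by simp, by simp⟩
  have hne : ∀ z ∈ V, f z ≠ 0 := fun z hz =>
    (h {z} (singleton_subset_iff.2 hz) isCompact_singleton).ne_zero rfl
  have hpc : IsPathConnected V := (hV.isConnected_iff_isPathConnected).1 ⟨⟨z₀, hz₀⟩, hc⟩
  have hex : ∀ z ∈ V, ∃ K ⊆ V, IsCompact K ∧ IsPreconnected K ∧ z₀ ∈ K ∧ K ∈ 𝓝 z := fun z hz => by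
    obtain ⟨ε, hε, hball⟩ := Metric.nhds_basis_closedBall.mem_iff.1 (hV.mem_nhds hz)
    obtain ⟨γ, hγ⟩ := hpc.joinedIn z₀ hz₀ z hz
    refine ⟨closedBall z ε ∪ range γ, union_subset hball (range_subset_iff.2 hγ),
      (isCompact_closedBall z ε).union (isCompact_range γ.continuous),
      IsPreconnected.union z (mem_closedBall_self hε.le) ⟨1, γ.target⟩
        (convex_closedBall z ε).isPreconnected (isPreconnected_range γ.continuous),
      Or.inr ⟨0, γ.source⟩, Filter.mem_of_superset (closedBall_mem_nhds z hε) subset_union_left⟩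
  have hnorm : ∀ K ⊆ V, IsCompact K → z₀ ∈ K → ∃ g : ℂ → ℂ, ContinuousOn g K ∧
      (∀ x ∈ K, Complex.exp (g x) = f x) ∧ g z₀ = Complex.log (f z₀) := by
    intro K hKV hK hzK
    obtain ⟨g, hg, he⟩ := h K hKV hK
    refine ⟨fun x => g x + (Complex.log (f z₀) - g z₀), hg.add continuousOn_const, ?_, by ring⟩
    intro x hx
    rw [Complex.exp_add, he x hx, Complex.exp_sub, he z₀ hzK, Complex.exp_log (hne z₀ hz₀),
      div_self (hne z₀ hz₀), mul_one]
  have huniq : ∀ K, IsPreconnected K → z₀ ∈ K → ∀ g g' : ℂ → ℂ, ContinuousOn g K →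
      ContinuousOn g' K → (∀ x ∈ K, Complex.exp (g x) = f x) →
      (∀ x ∈ K, Complex.exp (g' x) = f x) → g z₀ = g' z₀ → EqOn g g' K := by
    intro K hK hzK g g' hg hg' he he' h0 x hx
    obtain ⟨c, -, hc⟩ := log_unique hK hg hg' fun x hx => (he x hx).trans (he' x hx).symm
    have hc0 : c = 0 := by linear_combination h0 - hc z₀ hzK
    rw [hc x hx, hc0, add_zero]
  choose! K hKV hKc hKp hKz hKn using hex
  choose! g hg he hgz using hnorm
  have key : ∀ z ∈ V, ∀ w ∈ K z, g (K w) w = g (K z) w := by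
    intro z hz w hw
    have hwV := hKV z hz hw
    have hsub : K w ∪ K z ⊆ V := union_subset (hKV w hwV) (hKV z hz)
    have hcpt : IsCompact (K w ∪ K z) := (hKc w hwV).union (hKc z hz)
    have hz0 : z₀ ∈ K w ∪ K z := Or.inl (hKz w hwV)
    rw [huniq (K w) (hKp w hwV) (hKz w hwV) (g (K w)) (g (K w ∪ K z))
      (hg _ (hKV w hwV) (hKc w hwV) (hKz w hwV)) ((hg _ hsub hcpt hz0).mono subset_union_left)
      (he _ (hKV w hwV) (hKc w hwV) (hKz w hwV)) (fun x hx => he _ hsub hcpt hz0 x (Or.inl hx))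
      (by rw [hgz _ hsub hcpt hz0, hgz _ (hKV w hwV) (hKc w hwV) (hKz w hwV)])
      (mem_of_mem_nhds (hKn w hwV)),
      huniq (K z) (hKp z hz) (hKz z hz) (g (K z)) (g (K w ∪ K z))
      (hg _ (hKV z hz) (hKc z hz) (hKz z hz)) ((hg _ hsub hcpt hz0).mono subset_union_right)
      (he _ (hKV z hz) (hKc z hz) (hKz z hz)) (fun x hx => he _ hsub hcpt hz0 x (Or.inr hx))
      (by rw [hgz _ hsub hcpt hz0, hgz _ (hKV z hz) (hKc z hz) (hKz z hz)]) hw]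
  refine ⟨fun z => g (K z) z, fun z hz => ContinuousAt.continuousWithinAt ?_, fun z hz =>
    he _ (hKV z hz) (hKc z hz) (hKz z hz) z (mem_of_mem_nhds (hKn z hz))⟩
  have h1 : ContinuousAt (g (K z)) z :=
    (hg _ (hKV z hz) (hKc z hz) (hKz z hz)).continuousAt (hKn z hz)
  refine h1.congr ?_
  filter_upwards [hKn z hz] with w hw using (key z hz w hw).symm

end Planar

theorem montel {l : Ultrafilter ℕ} {F : ℕ → ℂ → ℂ} {U : Set ℂ} {R : ℝ}
    (h : ∀ z ∈ U, ∃ ε > 0, ∀ᶠ n in (l : Filter ℕ), DifferentiableOn ℂ (F n) (ball z ε) ∧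
      ∀ w ∈ ball z ε, ‖F n w‖ ≤ R) :
    ∃ G : ℂ → ℂ, TendstoLocallyUniformlyOn F G (l : Filter ℕ) U ∧
      ∀ z ∈ U, ∃ ε > 0, DifferentiableOn ℂ G (ball z ε) := by
  have hlim : ∀ w, (∀ᶠ n in (l : Filter ℕ), ‖F n w‖ ≤ R) →
      ∃ y, Tendsto (fun n => F n w) (l : Filter ℕ) (𝓝 y) := fun w hw => by
    obtain ⟨y, -, hy⟩ := (isCompact_closedBall (0 : ℂ) R).ultrafilter_le_nhds
      (l.map fun n => F n w) (by
        rw [le_principal_iff]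
        exact hw.mono fun n hn => by simpa using hn)
    exact ⟨y, hy⟩
  have hex : ∀ w, ∃ y, (∀ᶠ n in (l : Filter ℕ), ‖F n w‖ ≤ R) →
      Tendsto (fun n => F n w) (l : Filter ℕ) (𝓝 y) := fun w => by
    by_cases hw : ∀ᶠ n in (l : Filter ℕ), ‖F n w‖ ≤ R
    · exact (hlim w hw).imp fun y hy _ => hy
    · exact ⟨0, fun h => absurd h hw⟩
  choose G hG using hex
  have hunif : ∀ z ε, 0 < ε → (∀ᶠ n in (l : Filter ℕ), DifferentiableOn ℂ (F n) (ball z ε) ∧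
      ∀ w ∈ ball z ε, ‖F n w‖ ≤ R) → TendstoLocallyUniformlyOn F G (l : Filter ℕ) (ball z ε) := by
    intro z ε hε hn
    rw [Metric.tendstoLocallyUniformlyOn_iff]
    intro η hη x hx
    obtain ⟨ρ, hρ, hρε⟩ := Metric.isOpen_iff.1 isOpen_ball x hx
    obtain ⟨n₀, hn₀⟩ := hn.exists
    have hR : 0 ≤ R := (norm_nonneg _).trans (hn₀.2 x hx)
    set C := (2 * R + 1) / ρ
    have hC : 0 < C := by positivity
    have hlip : ∀ n, (DifferentiableOn ℂ (F n) (ball z ε) ∧ ∀ w ∈ ball z ε, ‖F n w‖ ≤ R) →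
        ∀ y ∈ ball x ρ, dist (F n y) (F n x) ≤ C * dist y x := by
      rintro n ⟨hd, hb⟩ y hy
      refine Complex.dist_le_div_mul_dist_of_mapsTo_ball (hd.mono hρε) (fun w hw => ?_) hy
      rw [mem_closedBall, dist_eq_norm]
      have := norm_sub_le (F n w) (F n x)
      have := hb w (hρε hw)
      have := hb x hx
      linarith
    have hb : ∀ y ∈ ball z ε, Tendsto (fun n => F n y) (l : Filter ℕ) (𝓝 (G y)) := fun y hy =>
      hG y (hn.mono fun n h => h.2 y hy)
    have hlipG : ∀ y ∈ ball x ρ, dist (G y) (G x) ≤ C * dist y x := fun y hy =>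
      le_of_tendsto ((hb y (hρε hy)).dist (hb x hx)) (hn.mono fun n h => hlip n h y hy)
    refine ⟨ball x (min ρ (η / (4 * C))), mem_nhdsWithin_of_mem_nhds
      (ball_mem_nhds x (by positivity)), ?_⟩
    have hx0 := (Metric.tendsto_nhds.1 (hb x hx)) (η / 4) (by positivity)
    filter_upwards [hn, hx0] with n h1 h2 y hy
    have hyρ : y ∈ ball x ρ := ball_subset_ball (min_le_left _ _) hy
    have hyη : C * dist y x ≤ η / 4 := by
      have : dist y x < η / (4 * C) := lt_of_lt_of_le hy (min_le_right _ _)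
      rw [lt_div_iff₀ (by positivity)] at this
      linarith
    have e1 := hlip n h1 y hyρ
    have e2 := hlipG y hyρ
    have e3 := dist_triangle4 (G y) (G x) (F n x) (F n y)
    rw [dist_comm (G x), dist_comm (F n x) (F n y)] at e3
    linarith
  refine ⟨G, ?_, fun z hz => ?_⟩
  · intro u hu z hz
    obtain ⟨ε, hε, hn⟩ := h z hz
    obtain ⟨t, ht, h'⟩ := hunif z ε hε hn u hu z (mem_ball_self hε)
    rw [isOpen_ball.nhdsWithin_eq (mem_ball_self hε)] at ht
    exact ⟨t, mem_nhdsWithin_of_mem_nhds ht, h'⟩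
  · obtain ⟨ε, hε, hn⟩ := h z hz
    exact ⟨ε, hε, (hunif z ε hε hn).differentiableOn (hn.mono fun n h => h.1) isOpen_ball⟩

theorem hurwitz {l : Filter ℕ} [l.NeBot] {F : ℕ → ℂ → ℂ} {G : ℂ → ℂ} {U : Set ℂ} {p : ℂ}
    (hU : IsOpen U) (hUc : IsPreconnected U) (hF : TendstoLocallyUniformlyOn F G l U)
    (hG : DifferentiableOn ℂ G U)
    (h : ∀ z ∈ U, ∃ ε > 0, ∀ᶠ n in l, DifferentiableOn ℂ (F n) (ball z ε) ∧
      ∀ w ∈ ball z ε, F n w ≠ p) (hne : ∃ z ∈ U, G z ≠ p) : ∀ z ∈ U, G z ≠ p := by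
  intro z hz hzp
  obtain ⟨w, hw, hwp⟩ := hne
  have han : AnalyticOnNhd ℂ (fun z => G z - p) U := (hG.sub_const p).analyticOnNhd hU
  rcases (han z hz).eventually_eq_zero_or_eventually_ne_zero with h0 | h0
  · exact hwp (sub_eq_zero.1 (han.eqOn_zero_of_preconnected_of_eventuallyEq_zero hUc hz h0 hw))
  obtain ⟨ε, hε, hn⟩ := h z hz
  rw [eventually_nhdsWithin_iff] at h0
  obtain ⟨δ, hδ, hδ'⟩ := Metric.nhds_basis_closedBall.mem_iff.1
    (inter_mem (inter_mem h0 (hU.mem_nhds hz)) (ball_mem_nhds z hε))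
  have hcont : ContinuousOn (fun x => ‖G x - p‖) (sphere z δ) :=
    ((hG.continuousOn.mono fun x hx => (hδ' (sphere_subset_closedBall hx)).1.2).sub
      continuousOn_const).norm
  obtain ⟨x₀, hx₀, hmin⟩ := (isCompact_sphere z δ).exists_isMinOn
    (NormedSpace.sphere_nonempty.2 hδ.le) hcont
  set m := ‖G x₀ - p‖
  have hm : 0 < m := by
    refine norm_pos_iff.2 ((hδ' (sphere_subset_closedBall hx₀)).1.1 ?_)
    rintro rfl
    simp at hx₀
    exact hδ.ne hx₀
  have hunif := (tendstoLocallyUniformlyOn_iff_forall_isCompact hU).1 hF (closedBall z δ)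
    (fun x hx => (hδ' hx).1.2) (isCompact_closedBall z δ)
  obtain ⟨n, ⟨hd, hnp⟩, hclose⟩ := (hn.and (Metric.tendstoUniformlyOn_iff.1 hunif (m / 2)
    (by positivity))).exists
  have hball : closedBall z δ ⊆ ball z ε := fun x hx => (hδ' hx).2
  have hdc : DiffContOnCl ℂ (fun x => (F n x - p)⁻¹) (ball z δ) := by
    refine DifferentiableOn.diffContOnCl ?_
    rw [closure_ball z hδ.ne']
    exact ((hd.mono hball).sub_const p).inv fun x hx => sub_ne_zero.2 (hnp x (hball hx))
  have key := Complex.norm_le_of_forall_mem_frontier_norm_le (C := (m / 2)⁻¹) isBounded_ball hdc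
    (fun x hx => by
      rw [frontier_ball z hδ.ne'] at hx
      rw [norm_inv]
      refine inv_anti₀ (by positivity) ?_
      have h1 : m ≤ ‖G x - p‖ := hmin hx
      have h2 := hclose x (sphere_subset_closedBall hx)
      rw [dist_eq_norm] at h2
      have h3 : ‖G x - p‖ ≤ ‖G x - F n x‖ + ‖F n x - p‖ := norm_sub_le_norm_sub_add_norm_sub _ _ _
      linarith) (subset_closure (mem_ball_self hδ))
  have hpos : 0 < ‖F n z - p‖ := norm_pos_iff.2 (sub_ne_zero.2 (hnp z (mem_ball_self hε)))
  rw [norm_inv, inv_le_inv₀ hpos (by positivity)] at key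
  have h2 := hclose z (mem_closedBall_self hδ.le)
  rw [dist_comm, dist_eq_norm, hzp] at h2
  linarith

/-- The disc automorphism exchanging `a` with the origin. -/
def mob (a z : ℂ) : ℂ := (z - a) / (1 - (starRingEnd ℂ) a * z)

section Mob

variable {a z : ℂ}

theorem mob_denom_ne (ha : ‖a‖ < 1) (hz : ‖z‖ ≤ 1) : 1 - (starRingEnd ℂ) a * z ≠ 0 := by
  intro h
  have h1 : (starRingEnd ℂ) a * z = 1 := (sub_eq_zero.1 h).symm
  have h2 : ‖(starRingEnd ℂ) a * z‖ = 1 := by rw [h1, norm_one]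
  rw [norm_mul, RCLike.norm_conj] at h2
  nlinarith [norm_nonneg a, norm_nonneg z]

theorem mob_normSq (a z : ℂ) : ‖1 - (starRingEnd ℂ) a * z‖ ^ 2 - ‖z - a‖ ^ 2 =
    (1 - ‖a‖ ^ 2) * (1 - ‖z‖ ^ 2) := by
  simp only [← Complex.normSq_eq_norm_sq, Complex.normSq_apply]
  simp
  ring

theorem norm_mob_le (ha : ‖a‖ < 1) (hz : ‖z‖ ≤ 1) : ‖mob a z‖ ≤ 1 := by
  have h := mob_normSq a z
  have h0 := norm_pos_iff.2 (mob_denom_ne ha hz)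
  rw [mob, norm_div, div_le_one h0]
  have h1 : 0 ≤ (1 - ‖a‖ ^ 2) * (1 - ‖z‖ ^ 2) :=
    mul_nonneg (by nlinarith [norm_nonneg a]) (by nlinarith [norm_nonneg z])
  exact le_of_sq_le_sq (by linarith) h0.le

theorem norm_mob_lt (ha : ‖a‖ < 1) (hz : ‖z‖ < 1) : ‖mob a z‖ < 1 := by
  have h := mob_normSq a z
  have h0 := norm_pos_iff.2 (mob_denom_ne ha hz.le)
  rw [mob, norm_div, div_lt_one h0]
  have h1 : 0 < (1 - ‖a‖ ^ 2) * (1 - ‖z‖ ^ 2) :=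
    mul_pos (by nlinarith [norm_nonneg a]) (by nlinarith [norm_nonneg z])
  exact lt_of_pow_lt_pow_left₀ 2 h0.le (by linarith)

theorem mob_neg_mob (ha : ‖a‖ < 1) (hz : ‖z‖ ≤ 1) : mob (-a) (mob a z) = z := by
  have h1 := mob_denom_ne ha hz
  have h2 := mob_denom_ne (a := -a) (by simpa using ha) (norm_mob_le ha hz)
  have hM : mob a z * (1 - (starRingEnd ℂ) a * z) = z - a := div_mul_cancel₀ _ h1
  rw [mob, div_eq_iff h2, map_neg]
  linear_combination hM

theorem mob_self (a : ℂ) : mob a a = 0 := by simp [mob]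

theorem mob_zero (a : ℂ) : mob a 0 = -a := by simp [mob]

theorem continuousOn_mob (ha : ‖a‖ < 1) : ContinuousOn (mob a) (closedBall 0 1) :=
  ContinuousOn.div (by fun_prop) (by fun_prop) fun z hz =>
    mob_denom_ne ha (mem_closedBall_zero_iff.1 hz)

theorem hasDerivAt_mob (ha : ‖a‖ < 1) (hz : ‖z‖ < 1) : HasDerivAt (mob a)
    ((1 - ‖a‖ ^ 2) / (1 - (starRingEnd ℂ) a * z) ^ 2) z := by
  have h1 := mob_denom_ne ha hz.le
  have h := ((hasDerivAt_id z).sub_const a).div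
    (((hasDerivAt_id z).const_mul ((starRingEnd ℂ) a)).const_sub 1) h1
  refine h.congr_deriv ?_
  rw [← Complex.conj_mul']
  simp
  ring

end Mob

theorem isOpen_image_of_injOn {W : Set ℂ} {f : ℂ → ℂ} (hW : IsOpen W) (hWc : IsPreconnected W)
    (hf : DifferentiableOn ℂ f W) (hi : InjOn f W) {s : Set ℂ} (hs : s ⊆ W) (hso : IsOpen s) :
    IsOpen (f '' s) := by
  rcases s.eq_empty_or_nonempty with rfl | ⟨x, hx⟩
  · simp
  rcases (hf.analyticOnNhd hW).is_constant_or_isOpen hWc with ⟨w, hw⟩ | h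
  · exfalso
    obtain ⟨ε, hε, hb⟩ := Metric.isOpen_iff.1 hW x (hs hx)
    have hy : x + (ε / 2 : ℝ) ∈ W := hb (by
      simp [abs_of_pos hε]; linarith)
    have := hi (hs hx) hy ((hw _ (hs hx)).trans (hw _ hy).symm)
    have h2 : ((ε / 2 : ℝ) : ℂ) = 0 := by linear_combination -this
    norm_cast at h2
    linarith
  · exact h s hs hso

theorem hasDerivAt_of_sq {s h : ℂ → ℂ} {z h' : ℂ} (hs : ContinuousAt s z)
    (hsq : ∀ᶠ w in 𝓝 z, s w ^ 2 = h w) (hd : HasDerivAt h h' z) (h0 : s z ≠ 0) :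
    HasDerivAt s (h' / (2 * s z)) z := by
  rw [hasDerivAt_iff_tendsto_slope] at hd ⊢
  have h1 : Tendsto (fun w => s w + s z) (𝓝 z) (𝓝 (2 * s z)) := by
    rw [two_mul]
    exact hs.tendsto.add_const _
  have h2 : 2 * s z ≠ 0 := mul_ne_zero two_ne_zero h0
  refine (hd.div (h1.mono_left nhdsWithin_le_nhds) h2).congr' ?_
  filter_upwards [self_mem_nhdsWithin, mem_nhdsWithin_of_mem_nhds hsq,
    mem_nhdsWithin_of_mem_nhds (h1.eventually_ne h2)] with w hw hw1 hw2
  rw [Pi.div_apply, slope_def_field, slope_def_field, ← hw1, ← hsq.self_of_nhds, sq_sub_sq]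
  field_simp

/-- The complement of `V` in the closed unit disc is preconnected. -/
def DiscFull (V : Set ℂ) : Prop := IsPreconnected (closedBall (0 : ℂ) 1 \ V)

theorem DiscFull.mob {V : Set ℂ} (hV : V ⊆ ball 0 1) (h : DiscFull V) {a : ℂ} (ha : ‖a‖ < 1) :
    DiscFull (mob a '' V) := by
  have hna : ‖-a‖ < 1 := by simpa using ha
  have hcb : ∀ z, z ∈ closedBall (0 : ℂ) 1 ↔ ‖z‖ ≤ 1 := fun z => mem_closedBall_zero_iff
  have : closedBall (0 : ℂ) 1 \ PlaneTop.mob a '' V =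
      PlaneTop.mob a '' (closedBall (0 : ℂ) 1 \ V) := by
    ext z
    simp only [Set.mem_sdiff, mem_image, hcb]
    constructor
    · rintro ⟨h1, h2⟩
      have h3 := mob_neg_mob hna h1
      rw [neg_neg] at h3
      exact ⟨PlaneTop.mob (-a) z, ⟨norm_mob_le hna h1, fun h4 => h2 ⟨_, h4, h3⟩⟩, h3⟩
    · rintro ⟨x, ⟨hx, hxV⟩, rfl⟩
      refine ⟨norm_mob_le ha hx, ?_⟩
      rintro ⟨y, hy, hyx⟩
      have hy1 : ‖y‖ ≤ 1 := (hcb y).1 (ball_subset_closedBall (hV hy))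
      have := mob_neg_mob ha hx
      rw [← hyx, mob_neg_mob ha hy1] at this
      exact hxV (this ▸ hy)
  rw [DiscFull, this]
  exact h.image _ ((continuousOn_mob ha).mono sdiff_subset)

theorem DiscFull.hasLog {V : Set ℂ} (hVo : IsOpen V) (hVc : IsPreconnected V)
    (hV : V ⊆ ball 0 1) (h : DiscFull V) {a : ℂ} (ha : ‖a‖ < 1) (haV : a ∉ V) :
    HasLog (PlaneTop.mob a) V := by
  have h1 : HasLog (fun z => z - a) V := by
    refine hasLog_of_compact hVo hVc fun K hKV hK => ?_
    have hseg : ∀ z ∈ segment ℝ (1 : ℂ) 2, 1 ≤ ‖z‖ := by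
      rintro z ⟨s, t, hs, ht, hst, rfl⟩
      have e : s • (1 : ℂ) + t • (2 : ℂ) = ((s + t * 2 : ℝ) : ℂ) := by simp
      rw [e, Complex.norm_real, Real.norm_eq_abs]
      exact le_trans (by linarith) (le_abs_self _)
    refine hasLog_sub_of_joined (T := (closedBall 0 1 \ V) ∪ segment ℝ 1 2) (b := 2) hK ?_ ?_
      (Or.inl ⟨by simpa using ha.le, haV⟩) (Or.inr (right_mem_segment ℝ _ _)) ?_
    · refine IsPreconnected.union 1 ⟨by simp, fun h1 => ?_⟩ (left_mem_segment ℝ _ _) h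
        (convex_segment _ _).isPreconnected
      simpa using hV h1
    · rw [Set.disjoint_left]
      rintro z (hz | hz) hzK
      · exact hz.2 (hKV hzK)
      · have := hV (hKV hzK)
        rw [mem_ball_zero_iff] at this
        linarith [hseg z hz]
    · refine (hKV.trans hV).trans (ball_subset_ball ?_)
      simp
  have h2 : HasLog (fun z => 1 - (starRingEnd ℂ) a * z) V := by
    refine hasLog_of_slitPlane (by fun_prop) fun z hz => ?_
    rw [sub_eq_add_neg]
    refine Complex.mem_slitPlane_of_norm_lt_one ?_
    rw [norm_neg, norm_mul, RCLike.norm_conj]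
    have := mem_ball_zero_iff.1 (hV hz)
    nlinarith [norm_nonneg a, norm_nonneg z]
  exact h1.div h2

theorem discFull_of_sq {V : Set ℂ} (hVo : IsOpen V) (hVc : IsPreconnected V) (hne : V.Nonempty)
    (hV : V ⊆ ball 0 1) (hd : ∀ z ∈ V, -z ∉ V) (h : DiscFull ((fun z => z ^ 2) '' V)) :
    DiscFull V := by
  set Q := {z ∈ closedBall (0 : ℂ) 1 | z ∉ V ∧ -z ∉ V} with hQ
  have hcb : ∀ z, z ∈ closedBall (0 : ℂ) 1 ↔ ‖z‖ ≤ 1 := fun z => mem_closedBall_zero_iff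
  have h0V : (0 : ℂ) ∉ V := fun h0 => hd 0 h0 (by simpa using h0)
  have hQs : ∀ z ∈ Q, -z ∈ Q := fun z hz =>
    ⟨by simpa using hz.1, hz.2.2, by simpa using hz.2.1⟩
  have hsq : ∀ z ∈ closedBall (0 : ℂ) 1 \ (fun z => z ^ 2) '' V, ∃ y ∈ Q, y ^ 2 = z := by
    rintro z ⟨hz, hzV⟩
    obtain ⟨y, hy⟩ := IsAlgClosed.exists_pow_nat_eq z two_pos
    subst hy
    refine ⟨y, ⟨?_, fun h => hzV ⟨y, h, rfl⟩, fun h => hzV ⟨-y, h, by simp⟩⟩, rfl⟩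
    rw [hcb, norm_pow] at hz
    rw [hcb]
    nlinarith [norm_nonneg y]
  have hQsq : ∀ y ∈ Q, y ^ 2 ∈ closedBall (0 : ℂ) 1 \ (fun z => z ^ 2) '' V := by
    rintro y ⟨hy, hy1, hy2⟩
    rw [hcb] at hy
    refine ⟨by rw [hcb, norm_pow]; nlinarith [norm_nonneg y], ?_⟩
    rintro ⟨x, hx, hxy⟩
    rcases sq_eq_sq_iff_eq_or_eq_neg.1 hxy with rfl | rfl
    · exact hy1 hx
    · exact hy2 hx
  have hQc : IsClosed Q := by
    have : Q = closedBall (0 : ℂ) 1 ∩ (Vᶜ ∩ (fun z => -z) ⁻¹' Vᶜ) := rfl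
    rw [this]
    exact isClosed_closedBall.inter (hVo.isClosed_compl.inter
      (hVo.isClosed_compl.preimage continuous_neg))
  have hQcpt : IsCompact Q := (isCompact_closedBall (0 : ℂ) 1).of_isClosed_subset hQc fun z hz => hz.1
  have h0Q : (0 : ℂ) ∈ Q := ⟨by simp, h0V, by simpa using h0V⟩
  have hQp : IsPreconnected Q := by
    -- it suffices to exclude a separation with `0` in the first piece
    have main : ∀ A B : Set ℂ, IsClosed A → IsClosed B → Q ⊆ A ∪ B → Q ∩ (A ∩ B) = ∅ → 0 ∈ A →
        Q ∩ B = ∅ := by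
      intro A B hA hB hQAB hAB h0A
      by_contra hne
      obtain ⟨y, hyQ, hyB⟩ := nonempty_iff_ne_empty.2 hne
      have hdis : ∀ z ∈ Q, z ∈ A → z ∈ B → False := fun z hz h1 h2 => by
        have : z ∈ Q ∩ (A ∩ B) := ⟨hz, h1, h2⟩
        rwa [hAB] at this
      have c1 : IsClosed ((fun z : ℂ => z ^ 2) '' (Q ∩ (A ∩ (fun z => -z) ⁻¹' A))) :=
        ((hQcpt.inter_right (hA.inter (hA.preimage continuous_neg))).image (by fun_prop)).isClosed
      have c2 : IsClosed ((fun z : ℂ => z ^ 2) '' (Q ∩ B)) :=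
        ((hQcpt.inter_right hB).image (by fun_prop)).isClosed
      obtain ⟨e, he, ⟨x, hx, rfl⟩, ⟨x', hx', hxx⟩⟩ := isPreconnected_closed_iff.1 h _ _ c1 c2
        (fun e he => by
          obtain ⟨x, hx, rfl⟩ := hsq e he
          by_cases hxA : x ∈ A
          · by_cases hnx : -x ∈ A
            · exact Or.inl ⟨x, ⟨hx, hxA, hnx⟩, rfl⟩
            · exact Or.inr ⟨-x, ⟨hQs x hx, (hQAB (hQs x hx)).resolve_left hnx⟩, by simp⟩
          · exact Or.inr ⟨x, ⟨hx, (hQAB hx).resolve_left hxA⟩, rfl⟩)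
        ⟨0, by simpa using hQsq 0 h0Q, 0, ⟨h0Q, h0A, by simpa using h0A⟩, by simp⟩
        ⟨y ^ 2, hQsq y hyQ, y, ⟨hyQ, hyB⟩, rfl⟩
      rcases sq_eq_sq_iff_eq_or_eq_neg.1 hxx with rfl | rfl
      · exact hdis _ hx'.1 hx.2.1 hx'.2
      · exact hdis _ hx'.1 hx.2.2 hx'.2
    rw [isPreconnected_closed_iff]
    intro A B hA hB hQAB ⟨x, hxQ, hxA⟩ ⟨y, hyQ, hyB⟩
    by_contra hne
    rw [not_nonempty_iff_eq_empty] at hne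
    rcases hQAB h0Q with h0 | h0
    · have := main A B hA hB hQAB hne h0
      exact (this ▸ (⟨hyQ, hyB⟩ : y ∈ Q ∩ B) : y ∈ (∅ : Set ℂ))
    · have := main B A hB hA (by rwa [union_comm]) (by rwa [inter_comm B]) h0
      exact (this ▸ (⟨hxQ, hxA⟩ : x ∈ Q ∩ A) : x ∈ (∅ : Set ℂ))
  set N := (fun z : ℂ => -z) '' V with hN
  have hNpre : N = (fun z : ℂ => -z) ⁻¹' V := by
    ext z
    exact ⟨by rintro ⟨x, hx, rfl⟩; simpa using hx, fun hz => ⟨-z, hz, by simp⟩⟩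
  have hNo : IsOpen N := by
    rw [hNpre]
    exact hVo.preimage continuous_neg
  have hNp : IsPreconnected N := hVc.image _ (by fun_prop)
  have hNV : Disjoint V N := by
    rw [Set.disjoint_left, hNpre]
    exact hd
  have hNb : N ⊆ closedBall 0 1 := by
    rintro _ ⟨x, hx, rfl⟩
    simpa using (mem_ball_zero_iff.1 (hV hx)).le
  obtain ⟨q, hq⟩ : (frontier N).Nonempty := by
    rw [nonempty_iff_ne_empty, Ne, frontier_eq_empty_iff]
    rintro (h | h)
    · exact (hne.image _).ne_empty h
    · have : (2 : ℂ) ∈ N := h ▸ mem_univ _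
      have := hNb this
      simp at this
  have hqQ : q ∈ Q := by
    refine ⟨closure_minimal hNb isClosed_closedBall hq.1, fun hqV => ?_, fun hqN => ?_⟩
    · exact (hNV.closure_right hVo).le_bot ⟨hqV, hq.1⟩
    · rw [hNo.frontier_eq] at hq
      exact hq.2 (hNpre ▸ hqN)
  have hun : closedBall (0 : ℂ) 1 \ V = Q ∪ insert q N := by
    ext z
    constructor
    · rintro ⟨h1, h2⟩
      by_cases h3 : -z ∈ V
      · exact Or.inr (Or.inr (hNpre ▸ h3))
      · exact Or.inl ⟨h1, h2, h3⟩
    · rintro (hz | rfl | hz)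
      · exact ⟨hz.1, hz.2.1⟩
      · exact ⟨hqQ.1, hqQ.2.1⟩
      · exact ⟨hNb hz, fun hzV => hNV.le_bot ⟨hzV, hz⟩⟩
  rw [DiscFull, hun]
  exact IsPreconnected.union q hqQ (mem_insert _ _) hQp
    (hNp.subset_closure (subset_insert _ _) (insert_subset hq.1 subset_closure))

/-- The family of normalized injective holomorphic maps into the disc used in the
Riemann mapping theorem. -/
structure KoebeFam (W : Set ℂ) (w₀ : ℂ) (f : ℂ → ℂ) : Prop where
  diff : DifferentiableOn ℂ f W
  inj : InjOn f W
  maps : MapsTo f W (ball 0 1)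
  zero : f w₀ = 0
  full : DiscFull (f '' W)
  deriv_ne : ∀ w ∈ W, deriv f w ≠ 0

section Koebe

variable {W : Set ℂ} {w₀ : ℂ} {f : ℂ → ℂ}

theorem KoebeFam.step (hW : IsOpen W) (hWc : IsPreconnected W) (hw₀ : w₀ ∈ W)
    (hf : KoebeFam W w₀ f) {a : ℂ} (ha : ‖a‖ < 1) (haf : a ∉ f '' W) :
    ∃ F, KoebeFam W w₀ F ∧ ‖deriv F w₀‖ = ‖deriv f w₀‖ * ((1 + ‖a‖) / (2 * √‖a‖)) := by
  have hVb : f '' W ⊆ ball 0 1 := hf.maps.image_subset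
  have hVo : IsOpen (f '' W) := isOpen_image_of_injOn hW hWc hf.diff hf.inj Subset.rfl hW
  obtain ⟨g, hg, hge⟩ := hf.full.hasLog hVo (hWc.image f hf.diff.continuousOn) hVb ha haf
  have hfn : ∀ w ∈ W, ‖f w‖ < 1 := fun w hw => mem_ball_zero_iff.1 (hf.maps hw)
  set s : ℂ → ℂ := fun w => Complex.exp (g (f w) / 2) with hs
  have hsq : ∀ w ∈ W, s w ^ 2 = mob a (f w) := fun w hw => by
    rw [hs, ← Complex.exp_nat_mul, ← hge _ ⟨w, hw, rfl⟩]
    congr 1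
    push_cast
    ring
  have hsc : ContinuousOn s W := by
    have : ContinuousOn (fun w => g (f w)) W :=
      hg.comp hf.diff.continuousOn (mapsTo_image f W)
    exact Complex.continuous_exp.comp_continuousOn (this.div_const 2)
  have hs0 : ∀ w, s w ≠ 0 := fun w => Complex.exp_ne_zero _
  have hsd : ∀ w ∈ W, HasDerivAt s
      ((1 - ‖a‖ ^ 2) / (1 - (starRingEnd ℂ) a * f w) ^ 2 * deriv f w / (2 * s w)) w := by
    intro w hw
    have h1 : HasDerivAt f (deriv f w) w :=
      (hf.diff.differentiableAt (hW.mem_nhds hw)).hasDerivAt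
    exact hasDerivAt_of_sq (hsc.continuousAt (hW.mem_nhds hw))
      (by filter_upwards [hW.mem_nhds hw] with x hx using hsq x hx)
      ((hasDerivAt_mob ha (hfn w hw)).comp w h1) (hs0 w)
  have hsi : ∀ x ∈ W, ∀ y ∈ W, s x ^ 2 = s y ^ 2 → x = y := by
    intro x hx y hy hxy
    rw [hsq x hx, hsq y hy] at hxy
    have := mob_neg_mob ha (hfn x hx).le
    rw [hxy, mob_neg_mob ha (hfn y hy).le] at this
    exact hf.inj hx hy this.symm
  have hsn : ∀ w ∈ W, ‖s w‖ < 1 := fun w hw => by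
    have := norm_mob_lt ha (hfn w hw)
    rw [← hsq w hw, norm_pow] at this
    exact (pow_lt_one_iff_of_nonneg (norm_nonneg _) two_ne_zero).1 this
  have hsinj : InjOn s W := fun x hx y hy h => hsi x hx y hy (by rw [h])
  have hsdiff : DifferentiableOn ℂ s W := fun w hw =>
    (hsd w hw).differentiableAt.differentiableWithinAt
  have hsb : s '' W ⊆ ball 0 1 := by
    rintro _ ⟨w, hw, rfl⟩
    simpa using hsn w hw
  have hsfull : DiscFull (s '' W) := by
    refine discFull_of_sq (isOpen_image_of_injOn hW hWc hsdiff hsinj Subset.rfl hW)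
      (hWc.image _ hsc) ⟨_, w₀, hw₀, rfl⟩ hsb ?_ ?_
    · rintro _ ⟨x, hx, rfl⟩ ⟨y, hy, hyx⟩
      have : x = y := hsi x hx y hy (by rw [hyx]; ring)
      subst this
      exact hs0 x (by linear_combination hyx / 2)
    · have : (fun z => z ^ 2) '' (s '' W) = mob a '' (f '' W) := by
        rw [image_image, image_image]
        exact image_congr hsq
      rw [this]
      exact hf.full.mob hVb ha
  set b := s w₀
  have hb : ‖b‖ < 1 := hsn w₀ hw₀
  have hb2 : ‖b‖ ^ 2 = ‖a‖ := by
    rw [← norm_pow, hsq w₀ hw₀, hf.zero, mob_zero, norm_neg]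
  refine ⟨fun w => mob b (s w), ⟨?_, ?_, ?_, mob_self b, ?_, ?_⟩, ?_⟩
  · intro w hw
    exact ((hasDerivAt_mob hb (hsn w hw)).comp w (hsd w hw)).differentiableAt.differentiableWithinAt
  · intro x hx y hy hxy
    have := mob_neg_mob hb (hsn x hx).le
    simp only at hxy
    rw [hxy, mob_neg_mob hb (hsn y hy).le] at this
    exact hsinj hx hy this.symm
  · intro w hw
    simpa using norm_mob_lt hb (hsn w hw)
  · rw [← image_image (g := mob b) (f := s)]
    exact hsfull.mob hsb hb
  · intro w hw
    have h1 := ((hasDerivAt_mob hb (hsn w hw)).comp w (hsd w hw)).deriv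
    have h2 : (fun w => mob b (s w)) = mob b ∘ s := rfl
    have hq : ∀ c : ℂ, ‖c‖ < 1 → (1 : ℂ) - ‖c‖ ^ 2 ≠ 0 := fun c hc h => by
      have h' : (1 : ℝ) - ‖c‖ ^ 2 = 0 := by exact_mod_cast h
      nlinarith [norm_nonneg c]
    rw [h2, h1]
    exact mul_ne_zero (div_ne_zero (hq b hb) (pow_ne_zero 2 (mob_denom_ne hb (hsn w hw).le)))
      (div_ne_zero (mul_ne_zero (div_ne_zero (hq a ha)
        (pow_ne_zero 2 (mob_denom_ne ha (hfn w hw).le))) (hf.deriv_ne w hw))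
        (mul_ne_zero two_ne_zero (hs0 w)))
  · have h1 := ((hasDerivAt_mob hb hb).comp w₀ (hsd w₀ hw₀)).deriv
    have h2 : (fun w => mob b (s w)) = mob b ∘ s := rfl
    have h3 : (starRingEnd ℂ) b * b = ((‖a‖ : ℝ) : ℂ) := by
      rw [Complex.conj_mul', ← hb2]
      push_cast
      rfl
    have ha0 : 0 < ‖a‖ := by
      rw [← hb2]
      exact pow_pos (norm_pos_iff.2 (hs0 w₀)) 2
    have hb3 : ‖b‖ = √‖a‖ := by rw [← hb2, Real.sqrt_sq (norm_nonneg _)]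
    have hr : ((1 : ℂ) - ‖a‖ ^ 2) = ((1 - ‖a‖ ^ 2 : ℝ) : ℂ) := by push_cast; rfl
    have hr' : ((1 : ℂ) - ‖b‖ ^ 2) = ((1 - ‖a‖ : ℝ) : ℂ) := by rw [← hb2]; push_cast; rfl
    have hr'' : ((1 : ℂ) - (‖a‖ : ℝ)) = ((1 - ‖a‖ : ℝ) : ℂ) := by push_cast; rfl
    rw [h2, h1, h3, hf.zero, mul_zero, sub_zero, hr, hr', hr'']
    have p1 : 0 < 1 - ‖a‖ := by linarith
    have p2 : 0 < 1 - ‖a‖ ^ 2 := by nlinarith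
    simp only [norm_mul, norm_div, norm_pow, Complex.norm_real, Real.norm_eq_abs, abs_of_pos p1,
      abs_of_pos p2, one_pow, div_one]
    have hb3' : ‖s w₀‖ = √‖a‖ := hb3
    rw [hb3']
    have : 0 < √‖a‖ := Real.sqrt_pos.2 ha0
    have h4 : ‖(2 : ℂ)‖ = 2 := by simp
    rw [h4]
    field_simp
    ring

theorem exists_koebeFam (hWb : Bornology.IsBounded W) (hc : IsPreconnected Wᶜ) :
    ∃ f, KoebeFam W w₀ f := by
  obtain ⟨R, hR, hWR⟩ := hWb.subset_ball_lt 0 w₀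
  have hR' : (R : ℂ) ≠ 0 := by exact_mod_cast hR.ne'
  have hinj : Function.Injective fun w : ℂ => (w - w₀) / R := fun x y h => by
    simp only at h
    rw [div_left_inj' hR'] at h
    simpa using h
  have hsurj : Function.Surjective fun w : ℂ => (w - w₀) / R := fun x => ⟨x * R + w₀, by
    simp [hR']⟩
  have hm : MapsTo (fun w : ℂ => (w - w₀) / R) W (ball 0 1) := fun w hw => by
    have h1 := hWR hw
    rw [mem_ball, dist_eq_norm] at h1
    rw [mem_ball_zero_iff, norm_div, Complex.norm_real, Real.norm_eq_abs, abs_of_pos hR]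
    exact (div_lt_one hR).2 h1
  refine ⟨fun w => (w - w₀) / R, by fun_prop, hinj.injOn, hm, by simp, ?_, ?_⟩
  swap
  · intro w hw
    simp [hR']
  set V := (fun w : ℂ => (w - w₀) / R) '' W
  have hVc : IsPreconnected Vᶜ := by
    have : Vᶜ = (fun w : ℂ => (w - w₀) / R) '' Wᶜ :=
      (image_compl_eq ⟨hinj, hsurj⟩).symm
    rw [this]
    exact hc.image _ (by fun_prop)
  have hVb : V ⊆ ball 0 1 := hm.image_subset
  have : closedBall (0 : ℂ) 1 \ V = clampDisc '' Vᶜ := by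
    ext z
    constructor
    · rintro ⟨h1, h2⟩
      exact ⟨z, h2, clampDisc_of_mem h1⟩
    · rintro ⟨x, hx, rfl⟩
      refine ⟨clampDisc_mem x, fun h => ?_⟩
      rcases le_total ‖x‖ 1 with h1 | h1
      · rw [clampDisc_of_mem (mem_closedBall_zero_iff.2 h1)] at h
        exact hx h
      · have h2 := mem_ball_zero_iff.1 (hVb h)
        rw [clampDisc, max_eq_right h1, norm_div, Complex.norm_real, norm_norm,
          div_self (by linarith)] at h2
        exact lt_irrefl _ h2
  rw [DiscFull, this]
  exact hVc.image _ continuous_clampDisc.continuousOn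

theorem koebeFactor_anti {x y : ℝ} (hx : 0 < x) (hxy : x ≤ y) (hy : y ≤ 1) :
    (1 + y) / (2 * √y) ≤ (1 + x) / (2 * √x) := by
  have h1 : 0 < √x := Real.sqrt_pos.2 hx
  have h2 : √x ≤ √y := Real.sqrt_le_sqrt hxy
  have h3 : √y ≤ 1 := Real.sqrt_le_one.2 hy
  have h4 := Real.sq_sqrt hx.le
  have h5 := Real.sq_sqrt (hx.le.trans hxy)
  rw [div_le_div_iff₀ (by linarith) (by linarith), ← h4, ← h5, h4, h5]
  rw [← h4, ← h5, Real.sqrt_sq h1.le, Real.sqrt_sq (h1.le.trans h2)]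
  have h6 : √x * √y ≤ 1 := mul_le_one₀ (h2.trans h3) (h1.le.trans h2) h3
  nlinarith [mul_nonneg (sub_nonneg.2 h2) (sub_nonneg.2 h6)]

theorem one_lt_koebeFactor {x : ℝ} (hx : 0 < x) (hx1 : x < 1) : 1 < (1 + x) / (2 * √x) := by
  have h1 : 0 < √x := Real.sqrt_pos.2 hx
  have h3 : √x < 1 := (Real.sqrt_lt' one_pos).2 (by simpa using hx1)
  have h4 := Real.sq_sqrt hx.le
  rw [lt_div_iff₀ (by linarith)]
  nlinarith [pow_pos (sub_pos.2 h3) 2]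

theorem exists_koebeFam_seq (hW : IsOpen W) (hWc : IsPreconnected W)
    (hWb : Bornology.IsBounded W) (hc : IsPreconnected Wᶜ) (hw₀ : w₀ ∈ W) :
    ∃ f : ℕ → ℂ → ℂ, (∀ n, KoebeFam W w₀ (f n)) ∧
      ∀ r < 1, ∀ᶠ n in atTop, ball 0 r ⊆ f n '' W := by
  obtain ⟨f₀, hf₀⟩ := exists_koebeFam (w₀ := w₀) hWb hc
  obtain ⟨ε, hε, hεW⟩ := Metric.isOpen_iff.1 hW w₀ hw₀
  set S := {m | ∃ f, KoebeFam W w₀ f ∧ m = ‖deriv f w₀‖}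
  have hSb : BddAbove S := by
    refine ⟨1 / ε, ?_⟩
    rintro _ ⟨f, hf, rfl⟩
    refine Complex.norm_deriv_le_div_of_mapsTo_ball (hf.diff.mono hεW) ?_ hε
    rw [hf.zero]
    exact (hf.maps.mono_left hεW).mono_right ball_subset_closedBall
  set M := sSup S
  have hM : 0 < M :=
    (norm_pos_iff.2 (hf₀.deriv_ne w₀ hw₀)).trans_le (le_csSup hSb ⟨f₀, hf₀, rfl⟩)
  have key : ∀ r : ℝ, 0 < r → r < 1 → ∃ f, KoebeFam W w₀ f ∧ ball 0 r ⊆ f '' W := by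
    intro r hr hr1
    have hκ := one_lt_koebeFactor hr hr1
    obtain ⟨_, ⟨f, hf, rfl⟩, hfm⟩ := exists_lt_of_lt_csSup (s := S) ⟨_, f₀, hf₀, rfl⟩
      (div_lt_self hM hκ)
    refine ⟨f, hf, fun a har => ?_⟩
    by_contra haf
    have har' := mem_ball_zero_iff.1 har
    obtain ⟨F, hF, hFd⟩ := hf.step hW hWc hw₀ (har'.trans hr1) haf
    have ha0 : a ≠ 0 := by
      rintro rfl
      exact haf ⟨w₀, hw₀, hf.zero⟩
    have h1 := koebeFactor_anti (norm_pos_iff.2 ha0) har'.le hr1.le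
    have h2 : ‖deriv F w₀‖ ≤ M := le_csSup hSb ⟨F, hF, rfl⟩
    rw [hFd] at h2
    rw [div_lt_iff₀ (by linarith)] at hfm
    have := mul_le_mul_of_nonneg_left h1 (norm_nonneg (deriv f w₀))
    linarith
  have hr : ∀ n : ℕ, (0 : ℝ) < 1 - 1 / (n + 2) := fun n => by
    rw [sub_pos, div_lt_one (by positivity)]
    linarith [n.cast_nonneg (α := ℝ)]
  choose f hf hfb using fun n : ℕ => key (1 - 1 / (n + 2)) (hr n)
    (by linarith [show (0 : ℝ) < 1 / (n + 2) by positivity])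
  refine ⟨f, hf, fun r hr1 => ?_⟩
  obtain ⟨m, hm⟩ := exists_nat_one_div_lt (sub_pos.2 hr1)
  filter_upwards [eventually_ge_atTop m] with n hn
  refine (ball_subset_ball ?_).trans (hfb n)
  have : (1 : ℝ) / (n + 2) ≤ 1 / (m + 1) := by
    have : (m : ℝ) ≤ n := by exact_mod_cast hn
    gcongr
    linarith
  linarith

/-- The Riemann mapping theorem for bounded domains with connected complement. -/
theorem exists_riemannMap (hW : IsOpen W) (hWc : IsPreconnected W)
    (hWb : Bornology.IsBounded W) (hc : IsPreconnected Wᶜ) (hw₀ : w₀ ∈ W) :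
    ∃ φ f : ℂ → ℂ, DifferentiableOn ℂ φ (ball 0 1) ∧ MapsTo φ (ball 0 1) W ∧
      DifferentiableOn ℂ f W ∧ MapsTo f W (ball 0 1) ∧ (∀ w ∈ W, φ (f w) = w) ∧
      ∀ z ∈ ball (0 : ℂ) 1, f (φ z) = z := by
  obtain ⟨F, hF, hFr⟩ := exists_koebeFam_seq hW hWc hWb hc hw₀
  set l : Ultrafilter ℕ := hyperfilter ℕ
  have hl : (l : Filter ℕ) ≤ atTop := Nat.hyperfilter_le_atTop
  obtain ⟨R, hR⟩ := hWb.subset_closedBall 0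
  set Φ : ℕ → ℂ → ℂ := fun n => Function.invFunOn (F n) W with hΦ
  have hΦW : ∀ n, ∀ z ∈ F n '' W, Φ n z ∈ W := fun n z hz => Function.invFunOn_mem hz
  have hFΦ : ∀ n, ∀ z ∈ F n '' W, F n (Φ n z) = z := fun n z hz => Function.invFunOn_eq hz
  have hΦF : ∀ n, ∀ w ∈ W, Φ n (F n w) = w := fun n w hw =>
    (hF n).inj (hΦW n _ ⟨w, hw, rfl⟩) hw (hFΦ n _ ⟨w, hw, rfl⟩)
  have hVo : ∀ n, IsOpen (F n '' W) := fun n =>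
    isOpen_image_of_injOn hW hWc (hF n).diff (hF n).inj Subset.rfl hW
  have hΦd : ∀ n, DifferentiableOn ℂ (Φ n) (F n '' W) := by
    rintro n _ ⟨w, hw, rfl⟩
    have hd : HasDerivAt (F n) (deriv (F n) (Φ n (F n w))) (Φ n (F n w)) := by
      rw [hΦF n w hw]
      exact ((hF n).diff.differentiableAt (hW.mem_nhds hw)).hasDerivAt
    have hcont : ContinuousAt (Φ n) (F n w) := by
      rw [ContinuousAt, hΦF n w hw, _root_.tendsto_nhds]
      intro s hs hws
      have : F n '' (s ∩ W) ∈ 𝓝 (F n w) :=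
        (isOpen_image_of_injOn hW hWc (hF n).diff (hF n).inj inter_subset_right
          (hs.inter hW)).mem_nhds ⟨w, ⟨hws, hw⟩, rfl⟩
      filter_upwards [this]
      rintro _ ⟨x, hx, rfl⟩
      rw [mem_preimage, hΦF n x hx.2]
      exact hx.1
    refine (hd.of_local_left_inverse hcont ?_ ?_).differentiableAt.differentiableWithinAt
    · rw [hΦF n w hw]
      exact (hF n).deriv_ne w hw
    · filter_upwards [(hVo n).mem_nhds ⟨w, hw, rfl⟩] with z hz using hFΦ n z hz
  have hball : ∀ z ∈ ball (0 : ℂ) 1, ∃ ε > 0, ∀ᶠ n in (l : Filter ℕ), ball z ε ⊆ F n '' W := by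
    intro z hz
    have hz' := mem_ball_zero_iff.1 hz
    refine ⟨(1 - ‖z‖) / 2, by linarith, hl ?_⟩
    filter_upwards [hFr ((1 + ‖z‖) / 2) (by linarith)] with n hn
    refine (ball_subset_ball' ?_).trans hn
    rw [dist_zero_right]
    linarith
  obtain ⟨f, hf, hfd⟩ := montel (l := l) (F := F) (U := W) (R := 1) (fun z hz => by
    obtain ⟨ε, hε, hεW⟩ := Metric.isOpen_iff.1 hW z hz
    exact ⟨ε, hε, Eventually.of_forall fun n => ⟨(hF n).diff.mono hεW, fun w hw =>
      (mem_ball_zero_iff.1 ((hF n).maps (hεW hw))).le⟩⟩)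
  obtain ⟨φ, hφ, hφd⟩ := montel (l := l) (F := Φ) (U := ball 0 1) (R := R) (fun z hz => by
    obtain ⟨ε, hε, h⟩ := hball z hz
    refine ⟨ε, hε, h.mono fun n hn => ⟨(hΦd n).mono hn, fun w hw => ?_⟩⟩
    exact mem_closedBall_zero_iff.1 (hR (hΦW n w (hn hw))))
  have hfD : DifferentiableOn ℂ f W := fun z hz => by
    obtain ⟨ε, hε, h⟩ := hfd z hz
    exact (h.differentiableAt (ball_mem_nhds z hε)).differentiableWithinAt
  have hφD : DifferentiableOn ℂ φ (ball 0 1) := fun z hz => by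
    obtain ⟨ε, hε, h⟩ := hφd z hz
    exact (h.differentiableAt (ball_mem_nhds z hε)).differentiableWithinAt
  have hft : ∀ w ∈ W, Tendsto (fun n => F n w) (l : Filter ℕ) (𝓝 (f w)) := fun w hw =>
    hf.tendsto_at hw
  have hφt : ∀ z ∈ ball (0 : ℂ) 1, Tendsto (fun n => Φ n z) (l : Filter ℕ) (𝓝 (φ z)) :=
    fun w hw => hφ.tendsto_at hw
  have hf0 : f w₀ = 0 := by
    refine tendsto_nhds_unique (hft w₀ hw₀) ?_
    simp only [(hF _).zero]
    exact tendsto_const_nhds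
  have hf1 : ∀ w ∈ W, ‖f w‖ ≤ 1 := fun w hw =>
    le_of_tendsto (hft w hw).norm (Eventually.of_forall fun n =>
      (mem_ball_zero_iff.1 ((hF n).maps hw)).le)
  have hfm : MapsTo f W (ball 0 1) := by
    intro w hw
    rw [mem_ball_zero_iff]
    refine (hf1 w hw).lt_of_ne fun h => ?_
    have hmax : IsMaxOn (norm ∘ f) W w := fun x hx => by
      simpa [h] using hf1 x hx
    have := Complex.eqOn_of_isPreconnected_of_isMaxOn_norm hWc hW hfD hw hmax hw₀
    rw [Function.const_apply, hf0] at this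
    rw [← this, norm_zero] at h
    exact zero_ne_one h
  have hφf : ∀ w ∈ W, φ (f w) = w := by
    intro w hw
    have h1 : Tendsto (fun n => Φ n (F n w)) (l : Filter ℕ) (𝓝 (φ (f w))) := by
      refine hφ.tendsto_comp ((hφD.continuousOn) _ (hfm hw)) (hfm hw) ?_
      rw [isOpen_ball.nhdsWithin_eq (hfm hw)]
      exact hft w hw
    refine tendsto_nhds_unique h1 ?_
    simp only [hΦF _ w hw]
    exact tendsto_const_nhds
  have hφm : MapsTo φ (ball 0 1) W := by
    intro z hz
    by_contra hp
    have h0 : (0 : ℂ) ∈ ball (0 : ℂ) 1 := mem_ball_self one_pos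
    refine hurwitz (p := φ z) isOpen_ball (convex_ball _ _).isPreconnected hφ hφD (fun x hx => ?_)
      ⟨0, h0, ?_⟩ z hz rfl
    · obtain ⟨ε, hε, h⟩ := hball x hx
      refine ⟨ε, hε, h.mono fun n hn => ⟨(hΦd n).mono hn, fun w hw hwp => hp ?_⟩⟩
      rw [← hwp]
      exact hΦW n w (hn hw)
    · rw [← hf0, hφf w₀ hw₀]
      exact fun h => hp (h ▸ hw₀)
  refine ⟨φ, f, hφD, hφm, hfD, hfm, hφf, fun z hz => ?_⟩
  have h1 : Tendsto (fun n => F n (Φ n z)) (l : Filter ℕ) (𝓝 (f (φ z))) := by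
    refine hf.tendsto_comp ((hfD.continuousOn) _ (hφm hz)) (hφm hz) ?_
    rw [hW.nhdsWithin_eq (hφm hz)]
    exact hφt z hz
  refine tendsto_nhds_unique h1 (tendsto_const_nhds.congr' ?_)
  obtain ⟨ε, hε, h⟩ := hball z hz
  filter_upwards [h] with n hn
  exact (hFΦ n z (hn (mem_ball_self hε))).symm

end Koebe

section LengthArea

open MeasureTheory

theorem exists_lintegral_line_le {H : ℂ → ENNReal} (hm : Measurable H) (hfin : ∫⁻ z, H z ≠ ⊤)
    {η : ENNReal} (hη : η ≠ 0) (s₀ : ℝ) : ∃ s < s₀, ∫⁻ θ : ℝ, H ⟨s, θ⟩ ≤ η := by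
  by_contra! h
  have h1 : ∫⁻ z, H z = ∫⁻ s : ℝ, ∫⁻ θ : ℝ, H ⟨s, θ⟩ := by
    rw [← (Complex.volume_preserving_equiv_real_prod.symm).lintegral_comp hm,
      Measure.volume_eq_prod, lintegral_prod]
    · rfl
    · exact (hm.comp Complex.measurableEquivRealProd.symm.measurable).aemeasurable
  apply hfin
  rw [h1, eq_top_iff]
  calc (⊤ : ENNReal) = ∫⁻ _ in Iio s₀, η := by
        rw [setLIntegral_const, Real.volume_Iio, ENNReal.mul_top hη]
    _ ≤ ∫⁻ s in Iio s₀, ∫⁻ θ : ℝ, H ⟨s, θ⟩ :=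
        setLIntegral_mono' measurableSet_Iio fun s hs => (h s hs).le
    _ ≤ _ := setLIntegral_le_lintegral _ _

theorem lintegral_sq_deriv_ne_top {ψ : ℂ → ℂ} {G : Set ℂ} (hG : IsOpen G)
    (hd : DifferentiableOn ℂ ψ G) (hi : InjOn ψ G) (hv : volume (ψ '' G) ≠ ⊤) :
    ∫⁻ z, G.indicator (fun z => ENNReal.ofReal (‖deriv ψ z‖ ^ 2)) z ≠ ⊤ := by
  rw [lintegral_indicator hG.measurableSet]
  have h1 : ∀ z ∈ G, HasFDerivWithinAt ψ
      ((ContinuousLinearMap.toSpanSingleton ℂ (deriv ψ z)).restrictScalars ℝ) G z := fun z hz =>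
    ((hd.differentiableAt (hG.mem_nhds hz)).hasDerivAt.hasFDerivAt.restrictScalars
      ℝ).hasFDerivWithinAt
  have h2 := lintegral_abs_det_fderiv_eq_addHaar_image volume hG.measurableSet h1 hi
  rw [← h2] at hv
  have h3 : ∀ z, ‖deriv ψ z‖ ^ 2 = |((ContinuousLinearMap.toSpanSingleton ℂ
      (deriv ψ z)).restrictScalars ℝ).det| := fun z => by
    simp [ContinuousLinearMap.det, LinearMap.det_restrictScalars, Algebra.norm_complex_eq,
      Complex.normSq_eq_norm_sq]
  simp_rw [h3]
  exact hv

theorem norm_sub_le_of_lintegral_le {ψ : ℂ → ℂ} {G : Set ℂ} (hG : IsOpen G)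
    (hd : DifferentiableOn ℂ ψ G) {s θ₁ θ₂ η K : ℝ} (hK : 0 < K) (hθ : θ₁ ≤ θ₂) (hη : 0 ≤ η)
    (hs : ∀ θ ∈ Icc θ₁ θ₂, (⟨s, θ⟩ : ℂ) ∈ G)
    (hl : ∫⁻ θ : ℝ, G.indicator (fun z => ENNReal.ofReal (‖deriv ψ z‖ ^ 2)) ⟨s, θ⟩ ≤
      ENNReal.ofReal η) :
    ‖ψ ⟨s, θ₂⟩ - ψ ⟨s, θ₁⟩‖ ≤ η / (2 * K) + K / 2 * (θ₂ - θ₁) := by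
  have hmk : ∀ θ : ℝ, (⟨s, θ⟩ : ℂ) = s + θ * Complex.I := fun θ => (Complex.mk_eq_add_mul_I s θ)
  have hmc : Continuous fun θ : ℝ => (⟨s, θ⟩ : ℂ) := by simp_rw [hmk]; fun_prop
  have hder : ∀ θ ∈ uIcc θ₁ θ₂, HasDerivAt (fun θ : ℝ => ψ ⟨s, θ⟩)
      (deriv ψ ⟨s, θ⟩ * Complex.I) θ := by
    intro θ hθ'
    rw [uIcc_of_le hθ] at hθ'
    have h1 : HasDerivAt ψ (deriv ψ ⟨s, θ⟩) ⟨s, θ⟩ :=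
      (hd.differentiableAt (hG.mem_nhds (hs θ hθ'))).hasDerivAt
    have h2 : HasDerivAt (fun θ : ℝ => (⟨s, θ⟩ : ℂ)) Complex.I θ := by
      simp_rw [hmk]
      simpa using ((Complex.ofRealCLM.hasDerivAt (x := θ)).mul_const Complex.I).const_add (s : ℂ)
    exact h1.comp θ h2
  have hcont : ContinuousOn (fun θ : ℝ => deriv ψ ⟨s, θ⟩) (Icc θ₁ θ₂) :=
    ((hd.deriv hG).continuousOn).comp hmc.continuousOn hs
  have hii : IntervalIntegrable (fun θ : ℝ => deriv ψ ⟨s, θ⟩ * Complex.I) volume θ₁ θ₂ := by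
    apply ContinuousOn.intervalIntegrable
    rw [uIcc_of_le hθ]
    exact hcont.mul continuousOn_const
  rw [← intervalIntegral.integral_eq_sub_of_hasDerivAt hder hii]
  have hsq : ContinuousOn (fun θ : ℝ => ‖deriv ψ ⟨s, θ⟩‖ ^ 2) (Icc θ₁ θ₂) := hcont.norm.pow 2
  have hsqi : IntervalIntegrable (fun θ : ℝ => ‖deriv ψ ⟨s, θ⟩‖ ^ 2) volume θ₁ θ₂ := by
    apply ContinuousOn.intervalIntegrable
    rwa [uIcc_of_le hθ]
  have hL : ∫ θ in θ₁..θ₂, ‖deriv ψ ⟨s, θ⟩‖ ^ 2 ≤ η := by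
    rw [intervalIntegral.integral_of_le hθ, ← ENNReal.ofReal_le_ofReal_iff hη,
      ofReal_integral_eq_lintegral_ofReal ((intervalIntegrable_iff_integrableOn_Ioc_of_le hθ).1 hsqi)
        (Eventually.of_forall fun _ => by positivity)]
    refine le_trans ?_ hl
    rw [← lintegral_indicator measurableSet_Ioc]
    refine lintegral_mono fun θ => ?_
    by_cases h : θ ∈ Ioc θ₁ θ₂
    · rw [indicator_of_mem h, indicator_of_mem (hs θ (Ioc_subset_Icc_self h))]
    · rw [indicator_of_notMem h]
      exact zero_le
  calc ‖∫ θ in θ₁..θ₂, deriv ψ ⟨s, θ⟩ * Complex.I‖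
      ≤ ∫ θ in θ₁..θ₂, (1 / (2 * K) * ‖deriv ψ ⟨s, θ⟩‖ ^ 2 + K / 2) := by
        refine intervalIntegral.norm_integral_le_of_norm_le hθ (Eventually.of_forall fun θ _ => ?_)
          ((hsqi.const_mul _).add intervalIntegrable_const)
        rw [norm_mul, Complex.norm_I, mul_one]
        have : 1 / (2 * K) * ‖deriv ψ ⟨s, θ⟩‖ ^ 2 + K / 2 - ‖deriv ψ ⟨s, θ⟩‖ =
            1 / (2 * K) * (‖deriv ψ ⟨s, θ⟩‖ - K) ^ 2 := by
          field_simp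
          ring
        have h2 : 0 ≤ 1 / (2 * K) * (‖deriv ψ ⟨s, θ⟩‖ - K) ^ 2 := by positivity
        linarith
    _ = 1 / (2 * K) * (∫ θ in θ₁..θ₂, ‖deriv ψ ⟨s, θ⟩‖ ^ 2) + K / 2 * (θ₂ - θ₁) := by
        rw [intervalIntegral.integral_add (hsqi.const_mul _) intervalIntegrable_const,
          intervalIntegral.integral_const_mul, intervalIntegral.integral_const, smul_eq_mul]
        ring
    _ ≤ η / (2 * K) + K / 2 * (θ₂ - θ₁) := by
        have := mul_le_mul_of_nonneg_left hL (show 0 ≤ 1 / (2 * K) by positivity)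
        have h3 : η / (2 * K) = 1 / (2 * K) * η := by ring
        linarith

/-- In logarithmic coordinates at a boundary point, the unit disc is this region. -/
def logDisc : Set ℂ := {w | |w.im| < Real.pi / 2 ∧ ‖1 - Complex.exp w‖ < 1}

theorem isOpen_logDisc : IsOpen logDisc :=
  IsOpen.inter (isOpen_lt (by fun_prop : Continuous fun w : ℂ => |w.im|) continuous_const)
    (isOpen_lt (by fun_prop : Continuous fun w : ℂ => ‖1 - Complex.exp w‖) continuous_const)

theorem mem_logDisc_iff {s θ : ℝ} : (⟨s, θ⟩ : ℂ) ∈ logDisc ↔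
    |θ| < Real.pi / 2 ∧ Real.exp s / 2 < Real.cos θ := by
  have h1 : ‖1 - Complex.exp ⟨s, θ⟩‖ ^ 2 =
      1 + Real.exp s * (Real.exp s - 2 * Real.cos θ) := by
    rw [← Complex.normSq_eq_norm_sq, Complex.normSq_apply]
    simp only [Complex.sub_re, Complex.sub_im, Complex.exp_re, Complex.exp_im, Complex.one_re,
      Complex.one_im]
    linear_combination Real.exp s ^ 2 * Real.sin_sq_add_cos_sq θ
  have h2 : ‖1 - Complex.exp ⟨s, θ⟩‖ < 1 ↔ ‖1 - Complex.exp ⟨s, θ⟩‖ ^ 2 < 1 :=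
    (pow_lt_one_iff_of_nonneg (norm_nonneg _) two_ne_zero).symm
  have h3 := Real.exp_pos s
  simp only [logDisc, mem_ofPred_eq, h2, h1]
  refine and_congr_right fun _ => ⟨fun h => ?_, fun h => ?_⟩
  · by_contra! hc
    have : 0 ≤ Real.exp s * (Real.exp s - 2 * Real.cos θ) :=
      mul_nonneg h3.le (by linarith)
    linarith
  · have : Real.exp s * (Real.exp s - 2 * Real.cos θ) < 0 :=
      mul_neg_of_pos_of_neg h3 (by linarith)
    linarith

theorem convex_logDisc_slice (s : ℝ) : Convex ℝ {θ : ℝ | (⟨s, θ⟩ : ℂ) ∈ logDisc} := by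
  have h := (strictConcaveOn_cos_Icc.concaveOn.convex_gt (Real.exp s / 2)).inter
    (convex_Ioo (-(Real.pi / 2)) (Real.pi / 2))
  refine (congrArg (Convex ℝ) (Set.ext fun θ => ?_)).mpr h
  simp only [mem_ofPred_eq, mem_logDisc_iff, abs_lt, mem_inter_iff, mem_Icc, mem_Ioo]
  exact ⟨fun h => ⟨⟨⟨h.1.1.le, h.1.2.le⟩, h.2⟩, h.1⟩, fun h => ⟨h.2, h.1.2⟩⟩

/-- Logarithmic coordinates on the unit disc at the boundary point `ζ`. -/
def logChart (ζ w : ℂ) : ℂ := ζ * (1 - Complex.exp w)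

theorem logChart_mem {ζ w : ℂ} (hζ : ‖ζ‖ = 1) (hw : w ∈ logDisc) :
    logChart ζ w ∈ ball (0 : ℂ) 1 := by
  rw [mem_ball_zero_iff, logChart, norm_mul, hζ, one_mul]
  exact hw.2

theorem injOn_logChart {ζ : ℂ} (hζ : ‖ζ‖ = 1) : InjOn (logChart ζ) logDisc := by
  intro x hx y hy h
  have h0 : ζ ≠ 0 := by
    rintro rfl
    simp at hζ
  have h1 := mul_left_cancel₀ h0 h
  have h2 : Complex.exp x = Complex.exp y := by linear_combination -h1
  have hp := Real.pi_pos
  have hx1 := abs_lt.1 hx.1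
  have hy1 := abs_lt.1 hy.1
  exact Complex.exp_inj_of_neg_pi_lt_of_le_pi (by linarith) (by linarith) (by linarith)
    (by linarith) h2

theorem exists_logChart {ζ z : ℂ} {r : ℝ} (hζ : ‖ζ‖ = 1) (hr : 0 < r)
    (hz : z ∈ ball (0 : ℂ) 1 ∩ sphere ζ r) :
    ∃ θ : ℝ, (⟨Real.log r, θ⟩ : ℂ) ∈ logDisc ∧ logChart ζ ⟨Real.log r, θ⟩ = z := by
  have hz1 := mem_ball_zero_iff.1 hz.1
  have h0 : ζ ≠ 0 := by
    rintro rfl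
    simp at hζ
  have h2 : ‖1 - z / ζ‖ = r := by
    have : 1 - z / ζ = -(z - ζ) / ζ := by field_simp; ring
    rw [this, norm_div, norm_neg, hζ, div_one]
    exact mem_sphere_iff_norm.1 hz.2
  have h3 : 1 - z / ζ ≠ 0 := by
    rw [← norm_pos_iff, h2]
    exact hr
  have h4 : (⟨Real.log r, (1 - z / ζ).arg⟩ : ℂ) = Complex.log (1 - z / ζ) := by
    rw [Complex.log, h2]
    exact Complex.mk_eq_add_mul_I _ _
  have h5 : ‖z / ζ‖ < 1 := by rw [norm_div, hζ, div_one]; exact hz1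
  refine ⟨(1 - z / ζ).arg, ?_, ?_⟩
  · rw [h4]
    refine ⟨?_, ?_⟩
    · rw [Complex.log_im, Complex.abs_arg_lt_pi_div_two_iff]
      left
      have := Complex.re_le_norm (z / ζ)
      rw [Complex.sub_re, Complex.one_re]
      linarith
    · rw [Complex.exp_log h3]
      simpa using h5
  · rw [h4, logChart, Complex.exp_log h3]
    field_simp
    ring

theorem logChart_mem_sphere {ζ : ℂ} {r θ : ℝ} (hζ : ‖ζ‖ = 1) (hr : 0 < r) :
    logChart ζ ⟨Real.log r, θ⟩ ∈ sphere ζ r := by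
  rw [mem_sphere_iff_norm, logChart]
  have : ζ * (1 - Complex.exp ⟨Real.log r, θ⟩) - ζ = -(ζ * Complex.exp ⟨Real.log r, θ⟩) := by ring
  rw [this, norm_neg, norm_mul, hζ, one_mul, Complex.norm_exp]
  exact Real.exp_log hr

theorem continuous_logChart (ζ : ℂ) : Continuous (logChart ζ) := by
  unfold logChart
  fun_prop

theorem isPreconnected_ball_inter_sphere {ζ : ℂ} {r : ℝ} (hζ : ‖ζ‖ = 1) (hr : 0 < r) :
    IsPreconnected (ball (0 : ℂ) 1 ∩ sphere ζ r) := by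
  have : ball (0 : ℂ) 1 ∩ sphere ζ r = (fun θ : ℝ => logChart ζ ⟨Real.log r, θ⟩) ''
      {θ : ℝ | (⟨Real.log r, θ⟩ : ℂ) ∈ logDisc} := by
    ext z
    constructor
    · intro hz
      obtain ⟨θ, h1, h2⟩ := exists_logChart hζ hr hz
      exact ⟨θ, h1, h2⟩
    · rintro ⟨θ, h1, rfl⟩
      exact ⟨logChart_mem hζ h1, logChart_mem_sphere hζ hr⟩
  rw [this]
  refine (convex_logDisc_slice _).isPreconnected.image _ ?_
  have : ∀ θ : ℝ, (⟨Real.log r, θ⟩ : ℂ) = Real.log r + θ * Complex.I := fun θ =>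
    (Complex.mk_eq_add_mul_I _ θ)
  simp_rw [this]
  exact ((continuous_logChart ζ).comp (by fun_prop)).continuousOn

/-- Short crosscuts: a bounded injective holomorphic function on the disc maps some small
circular crosscut at each boundary point to a set of small diameter. -/
theorem exists_short_crosscut {φ : ℂ → ℂ} (hd : DifferentiableOn ℂ φ (ball 0 1))
    (hi : InjOn φ (ball 0 1)) (hv : volume (φ '' ball 0 1) ≠ ⊤) {ζ : ℂ} (hζ : ‖ζ‖ = 1)
    {ε r₀ : ℝ} (hε : 0 < ε) (hr₀ : 0 < r₀) :
    ∃ r, 0 < r ∧ r < r₀ ∧ ∀ z ∈ ball (0 : ℂ) 1 ∩ sphere ζ r, ∀ z' ∈ ball (0 : ℂ) 1 ∩ sphere ζ r,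
      dist (φ z) (φ z') ≤ ε := by
  set ψ : ℂ → ℂ := φ ∘ logChart ζ with hψ
  have hmt : MapsTo (logChart ζ) logDisc (ball 0 1) := fun w hw => logChart_mem hζ hw
  have hψd : DifferentiableOn ℂ ψ logDisc :=
    hd.comp (by unfold logChart; fun_prop) hmt
  have hψi : InjOn ψ logDisc := hi.comp (injOn_logChart hζ) hmt
  have hψv : volume (ψ '' logDisc) ≠ ⊤ := by
    refine ne_top_of_le_ne_top hv (measure_mono ?_)
    rw [hψ, image_comp]
    exact image_mono hmt.image_subset
  have hfin := lintegral_sq_deriv_ne_top isOpen_logDisc hψd hψi hψv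
  have hm : Measurable (logDisc.indicator (fun z => ENNReal.ofReal (‖deriv ψ z‖ ^ 2))) :=
    (((measurable_deriv ψ).norm.pow_const 2).ennreal_ofReal).indicator isOpen_logDisc.measurableSet
  set K := ε / 4
  have hK : 0 < K := by positivity
  have hp := Real.pi_pos
  have hp4 := Real.pi_lt_four
  obtain ⟨s, hs, hsl⟩ := exists_lintegral_line_le hm hfin (η := ENNReal.ofReal (K * ε / 2))
    (by simp; positivity) (Real.log r₀)
  refine ⟨Real.exp s, Real.exp_pos s, (Real.lt_log_iff_exp_lt hr₀).1 hs, fun z hz z' hz' => ?_⟩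
  obtain ⟨θ, hθ, rfl⟩ := exists_logChart hζ (Real.exp_pos s) hz
  obtain ⟨θ', hθ', rfl⟩ := exists_logChart hζ (Real.exp_pos s) hz'
  rw [Real.log_exp] at *
  have key : ∀ θ₁ θ₂ : ℝ, (⟨s, θ₁⟩ : ℂ) ∈ logDisc → (⟨s, θ₂⟩ : ℂ) ∈ logDisc → θ₁ ≤ θ₂ →
      ‖ψ ⟨s, θ₂⟩ - ψ ⟨s, θ₁⟩‖ ≤ ε := by
    intro θ₁ θ₂ h1 h2 h12
    have := norm_sub_le_of_lintegral_le isOpen_logDisc hψd hK h12 (by positivity)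
      (fun θ hθ => (convex_logDisc_slice s).ordConnected.out h1 h2 hθ) hsl
    have e1 : K * ε / 2 / (2 * K) = ε / 4 := by field_simp; norm_num
    have a1 := (abs_lt.1 h1.1)
    have a2 := (abs_lt.1 h2.1)
    simp only at a1 a2
    have : K / 2 * (θ₂ - θ₁) ≤ K / 2 * 4 :=
      mul_le_mul_of_nonneg_left (by linarith) (by positivity)
    have e2 : K / 2 * 4 = ε / 2 := by simp only [K]; ring
    linarith
  rcases le_total θ θ' with h | h
  · rw [dist_comm, dist_eq_norm]
    exact key _ _ hθ hθ' h
  · rw [dist_eq_norm]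
    exact key _ _ hθ' hθ h

end LengthArea

/-- `C` is a simple closed curve. -/
def IsJordan {X : Type*} [TopologicalSpace X] (C : Set X) : Prop :=
  ∃ c : ℂ → X, ContinuousOn c (sphere 0 1) ∧ InjOn c (sphere 0 1) ∧ c '' sphere 0 1 = C

theorem IsJordan.isCompact {X : Type*} [TopologicalSpace X] {C : Set X} (hC : IsJordan C) :
    IsCompact C := by
  obtain ⟨c, hc, -, rfl⟩ := hC
  exact (isCompact_sphere 0 1).image_of_continuousOn hc

theorem IsJordan.isPreconnected {X : Type*} [TopologicalSpace X] {C : Set X} (hC : IsJordan C) :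
    IsPreconnected C := by
  obtain ⟨c, hc, -, rfl⟩ := hC
  refine IsPreconnected.image ?_ c hc
  exact isPreconnected_sphere (by simp [Complex.rank_real_complex]) 0 1

theorem isPreconnected_compl_closedBall (x : ℂ) {R : ℝ} (hR : 0 < R) :
    IsPreconnected (closedBall x R)ᶜ := by
  have : (closedBall x R)ᶜ = (fun w => x + Complex.exp w) '' {w | Real.log R < w.re} := by
    ext z
    rw [mem_compl_iff, mem_closedBall_iff_norm, not_le]
    constructor
    · intro h
      have h0 : z - x ≠ 0 := norm_pos_iff.1 (hR.trans h)
      exact ⟨Complex.log (z - x), by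
        rw [mem_ofPred_eq, Complex.log_re]
        exact Real.log_lt_log hR h, by
        simp only [Complex.exp_log h0]
        ring⟩
    · rintro ⟨w, hw, rfl⟩
      rw [add_sub_cancel_left, Complex.norm_exp, ← Real.log_lt_iff_lt_exp hR]
      exact hw
  rw [this]
  exact (convex_halfSpace_re_gt _).isPreconnected.image _ (by fun_prop)

theorem isPreconnected_cap_one (s : ℝ) : IsPreconnected {v ∈ sphere (0 : ℂ) 1 | s ≤ v.re} := by
  rcases lt_or_ge 1 s with h | h
  · have : {v ∈ sphere (0 : ℂ) 1 | s ≤ v.re} = ∅ := by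
      ext v
      simp only [mem_ofPred_eq, mem_empty_iff_false, iff_false, not_and, not_le,
        mem_sphere_zero_iff_norm]
      intro hv
      have := Complex.re_le_norm v
      linarith
    rw [this]
    exact isPreconnected_empty
  set lo := max s (-1)
  have hlo : lo ≤ 1 := max_le h (by norm_num)
  have hmk : ∀ x y : ℝ, (⟨x, y⟩ : ℂ) = x + y * Complex.I := Complex.mk_eq_add_mul_I
  have hi : ∀ τ : ℝ, IsPreconnected ((fun x : ℝ => (⟨x, τ * √(1 - x ^ 2)⟩ : ℂ)) '' Icc lo 1) := by
    intro τ
    refine isPreconnected_Icc.image _ (Continuous.continuousOn ?_)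
    simp_rw [hmk]
    fun_prop
  have h1 : ∀ τ : ℝ, (1 : ℂ) ∈ (fun x : ℝ => (⟨x, τ * √(1 - x ^ 2)⟩ : ℂ)) '' Icc lo 1 :=
    fun τ => ⟨1, ⟨hlo, le_rfl⟩, by apply Complex.ext <;> simp⟩
  convert (hi 1).union 1 (h1 1) (h1 (-1)) (hi (-1)) using 1
  ext v
  constructor
  · rintro ⟨hv, hs⟩
    rw [mem_sphere_zero_iff_norm] at hv
    have hn : v.re ^ 2 + v.im ^ 2 = 1 := by
      have := Complex.normSq_eq_norm_sq v
      rw [Complex.normSq_apply, hv] at this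
      linarith
    have hre : v.re ∈ Icc lo 1 := ⟨max_le hs (by nlinarith [sq_nonneg v.im]),
      by nlinarith [sq_nonneg v.im]⟩
    have him : 1 - v.re ^ 2 = v.im ^ 2 := by linarith
    rcases le_total 0 v.im with h0 | h0
    · left
      refine ⟨v.re, hre, Complex.ext rfl ?_⟩
      simp only [him, Real.sqrt_sq h0, one_mul]
    · right
      refine ⟨v.re, hre, Complex.ext rfl ?_⟩
      simp only [him]
      rw [← neg_sq, Real.sqrt_sq (neg_nonneg.2 h0)]
      ring
  · have key : ∀ τ : ℝ, τ ^ 2 = 1 → ∀ x ∈ Icc lo 1,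
        (⟨x, τ * √(1 - x ^ 2)⟩ : ℂ) ∈ {v ∈ sphere (0 : ℂ) 1 | s ≤ v.re} := by
      intro τ hτ x hx
      refine ⟨?_, (le_max_left _ _).trans hx.1⟩
      have hx1 : -1 ≤ x := (le_max_right _ _).trans hx.1
      have h2 : 0 ≤ 1 - x ^ 2 := by nlinarith [hx.2]
      rw [mem_sphere_zero_iff_norm, ← sq_eq_sq₀ (norm_nonneg _) zero_le_one,
        ← Complex.normSq_eq_norm_sq, Complex.normSq_apply]
      nlinarith [Real.sq_sqrt h2]
    rintro (⟨x, hx, rfl⟩ | ⟨x, hx, rfl⟩)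
    · exact key 1 (by norm_num) x hx
    · exact key (-1) (by norm_num) x hx

theorem isPreconnected_cap {u : ℂ} (hu : ‖u‖ = 1) (s : ℝ) :
    IsPreconnected {v ∈ sphere (0 : ℂ) 1 | s ≤ (v * (starRingEnd ℂ) u).re} := by
  have huu : u * (starRingEnd ℂ) u = 1 := by
    rw [Complex.mul_conj, Complex.normSq_eq_norm_sq, hu]
    norm_num
  convert (isPreconnected_cap_one s).image (fun z => z * u) (by fun_prop) using 1
  ext v
  constructor
  · rintro ⟨h1, h2⟩
    refine ⟨v * (starRingEnd ℂ) u, ⟨?_, h2⟩, ?_⟩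
    · rw [mem_sphere_zero_iff_norm] at *
      simp [h1, hu]
    · linear_combination v * huu
  · rintro ⟨z, ⟨h1, h2⟩, rfl⟩
    refine ⟨?_, ?_⟩
    · rw [mem_sphere_zero_iff_norm] at *
      simp [h1, hu]
    · rwa [mul_assoc, huu, mul_one]

/-- Simple closed curves are locally arcs with connected complement, uniformly. -/
theorem IsJordan.localArc {X : Type*} [MetricSpace X] {C : Set X} (hC : IsJordan C) {ε : ℝ}
    (hε : 0 < ε) : ∃ δ > 0, ∀ x ∈ C, ∃ J J' : Set X, J ∪ J' = C ∧ IsCompact J ∧ IsCompact J' ∧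
      IsPreconnected J ∧ IsPreconnected J' ∧ J ⊆ ball x ε ∧ ∀ y ∈ J', δ ≤ dist y x := by
  obtain ⟨c, hc, hi, rfl⟩ := hC
  have hK := isCompact_sphere (0 : ℂ) 1
  obtain ⟨η, hη, hcη⟩ := Metric.uniformContinuousOn_iff.1
    (hK.uniformContinuousOn_of_continuous hc) ε hε
  have hdist : ∀ u v : ℂ, ‖u‖ = 1 → ‖v‖ = 1 → dist u v ^ 2 = 2 - 2 * (v * (starRingEnd ℂ) u).re := by
    intro u v hu hv
    rw [dist_comm, dist_eq_norm, ← Complex.normSq_eq_norm_sq, Complex.normSq_sub,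
      Complex.normSq_eq_norm_sq, Complex.normSq_eq_norm_sq, hu, hv]
    ring
  set s := 1 - η ^ 2 / 8 with hs
  have hcl : Continuous fun p : ℂ × ℂ => (p.2 * (starRingEnd ℂ) p.1).re := by fun_prop
  obtain ⟨δ, hδ, hδs⟩ := ((hK.prod hK).inter_right (isClosed_le hcl
    (continuous_const (y := s)))).exists_forall_le' (f := fun p => dist (c p.2) (c p.1)) (a := 0)
    (by
      refine continuous_dist.comp_continuousOn
        ((hc.comp continuousOn_snd ?_).prodMk (hc.comp continuousOn_fst ?_))
      · rintro ⟨a, b⟩ h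
        exact h.1.2
      · rintro ⟨a, b⟩ h
        exact h.1.1)
    (by
      rintro ⟨u, v⟩ ⟨⟨hu, hv⟩, h⟩
      refine dist_pos.2 fun h' => ?_
      have : v = u := hi hv hu h'
      subst this
      have h1 := hdist v v (mem_sphere_zero_iff_norm.1 hu) (mem_sphere_zero_iff_norm.1 hu)
      rw [dist_self] at h1
      simp only [mem_ofPred_eq, hs] at h
      nlinarith [sq_pos_of_pos hη])
  refine ⟨δ, hδ, ?_⟩
  rintro _ ⟨u, hu, rfl⟩
  have hu1 := mem_sphere_zero_iff_norm.1 hu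
  set A := {v ∈ sphere (0 : ℂ) 1 | s ≤ (v * (starRingEnd ℂ) u).re}
  set B := {v ∈ sphere (0 : ℂ) 1 | (v * (starRingEnd ℂ) u).re ≤ s}
  have hAs : A ⊆ sphere 0 1 := sep_subset _ _
  have hBs : B ⊆ sphere 0 1 := sep_subset _ _
  have hcl' : Continuous fun v : ℂ => (v * (starRingEnd ℂ) u).re := by fun_prop
  have hAc : IsCompact A := hK.inter_right (isClosed_le continuous_const hcl')
  have hBc : IsCompact B := hK.inter_right (isClosed_le hcl' continuous_const)
  have hA : IsPreconnected A := isPreconnected_cap hu1 s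
  have hB : IsPreconnected B := by
    have : B = {v ∈ sphere (0 : ℂ) 1 | -s ≤ (v * (starRingEnd ℂ) (-u)).re} := by
      ext v
      simp [B]
    rw [this]
    exact isPreconnected_cap (by simpa using hu1) _
  refine ⟨c '' A, c '' B, ?_, hAc.image_of_continuousOn (hc.mono hAs),
    hBc.image_of_continuousOn (hc.mono hBs), hA.image c (hc.mono hAs), hB.image c (hc.mono hBs),
    ?_, ?_⟩
  · rw [← image_union]
    congr 1
    ext v
    simp only [A, B, mem_union, mem_ofPred_eq, ← and_or_left, le_total, and_true]
  · rintro _ ⟨v, hv, rfl⟩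
    refine hcη v hv.1 u hu ?_
    have h1 := hdist v u (mem_sphere_zero_iff_norm.1 hv.1) hu1
    have h2 : (u * (starRingEnd ℂ) v).re = (v * (starRingEnd ℂ) u).re := by
      simp only [Complex.mul_re, Complex.conj_re, Complex.conj_im]
      ring
    rw [h2] at h1
    have h3 := hv.2
    have : dist v u ^ 2 < η ^ 2 := by
      rw [h1, hs] at *
      nlinarith [sq_pos_of_pos hη]
    exact lt_of_pow_lt_pow_left₀ 2 hη.le this
  · rintro _ ⟨v, hv, rfl⟩
    exact hδs (u, v) ⟨⟨hu, hv.1⟩, hv.2⟩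

/-- A bounded complementary domain of a simple closed curve in the plane. -/
structure JordanDomain (C W : Set ℂ) : Prop where
  jordan : IsJordan C
  isOpen : IsOpen W
  conn : IsPreconnected W
  bdd : Bornology.IsBounded W
  disj : Disjoint W C
  front : frontier W ⊆ C

/-- A conformal map of the unit disc onto `W`, with its inverse. -/
structure ConformalPair (W : Set ℂ) (φ f : ℂ → ℂ) : Prop where
  diff : DifferentiableOn ℂ φ (ball 0 1)
  maps : MapsTo φ (ball 0 1) W
  diff' : DifferentiableOn ℂ f W
  maps' : MapsTo f W (ball 0 1)
  left : ∀ w ∈ W, φ (f w) = w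
  right : ∀ z ∈ ball (0 : ℂ) 1, f (φ z) = z

section Caratheodory

variable {C W : Set ℂ} {φ f : ℂ → ℂ}

theorem ConformalPair.injOn (h : ConformalPair W φ f) : InjOn φ (ball 0 1) := fun x hx y hy hxy => by
  rw [← h.right x hx, hxy, h.right y hy]

theorem ConformalPair.image_eq (h : ConformalPair W φ f) : φ '' ball 0 1 = W :=
  h.maps.image_subset.antisymm fun w hw => ⟨f w, h.maps' hw, h.left w hw⟩

theorem ConformalPair.isOpen_image (h : ConformalPair W φ f) {s : Set ℂ} (hs : s ⊆ ball 0 1)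
    (hso : IsOpen s) : IsOpen (φ '' s) :=
  isOpen_image_of_injOn isOpen_ball (convex_ball _ _).isPreconnected h.diff h.injOn hs hso

theorem JordanDomain.small_ends (hW : JordanDomain C W) (h : ConformalPair W φ f) {ζ : ℂ}
    (hζ : ‖ζ‖ = 1) {ε : ℝ} (hε : 0 < ε) :
    ∃ r > 0, ∀ z ∈ ball (0 : ℂ) 1 ∩ ball ζ r, ∀ z' ∈ ball (0 : ℂ) 1 ∩ ball ζ r,
      dist (φ z) (φ z') ≤ ε := by
  have h0 : (0 : ℂ) ∈ ball (0 : ℂ) 1 := mem_ball_self one_pos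
  obtain ⟨η, hη, hηb⟩ := Metric.isOpen_iff.1 (h.isOpen_image (s := ball 0 (1 / 2))
    (ball_subset_ball (by norm_num)) isOpen_ball) (φ 0) ⟨0, mem_ball_self (by norm_num), rfl⟩
  set e := min (ε / 8) (η / 8)
  have he : 0 < e := lt_min (by positivity) (by positivity)
  have heε : e ≤ ε / 8 := min_le_left _ _
  have heη : e ≤ η / 8 := min_le_right _ _
  obtain ⟨δ₀, hδ₀, hloc⟩ := hW.jordan.localArc he
  set δ := min δ₀ e
  have hδ : 0 < δ := lt_min hδ₀ he
  have hv : MeasureTheory.volume (φ '' ball 0 1) ≠ ⊤ := by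
    rw [h.image_eq]
    exact hW.bdd.measure_lt_top.ne
  obtain ⟨r, hr, hr1, hcut⟩ := exists_short_crosscut h.diff h.injOn hv hζ (ε := δ / 2)
    (by positivity) (show (0 : ℝ) < 1 / 2 by norm_num)
  set S := ball (0 : ℂ) 1 ∩ sphere ζ r
  set B := ball (0 : ℂ) 1 ∩ ball ζ r
  have hSD : S ⊆ ball 0 1 := inter_subset_left
  have hBD : B ⊆ ball 0 1 := inter_subset_left
  have hSpre : IsPreconnected (φ '' S) :=
    (isPreconnected_ball_inter_sphere hζ hr).image φ (h.diff.continuousOn.mono hSD)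
  set Γ := closure (φ '' S)
  have hΓ : IsPreconnected Γ := hSpre.closure
  have hΓW : Γ ⊆ closure W := closure_mono ((image_mono hSD).trans h.image_eq.subset)
  have hΓc : IsCompact Γ := (hW.bdd.subset ((image_mono hSD).trans h.image_eq.subset)).isCompact_closure
  have hΓd : ∀ x ∈ Γ, ∀ y ∈ Γ, dist x y ≤ δ / 2 := by
    have := closure_minimal (s := (φ '' S) ×ˢ (φ '' S)) (t := {p : ℂ × ℂ | dist p.1 p.2 ≤ δ / 2})
      (by
        rintro ⟨_, _⟩ ⟨⟨z, hz, rfl⟩, ⟨z', hz', rfl⟩⟩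
        exact hcut z hz z' hz') (isClosed_le (by fun_prop) continuous_const)
    rw [closure_prod_eq] at this
    exact fun x hx y hy => this (show (x, y) ∈ Γ ×ˢ Γ from ⟨hx, hy⟩)
  have hSne : ((1 - r : ℝ) : ℂ) * ζ ∈ S := by
    refine ⟨?_, ?_⟩
    · rw [mem_ball_zero_iff, norm_mul, hζ, mul_one, Complex.norm_real, Real.norm_eq_abs,
        abs_of_pos (by linarith)]
      linarith
    · rw [mem_sphere_iff_norm]
      have : ((1 - r : ℝ) : ℂ) * ζ - ζ = -((r : ℂ) * ζ) := by push_cast; ring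
      rw [this, norm_neg, norm_mul, hζ, mul_one, Complex.norm_real, Real.norm_eq_abs, abs_of_pos hr]
  set z₀ := ((1 - r : ℝ) : ℂ) * ζ
  set x₀ := φ z₀
  have hx₀ : x₀ ∈ Γ := subset_closure ⟨z₀, hSne, rfl⟩
  have hx₀η : η ≤ dist (φ 0) x₀ := by
    by_contra! hlt
    rw [dist_comm] at hlt
    obtain ⟨y, hy, hyx⟩ := hηb hlt
    have hy1 : y ∈ ball (0 : ℂ) 1 := ball_subset_ball (by norm_num) hy
    have := h.injOn hy1 (hSD hSne) hyx
    rw [this, mem_ball_zero_iff, norm_mul, hζ, mul_one, Complex.norm_real, Real.norm_eq_abs,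
      abs_of_pos (by linarith)] at hy
    linarith
  -- the arc of the curve cut off near the crosscut
  obtain ⟨J, hJc, hJ, hJC, hJb, hΓJ, hΓCJ⟩ : ∃ J : Set ℂ, IsCompact J ∧ IsPreconnected (Γ ∪ J) ∧
      J ⊆ C ∧ J ⊆ ball x₀ (2 * e) ∧ IsPreconnected J ∧ Γ ∩ C ⊆ J := by
    rcases (Γ ∩ C).eq_empty_or_nonempty with hemp | ⟨x, hxΓ, hxC⟩
    · exact ⟨∅, isCompact_empty, by simpa using hΓ, empty_subset _, empty_subset _,
        isPreconnected_empty, hemp.subset⟩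
    · obtain ⟨J, J', hJJ, hJc, hJ'c, hJp, -, hJe, hJ'⟩ := hloc x hxC
      have hδe : δ ≤ e := min_le_right _ _
      have hxJ : ∀ y ∈ Γ ∩ C, y ∈ J := by
        rintro y ⟨hyΓ, hyC⟩
        rw [← hJJ] at hyC
        refine hyC.resolve_right fun hy => ?_
        have h1 := hJ' y hy
        have h2 := hΓd y hyΓ x hxΓ
        have h3 : δ ≤ δ₀ := min_le_left _ _
        linarith
      refine ⟨J, hJc, hΓ.union x hxΓ (hxJ x ⟨hxΓ, hxC⟩) hJp, hJJ ▸ subset_union_left, ?_, hJp,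
        hxJ⟩
      intro y hy
      have h1 := mem_ball.1 (hJe hy)
      have h2 := hΓd x hxΓ x₀ hx₀
      rw [mem_ball]
      linarith [dist_triangle y x x₀]
  have hK₂ : Γ ∪ J ⊆ closedBall x₀ (2 * e) := by
    refine union_subset (fun y hy => ?_) (hJb.trans ball_subset_closedBall)
    have h2 := hΓd y hy x₀ hx₀
    have hδe : δ ≤ e := min_le_right _ _
    rw [mem_closedBall]
    linarith
  have hfr : frontier (φ '' B) ⊆ C ∪ (Γ ∪ J) := by
    have hBo : IsOpen (φ '' B) := h.isOpen_image hBD (isOpen_ball.inter isOpen_ball)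
    have hBW : φ '' B ⊆ W := (image_mono hBD).trans h.image_eq.subset
    intro y hy
    rw [hBo.frontier_eq] at hy
    by_cases hyW : y ∈ W
    · right; left
      obtain ⟨z, hz, rfl⟩ : ∃ z ∈ ball (0 : ℂ) 1, φ z = y := ⟨f y, h.maps' hyW, h.left y hyW⟩
      have hcl : z ∈ closedBall ζ r := by
        have hfc : ContinuousAt f (φ z) :=
          (h.diff'.differentiableAt (hW.isOpen.mem_nhds hyW)).continuousAt
        have := mem_closure_image hfc hy.1
        rw [h.right z hz] at this
        refine closure_minimal ?_ isClosed_closedBall this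
        rintro _ ⟨_, ⟨x, hx, rfl⟩, rfl⟩
        rw [h.right x hx.1]
        exact ball_subset_closedBall hx.2
      refine subset_closure ⟨z, ⟨hz, ?_⟩, rfl⟩
      rw [mem_sphere]
      refine (mem_closedBall.1 hcl).antisymm ?_
      by_contra! hlt
      exact hy.2 ⟨z, ⟨hz, hlt⟩, rfl⟩
    · left
      refine hW.front ?_
      rw [hW.isOpen.frontier_eq]
      exact ⟨closure_mono hBW hy.1, hyW⟩
  have hmain : φ '' B ⊆ closedBall x₀ (3 * e) := by
    rintro w ⟨z, hz, rfl⟩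
    by_contra hw
    rw [mem_closedBall, not_le] at hw
    have h0B : φ 0 ∈ φ '' B := by
      refine janiszewski (K₁ := C) (K₂ := Γ ∪ J) (T₁ := W) (T₂ := (closedBall x₀ (2 * e))ᶜ)
        (a := φ z) hW.jordan.isCompact (hΓc.union hJc) ?_ hW.conn
        (isPreconnected_compl_closedBall x₀ (by positivity)) hW.disj
        (disjoint_compl_left_iff_subset.2 hK₂) (h.maps (hBD hz)) (h.maps h0) ?_ ?_
        (h.isOpen_image hBD (isOpen_ball.inter isOpen_ball))
        (hW.bdd.subset ((image_mono hBD).trans h.image_eq.subset)) hfr ⟨z, hz, rfl⟩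
      · have : C ∩ (Γ ∪ J) = J := by
          ext y
          constructor
          · rintro ⟨hyC, hy | hy⟩
            · exact hΓCJ ⟨hy, hyC⟩
            · exact hy
          · exact fun hy => ⟨hJC hy, Or.inr hy⟩
        rw [this]
        exact hΓJ
      · rw [mem_compl_iff, mem_closedBall, not_le]
        linarith
      · rw [mem_compl_iff, mem_closedBall, not_le]
        linarith
    obtain ⟨y, hy, hy0⟩ := h0B
    have := h.injOn (hBD hy) h0 hy0
    have h2 := mem_ball_iff_norm.1 hy.2
    rw [this, zero_sub, norm_neg, hζ] at h2
    linarith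
  refine ⟨r, hr, fun z hz z' hz' => ?_⟩
  have h1 := mem_closedBall.1 (hmain ⟨z, hz, rfl⟩)
  have h2 := mem_closedBall'.1 (hmain ⟨z', hz', rfl⟩)
  linarith [dist_triangle (φ z) x₀ (φ z')]

end Caratheodory

theorem frontier_connectedComponentIn_subset {X : Type*} [TopologicalSpace X]
    [LocallyConnectedSpace X] {U : Set X} (hU : IsOpen U) (x : X) :
    frontier (connectedComponentIn U x) ⊆ frontier U := by
  intro y hy
  rw [hU.connectedComponentIn.frontier_eq] at hy
  rw [hU.frontier_eq]
  refine ⟨closure_mono (connectedComponentIn_subset U x) hy.1, fun hyU => hy.2 ?_⟩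
  obtain ⟨z, hz1, hz2⟩ := mem_closure_iff.1 hy.1 _ (hU.connectedComponentIn (x := y))
    (mem_connectedComponentIn hyU)
  rw [connectedComponentIn_eq hz2, ← connectedComponentIn_eq hz1]
  exact mem_connectedComponentIn hyU

/-- The point of the unit circle at angle `t`. -/
def cis (t : ℝ) : ℂ := Complex.exp (t * Complex.I)

theorem norm_cis (t : ℝ) : ‖cis t‖ = 1 := Complex.norm_exp_ofReal_mul_I t

theorem cis_mem (t : ℝ) : cis t ∈ sphere (0 : ℂ) 1 := mem_sphere_zero_iff_norm.2 (norm_cis t)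

theorem cis_ne_zero (t : ℝ) : cis t ≠ 0 := Complex.exp_ne_zero _

theorem cis_add (s t : ℝ) : cis (s + t) = cis s * cis t := by
  rw [cis, cis, cis, ← Complex.exp_add]
  congr 1
  push_cast
  ring

theorem cis_zero : cis 0 = 1 := by simp [cis]

theorem cis_pi : cis Real.pi = -1 := by simp [cis]

theorem cis_neg_pi : cis (-Real.pi) = -1 := by simp [cis, Complex.exp_neg]

theorem cis_two_pi_int (n : ℤ) : cis (n * (2 * Real.pi)) = 1 := by
  rw [cis, Complex.exp_eq_one_iff]
  exact ⟨n, by push_cast; ring⟩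

theorem cis_add_two_pi (t : ℝ) : cis (t + 2 * Real.pi) = cis t := by
  have := cis_two_pi_int 1
  rw [Int.cast_one, one_mul] at this
  rw [cis_add, this, mul_one]

theorem continuous_cis : Continuous cis := by
  unfold cis
  fun_prop

theorem exists_cis_eq {z : ℂ} (hz : ‖z‖ = 1) (a : ℝ) :
    ∃ t ∈ Ico a (a + 2 * Real.pi), cis t = z := by
  have hp := Real.two_pi_pos
  refine ⟨toIcoMod hp a z.arg, toIcoMod_mem_Ico hp a _, ?_⟩
  have h1 : cis z.arg = z := by
    have := Complex.norm_mul_exp_arg_mul_I z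
    rwa [hz, Complex.ofReal_one, one_mul] at this
  rw [← h1]
  have h2 := toIcoMod_add_toIcoDiv_zsmul hp a z.arg
  nth_rewrite 2 [← h2]
  rw [cis_add, zsmul_eq_mul, cis_two_pi_int, mul_one, h1]

theorem arg_cis {t : ℝ} (h : t ∈ Ioc (-Real.pi) Real.pi) : (cis t).arg = t := by
  rw [cis, Complex.exp_mul_I]
  exact Complex.arg_cos_add_sin_mul_I h

theorem cis_injOn (a : ℝ) : InjOn cis (Ioo a (a + 2 * Real.pi)) := by
  intro x hx y hy h
  have h1 : cis (x - (a + Real.pi)) = cis (y - (a + Real.pi)) := by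
    rw [sub_eq_add_neg, sub_eq_add_neg, cis_add, cis_add, h]
  have h2 := congrArg Complex.arg h1
  rw [arg_cis ⟨by linarith [hx.1], by linarith [hx.2]⟩,
    arg_cis ⟨by linarith [hy.1], by linarith [hy.2]⟩] at h2
  linarith

theorem cis_injOn_Ico (a : ℝ) : InjOn cis (Ico a (a + 2 * Real.pi)) := by
  intro x hx y hy h
  have hp := Real.pi_pos
  rcases le_total x y with hxy | hxy
  · exact cis_injOn (y - 2 * Real.pi + (a + 2 * Real.pi - y) / 2)
      ⟨by linarith [hx.1, hy.2], by linarith [hy.2]⟩ ⟨by linarith [hy.1], by linarith [hy.2]⟩ h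
  · exact cis_injOn (x - 2 * Real.pi + (a + 2 * Real.pi - x) / 2)
      ⟨by linarith [hx.1], by linarith [hx.2]⟩ ⟨by linarith [hx.2, hy.1], by linarith [hx.2]⟩ h

theorem arg_mul_cis {r t : ℝ} (hr : 0 < r) (h : t ∈ Ioc (-Real.pi) Real.pi) :
    ((r : ℂ) * cis t).arg = t := by
  rw [Complex.arg_real_mul _ hr, arg_cis h]

/-- A function on a simple closed curve has a logarithm on proper compact subsets. -/
theorem IsJordan.hasLog_of_ssubset {X : Type*} [TopologicalSpace X] [T2Space X] {C K : Set X}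
    (hC : IsJordan C) {f : X → ℂ} (hf : ContinuousOn f C) (h0 : ∀ x ∈ C, f x ≠ 0) (hK : IsClosed K)
    (hKC : K ⊆ C) {x : X} (hx : x ∈ C) (hxK : x ∉ K) : HasLog f K := by
  obtain ⟨c, hc, hi, rfl⟩ := hC
  obtain ⟨u, hu, rfl⟩ := hx
  obtain ⟨a, -, ha⟩ := exists_cis_eq (mem_sphere_zero_iff_norm.1 hu) 0
  set γ : ℝ → X := fun t => c (cis t) with hγ
  have hγc : Continuous γ := by
    rw [← continuousOn_univ]
    exact hc.comp continuous_cis.continuousOn fun t _ => cis_mem t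
  set L := Icc a (a + 2 * Real.pi) ∩ γ ⁻¹' K
  have hL : IsCompact L := isCompact_Icc.inter_right (hK.preimage hγc)
  have hLo : L ⊆ Ioo a (a + 2 * Real.pi) := by
    rintro t ⟨ht, htK⟩
    refine ⟨ht.1.lt_of_ne ?_, ht.2.lt_of_ne ?_⟩
    · rintro rfl
      exact hxK (by rw [← ha]; exact htK)
    · rintro rfl
      rw [mem_preimage, hγ] at htK
      simp only [cis_add_two_pi] at htK
      exact hxK (by rw [← ha]; exact htK)
  have hlog : HasLog (fun t => f (γ t)) (Icc a (a + 2 * Real.pi)) :=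
    hasLog_Icc (hf.comp hγc.continuousOn fun t _ => ⟨_, cis_mem t, rfl⟩)
      fun t _ => h0 _ ⟨_, cis_mem t, rfl⟩
  refine (HasLog.image hL hγc.continuousOn (fun s hs t ht hst => cis_injOn a (hLo hs) (hLo ht)
    (hi (cis_mem s) (cis_mem t) hst)) (hlog.mono inter_subset_left)).mono ?_
  intro y hy
  obtain ⟨v, hv, rfl⟩ := hKC hy
  obtain ⟨t, ht, rfl⟩ := exists_cis_eq (mem_sphere_zero_iff_norm.1 hv) a
  exact ⟨t, ⟨Ico_subset_Icc_self ht, hy⟩, rfl⟩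

/-- Two radii separate the plane. -/
theorem exists_mem_radius {K : Set ℂ} (hK : IsPreconnected K) (h0 : (0 : ℂ) ∉ K)
    {α β t₁ t₂ r : ℝ} (hr : 0 < r) (h1 : α < t₁) (h2 : t₁ < β) (h3 : β < t₂)
    (h4 : t₂ < α + 2 * Real.pi) (hα : (r : ℂ) * cis α ∈ K) (hβ : (r : ℂ) * cis β ∈ K) :
    ∃ ρ : ℝ, 0 < ρ ∧ ((ρ : ℂ) * cis t₁ ∈ K ∨ (ρ : ℂ) * cis t₂ ∈ K) := by
  by_contra! hcon
  set s := -t₁ - Real.pi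
  have hrot : ∀ z : ℂ, z = (‖z‖ : ℂ) * cis ((z * cis s).arg - s) := by
    intro z
    have := Complex.norm_mul_exp_arg_mul_I (z * cis s)
    rw [norm_mul, norm_cis, mul_one] at this
    have h5 : cis s * cis (-s) = 1 := by rw [← cis_add, add_neg_cancel, cis_zero]
    rw [sub_eq_add_neg, cis_add, ← mul_assoc]
    change _ = (‖z‖ : ℂ) * Complex.exp _ * _
    rw [this, mul_assoc, h5, mul_one]
  have hslit : ∀ z ∈ K, z * cis s ∈ Complex.slitPlane := by
    intro z hz
    have hz0 : z ≠ 0 := fun h => h0 (h ▸ hz)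
    rw [Complex.mem_slitPlane_iff_arg]
    refine ⟨fun h => ?_, mul_ne_zero hz0 (cis_ne_zero s)⟩
    have h6 := hrot z
    rw [h, show Real.pi - s = t₁ + 2 * Real.pi by simp only [s]; ring, cis_add_two_pi] at h6
    exact (hcon ‖z‖ (norm_pos_iff.2 hz0)).1 (h6 ▸ hz)
  have hc : ContinuousOn (fun z => (z * cis s).arg) K := fun z hz =>
    ((Complex.continuousAt_arg (hslit z hz)).comp
      (f := fun z => z * cis s) (by fun_prop)).continuousWithinAt
  have hoc := (hK.image _ hc).ordConnected
  have e1 : ((r : ℂ) * cis β * cis s).arg = β + s := by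
    rw [mul_assoc, ← cis_add]
    exact arg_mul_cis hr ⟨by simp only [s]; linarith, by simp only [s]; linarith⟩
  have e2 : ((r : ℂ) * cis α * cis s).arg = α + 2 * Real.pi + s := by
    rw [← cis_add_two_pi, mul_assoc, ← cis_add]
    exact arg_mul_cis hr ⟨by simp only [s]; linarith, by simp only [s]; linarith⟩
  obtain ⟨z, hz, hzt⟩ := hoc.out ⟨_, hβ, e1⟩ ⟨_, hα, e2⟩
    (show t₂ + s ∈ Icc (β + s) (α + 2 * Real.pi + s) from ⟨by linarith, by linarith⟩)
  have hz0 : z ≠ 0 := fun h => h0 (h ▸ hz)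
  have h6 := hrot z
  simp only at hzt
  rw [hzt, add_sub_cancel_right] at h6
  exact (hcon ‖z‖ (norm_pos_iff.2 hz0)).2 (h6 ▸ hz)

/-- A continuous function on the closed disc, holomorphic inside and constant on a boundary arc,
takes that constant value at the centre. -/
theorem eq_of_eqOn_arc {Φ : ℂ → ℂ} (hc : ContinuousOn Φ (closedBall 0 1))
    (hd : DifferentiableOn ℂ Φ (ball 0 1)) {α β : ℝ} (hαβ : α < β) {q : ℂ}
    (h : ∀ t ∈ Ioo α β, Φ (cis t) = q) : Φ 0 = q := by
  have hp := Real.two_pi_pos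
  obtain ⟨N, hN⟩ := exists_nat_gt (2 * Real.pi / (β - α))
  have hN0 : (0 : ℝ) < N := lt_of_le_of_lt (div_nonneg hp.le (by linarith)) hN
  have hN' : 0 < N := by exact_mod_cast hN0
  rw [div_lt_iff₀ (by linarith)] at hN
  set ω : ℕ → ℂ := fun k => cis (2 * Real.pi * k / N) with hω
  have hωn : ∀ k z, ‖ω k * z‖ = ‖z‖ := fun k z => by rw [norm_mul, hω]; simp [norm_cis]
  set F : ℂ → ℂ := fun z => ∏ k ∈ Finset.range N, (Φ (ω k * z) - q) with hF
  have hFd : DiffContOnCl ℂ F (ball 0 1) := by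
    refine DiffContOnCl.mk ?_ ?_
    · refine DifferentiableOn.fun_finsetProd fun k _ => ?_
      refine (hd.comp (by fun_prop) fun z hz => ?_).sub_const q
      rw [mem_ball_zero_iff] at *
      rwa [hωn]
    · rw [closure_ball _ one_ne_zero]
      refine continuousOn_finsetProd _ fun k _ => ?_
      refine (hc.comp (by fun_prop) fun z hz => ?_).sub continuousOn_const
      rw [mem_closedBall_zero_iff] at *
      rwa [hωn]
  have hF0 : ∀ z ∈ frontier (ball (0 : ℂ) 1), ‖F z‖ ≤ 0 := by
    intro z hz
    rw [frontier_ball _ one_ne_zero, mem_sphere_zero_iff_norm] at hz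
    obtain ⟨s, -, rfl⟩ := exists_cis_eq hz 0
    rw [norm_le_zero_iff, hF]
    set m : ℤ := ⌊(α - s) * N / (2 * Real.pi)⌋ + 1
    have hm1 : (α - s) * N / (2 * Real.pi) < m := by
      simp only [m]; push_cast; exact Int.lt_floor_add_one _
    have hm2 : (m : ℝ) ≤ (α - s) * N / (2 * Real.pi) + 1 := by
      simp only [m]; push_cast; linarith [Int.floor_le ((α - s) * N / (2 * Real.pi))]
    have hmN : 0 ≤ m % N := Int.emod_nonneg _ (by exact_mod_cast hN'.ne')
    have hmN' : m % N < N := Int.emod_lt_of_pos _ (by exact_mod_cast hN')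
    refine Finset.prod_eq_zero (i := (m % N).toNat) ?_ ?_
    · rw [Finset.mem_range]
      omega
    · rw [sub_eq_zero]
      have e1 : ω (m % N).toNat * cis s = cis (s + 2 * Real.pi * m / N) := by
        have e2 : (((m % N).toNat : ℕ) : ℝ) = m - N * (m / N : ℤ) := by
          have : (((m % N).toNat : ℕ) : ℤ) = m - N * (m / N) := by
            rw [Int.toNat_of_nonneg hmN]
            linarith [Int.emod_add_mul_ediv m N]
          exact_mod_cast this
        have e3 : s + 2 * Real.pi * m / N = 2 * Real.pi * ((m % N).toNat : ℕ) / N + s +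
            (m / N : ℤ) * (2 * Real.pi) := by
          rw [e2]
          field_simp
          ring
        rw [e3, cis_add, cis_two_pi_int, mul_one, cis_add]
      rw [e1]
      rw [div_lt_iff₀ hp] at hm1
      refine h _ ⟨?_, ?_⟩
      · have : α - s < 2 * Real.pi * m / N := by
          rw [lt_div_iff₀ hN0]
          linarith
        linarith
      · have : 2 * Real.pi * m / N < β - s := by
          rw [div_lt_iff₀ hN0]
          have := mul_le_mul_of_nonneg_left hm2 hp.le
          have e4 : 2 * Real.pi * ((α - s) * N / (2 * Real.pi) + 1) = (α - s) * N + 2 * Real.pi := by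
            field_simp
          nlinarith
        linarith
  have := Complex.norm_le_of_forall_mem_frontier_norm_le isBounded_ball hFd hF0
    (subset_closure (mem_ball_self one_pos))
  rw [norm_le_zero_iff, hF] at this
  simp only [mul_zero, Finset.prod_const, Finset.card_range] at this
  exact sub_eq_zero.1 (pow_eq_zero_iff hN'.ne' |>.1 this)

section Caratheodory

variable {C W : Set ℂ} {φ f : ℂ → ℂ}

theorem JordanDomain.ulc (hW : JordanDomain C W) {q : ℂ} (hq : q ∈ C) {ε : ℝ} (hε : 0 < ε) :
    ∃ δ > 0, ∀ w ∈ W ∩ ball q δ, ∀ w' ∈ W ∩ ball q δ,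
      ∃ T, IsPreconnected T ∧ T ⊆ W ∩ ball q ε ∧ w ∈ T ∧ w' ∈ T := by
  obtain ⟨δ, hδ, hloc⟩ := hW.jordan.localArc hε
  obtain ⟨J, J', hJJ, hJc, hJ'c, hJ, hJ', hJε, hJδ⟩ := hloc q hq
  refine ⟨min δ ε, lt_min hδ hε, fun w hw w' hw' => ?_⟩
  have hU : IsOpen (W ∩ ball q ε) := hW.isOpen.inter isOpen_ball
  have hsub : W ∩ ball q (min δ ε) ⊆ W ∩ ball q ε :=
    inter_subset_inter_right _ (ball_subset_ball (min_le_right _ _))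
  set O := connectedComponentIn (W ∩ ball q ε) w
  have hwO : w ∈ O := mem_connectedComponentIn (hsub hw)
  have hOs : O ⊆ W ∩ ball q ε := connectedComponentIn_subset _ _
  refine ⟨O, isPreconnected_connectedComponentIn, hOs, hwO, ?_⟩
  have hfr : frontier O ⊆ C ∪ (J' ∪ sphere q ε) := by
    intro y hy
    have := frontier_inter_subset _ _ (frontier_connectedComponentIn_subset hU w hy)
    rcases this with h | h
    · exact Or.inl (hW.front h.1)
    · exact Or.inr (Or.inr (frontier_ball_subset_sphere h.2))
  refine janiszewski (K₁ := C) (K₂ := J' ∪ sphere q ε) (T₁ := W) (T₂ := ball q (min δ ε))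
    hW.jordan.isCompact (hJ'c.union (isCompact_sphere _ _)) ?_ hW.conn
    (convex_ball _ _).isPreconnected hW.disj ?_ hw.1 hw'.1 hw.2 hw'.2
    hU.connectedComponentIn (hW.bdd.subset (hOs.trans inter_subset_left)) hfr hwO
  · have : C ∩ (J' ∪ sphere q ε) = J' := by
      ext y
      constructor
      · rintro ⟨hyC, hy | hy⟩
        · exact hy
        · rw [← hJJ] at hyC
          refine hyC.resolve_left fun hyJ => ?_
          exact (mem_ball.1 (hJε hyJ)).ne (mem_sphere.1 hy)
      · exact fun hy => ⟨hJJ ▸ Or.inr hy, Or.inl hy⟩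
    rw [this]
    exact hJ'
  · rw [disjoint_left]
    rintro y hy (hy' | hy')
    · exact (hJδ y hy').not_gt ((mem_ball.1 hy).trans_le (min_le_left _ _))
    · exact ((mem_ball.1 hy).trans_le (min_le_right _ _)).ne (mem_sphere.1 hy')

theorem JordanDomain.exists_extension (hW : JordanDomain C W) (h : ConformalPair W φ f) :
    ∃ Φ : ℂ → ℂ, ContinuousOn Φ (closedBall 0 1) ∧ EqOn Φ φ (ball 0 1) ∧
      MapsTo Φ (sphere 0 1) C := by
  have heq : EqOn (extendFrom (ball (0 : ℂ) 1) φ) φ (ball 0 1) := fun z hz =>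
    extendFrom_extends h.diff.continuousOn z hz
  have hcl : closedBall (0 : ℂ) 1 ⊆ closure (ball 0 1) := (closure_ball _ one_ne_zero).ge
  have hc : ContinuousOn (extendFrom (ball (0 : ℂ) 1) φ) (closedBall 0 1) := by
    refine continuousOn_extendFrom hcl fun z hz => ?_
    rw [mem_closedBall_zero_iff] at hz
    rcases hz.lt_or_eq with hz1 | hz1
    · exact ⟨φ z, h.diff.continuousOn z (mem_ball_zero_iff.2 hz1)⟩
    · have : (𝓝[ball 0 1] z).NeBot := mem_closure_iff_nhdsWithin_neBot.1
        (hcl (mem_closedBall_zero_iff.2 hz))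
      rw [← cauchy_map_iff_exists_tendsto, Metric.cauchy_iff]
      refine ⟨inferInstance, fun ε hε => ?_⟩
      obtain ⟨r, hr, hrd⟩ := hW.small_ends h hz1 (half_pos hε)
      refine ⟨φ '' (ball 0 1 ∩ ball z r), image_mem_map (inter_mem self_mem_nhdsWithin
        (mem_nhdsWithin_of_mem_nhds (ball_mem_nhds z hr))), ?_⟩
      rintro _ ⟨x, hx, rfl⟩ _ ⟨y, hy, rfl⟩
      exact (hrd x hx y hy).trans_lt (half_lt_self hε)
  refine ⟨_, hc, heq, fun z hz => hW.front ?_⟩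
  have hz1 := sphere_subset_closedBall hz
  have hmem : extendFrom (ball (0 : ℂ) 1) φ z ∈ closure W := by
    have := (hc z hz1).mono ball_subset_closedBall |>.mem_closure_image (hcl hz1)
    rwa [heq.image_eq, h.image_eq] at this
  rw [hW.isOpen.frontier_eq]
  refine ⟨hmem, fun hzW => ?_⟩
  have : (𝓝[ball 0 1] z).NeBot := mem_closure_iff_nhdsWithin_neBot.1 (hcl hz1)
  have hfc : ContinuousAt f (extendFrom (ball (0 : ℂ) 1) φ z) :=
    (h.diff'.differentiableAt (hW.isOpen.mem_nhds hzW)).continuousAt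
  have ht : Tendsto (fun x => f (extendFrom (ball (0 : ℂ) 1) φ x)) (𝓝[ball 0 1] z)
      (𝓝 (f (extendFrom (ball (0 : ℂ) 1) φ z))) :=
    hfc.tendsto.comp ((hc z hz1).mono ball_subset_closedBall)
  have ht' : Tendsto (fun x => f (extendFrom (ball (0 : ℂ) 1) φ x)) (𝓝[ball 0 1] z) (𝓝 z) := by
    refine Tendsto.congr' ?_ (tendsto_id.mono_left nhdsWithin_le_nhds)
    filter_upwards [self_mem_nhdsWithin] with x hx
    rw [heq hx, h.right x hx, id]
  have h1 := mem_ball_zero_iff.1 (h.maps' hzW)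
  rw [tendsto_nhds_unique ht ht', mem_sphere_zero_iff_norm.1 hz] at h1
  exact lt_irrefl _ h1

theorem JordanDomain.eq_or_eq (hW : JordanDomain C W) (h : ConformalPair W φ f) {Φ : ℂ → ℂ}
    (hc : ContinuousOn Φ (closedBall 0 1)) (he : EqOn Φ φ (ball 0 1)) {q : ℂ} (hq : q ∈ C)
    {α β t₁ t₂ : ℝ} (h1 : α < t₁) (h2 : t₁ < β) (h3 : β < t₂) (h4 : t₂ < α + 2 * Real.pi)
    (hα : Φ (cis α) = q) (hβ : Φ (cis β) = q) : Φ (cis t₁) = q ∨ Φ (cis t₂) = q := by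
  by_contra! hcon
  have hmk : ∀ (t ρ : ℝ), 0 ≤ ρ → ‖(ρ : ℂ) * cis t‖ = ρ := fun t ρ hρ => by
    rw [norm_mul, norm_cis, mul_one, Complex.norm_real, Real.norm_eq_abs, abs_of_nonneg hρ]
  have hrc : ∀ t, ContinuousOn (fun ρ : ℝ => Φ (ρ * cis t)) (Icc 0 1) := fun t =>
    hc.comp (by fun_prop) fun ρ hρ => by
      rw [mem_closedBall_zero_iff, hmk t ρ hρ.1]
      exact hρ.2
  have hrad : ∀ t, Φ (cis t) ≠ q → ∃ ε > 0, ∀ ρ ∈ Icc (0 : ℝ) 1, ε ≤ dist (Φ (ρ * cis t)) q := by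
    intro t ht
    refine isCompact_Icc.exists_forall_le' (continuous_dist.comp_continuousOn
      ((hrc t).prodMk continuousOn_const)) fun ρ hρ => ?_
    show 0 < dist (Φ (ρ * cis t)) q
    rw [dist_pos]
    rcases hρ.2.lt_or_eq with h5 | rfl
    · have h6 : (ρ : ℂ) * cis t ∈ ball (0 : ℂ) 1 := by
        rw [mem_ball_zero_iff, hmk t ρ hρ.1]
        exact h5
      rw [he h6]
      intro h7
      exact disjoint_left.1 hW.disj (h.maps h6) (h7 ▸ hq)
    · rwa [Complex.ofReal_one, one_mul]
  obtain ⟨ε₁, hε₁, hr₁⟩ := hrad t₁ hcon.1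
  obtain ⟨ε₂, hε₂, hr₂⟩ := hrad t₂ hcon.2
  obtain ⟨δ, hδ, hulc⟩ := hW.ulc hq (lt_min hε₁ hε₂)
  have hnear : ∀ t, Φ (cis t) = q → ∀ᶠ ρ : ℝ in 𝓝[Icc 0 1] 1, Φ (ρ * cis t) ∈ ball q δ := by
    intro t ht
    have := hrc t 1 ⟨zero_le_one, le_rfl⟩
    rw [ContinuousWithinAt, Complex.ofReal_one, one_mul, ht] at this
    exact this (ball_mem_nhds q hδ)
  have hsub : 𝓝[Ioo 0 1] (1 : ℝ) ≤ 𝓝[Icc 0 1] 1 := nhdsWithin_mono _ Ioo_subset_Icc_self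
  have : (𝓝[Ioo 0 1] (1 : ℝ)).NeBot := by
    rw [← mem_closure_iff_nhdsWithin_neBot, closure_Ioo zero_ne_one]
    exact ⟨zero_le_one, le_rfl⟩
  obtain ⟨r, ⟨hrα, hrβ⟩, hr⟩ := ((((hnear α hα).and (hnear β hβ)).filter_mono hsub).and
    (self_mem_nhdsWithin : Ioo (0 : ℝ) 1 ∈ 𝓝[Ioo 0 1] 1)).exists
  have hrb : ∀ t, (r : ℂ) * cis t ∈ ball (0 : ℂ) 1 := fun t => by
    rw [mem_ball_zero_iff, hmk t r hr.1.le]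
    exact hr.2
  rw [he (hrb _)] at hrα hrβ
  obtain ⟨T, hT, hTW, hTα, hTβ⟩ := hulc _ ⟨h.maps (hrb α), hrα⟩ _ ⟨h.maps (hrb β), hrβ⟩
  have hTW' : T ⊆ W := hTW.trans inter_subset_left
  have hfar : ∀ t, ∀ ε, min ε₁ ε₂ ≤ ε → (∀ ρ ∈ Icc (0 : ℝ) 1, ε ≤ dist (Φ (ρ * cis t)) q) →
      ∀ ρ : ℝ, 0 ≤ ρ → (ρ : ℂ) * cis t ∉ f '' T := by
    rintro t ε hε hρε ρ hρ ⟨w, hw, hwρ⟩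
    have h5 := h.maps' (hTW' hw)
    rw [hwρ] at h5
    have h6 := hρε ρ ⟨hρ, by rw [← hmk t ρ hρ]; exact (mem_ball_zero_iff.1 h5).le⟩
    rw [he h5, ← hwρ, h.left w (hTW' hw)] at h6
    have := mem_ball.1 (hTW hw).2
    linarith
  obtain ⟨ρ, hρ, h5⟩ := exists_mem_radius
    (hT.image f (h.diff'.continuousOn.mono hTW')) (fun h0 => hfar t₁ ε₁ (min_le_left _ _) hr₁ 0 le_rfl (by simpa using h0)) hr.1 h1 h2 h3 h4
    ⟨_, hTα, h.right _ (hrb α)⟩ ⟨_, hTβ, h.right _ (hrb β)⟩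
  rcases h5 with h5 | h5
  · exact hfar t₁ ε₁ (min_le_left _ _) hr₁ ρ hρ.le h5
  · exact hfar t₂ ε₂ (min_le_right _ _) hr₂ ρ hρ.le h5

/-- Carathéodory's theorem: a bounded complementary domain of a simple closed curve in the plane,
together with the curve, is a closed disc. -/
theorem JordanDomain.exists_disc (hW : JordanDomain C W) (hne : W.Nonempty)
    (hWc : IsPreconnected Wᶜ) :
    ∃ Φ : ℂ → ℂ, ContinuousOn Φ (closedBall 0 1) ∧ InjOn Φ (closedBall 0 1) ∧
      Φ '' ball 0 1 = W ∧ Φ '' sphere 0 1 = C := by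
  obtain ⟨w₀, hw₀⟩ := hne
  obtain ⟨φ, f, hp1, hp2, hp3, hp4, hp5, hp6⟩ := exists_riemannMap hW.isOpen hW.conn hW.bdd hWc hw₀
  have h : ConformalPair W φ f := ⟨hp1, hp2, hp3, hp4, hp5, hp6⟩
  obtain ⟨Φ, hc, he, hm⟩ := hW.exists_extension h
  have h0 : (0 : ℂ) ∈ ball (0 : ℂ) 1 := mem_ball_self one_pos
  have hWeq : Φ '' ball 0 1 = W := by rw [he.image_eq, h.image_eq]
  have hconst : ∀ α β : ℝ, α < β → ∀ q ∈ C, ∃ t ∈ Ioo α β, Φ (cis t) ≠ q := by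
    intro α β hαβ q hq
    by_contra! hcon
    have h2 := eq_of_eqOn_arc hc (h.diff.congr he) hαβ hcon
    rw [he h0] at h2
    exact disjoint_left.1 hW.disj (h.maps h0) (h2 ▸ hq)
  have hsph : ∀ α β : ℝ, α < β → β < α + 2 * Real.pi → Φ (cis α) ≠ Φ (cis β) := by
    intro α β h1 h2 h3
    have hq : Φ (cis β) ∈ C := hm (cis_mem β)
    obtain ⟨t₁, ht₁, hn₁⟩ := hconst α β h1 _ hq
    obtain ⟨t₂, ht₂, hn₂⟩ := hconst β (α + 2 * Real.pi) h2 _ hq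
    rcases hW.eq_or_eq h hc he hq ht₁.1 ht₁.2 ht₂.1 ht₂.2 h3 rfl with h4 | h4
    · exact hn₁ h4
    · exact hn₂ h4
  have hsphi : InjOn Φ (sphere 0 1) := by
    intro x hx y hy hxy
    obtain ⟨a, ha, rfl⟩ := exists_cis_eq (mem_sphere_zero_iff_norm.1 hx) 0
    obtain ⟨b, hb, rfl⟩ := exists_cis_eq (mem_sphere_zero_iff_norm.1 hy) 0
    rcases lt_trichotomy a b with h1 | h1 | h1
    · exact absurd hxy (hsph a b h1 (by linarith [ha.1, hb.2]))
    · rw [h1]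
    · exact absurd hxy.symm (hsph b a h1 (by linarith [hb.1, ha.2]))
  have hcb : closedBall (0 : ℂ) 1 = ball 0 1 ∪ sphere 0 1 := ball_union_sphere.symm
  have hinj : InjOn Φ (closedBall 0 1) := by
    have hmix : ∀ x ∈ ball (0 : ℂ) 1, ∀ y ∈ sphere (0 : ℂ) 1, Φ x ≠ Φ y := fun x hx y hy hxy =>
      disjoint_left.1 hW.disj (hWeq ▸ mem_image_of_mem Φ hx) (hxy ▸ hm hy)
    rw [hcb]
    rintro x (hx | hx) y (hy | hy) hxy
    · exact h.injOn hx hy (by rw [← he hx, ← he hy, hxy])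
    · exact absurd hxy (hmix x hx y hy)
    · exact absurd hxy.symm (hmix y hy x hx)
    · exact hsphi hx hy hxy
  refine ⟨Φ, hc, hinj, hWeq, hm.image_subset.antisymm fun x hx => ?_⟩
  by_contra hxn
  have hfr : frontier W ⊆ Φ '' sphere 0 1 := by
    intro y hy
    rw [hW.isOpen.frontier_eq] at hy
    have h1 : closure W ⊆ Φ '' closedBall 0 1 :=
      closure_minimal (hWeq ▸ image_mono ball_subset_closedBall)
        ((isCompact_closedBall _ _).image_of_continuousOn hc).isClosed
    obtain ⟨z, hz, rfl⟩ := h1 hy.1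
    rw [hcb] at hz
    rcases hz with hz | hz
    · exact absurd (hWeq ▸ mem_image_of_mem Φ hz) hy.2
    · exact ⟨z, hz, rfl⟩
  refine not_hasLog_frontier hW.bdd hw₀ (HasLog.mono ?_ hfr)
  refine hW.jordan.hasLog_of_ssubset (by fun_prop) (fun y hy h0 => ?_)
    ((isCompact_sphere _ _).image_of_continuousOn (hc.mono sphere_subset_closedBall)).isClosed
    hm.image_subset hx hxn
  rw [sub_eq_zero] at h0
  exact disjoint_left.1 hW.disj hw₀ (h0 ▸ hy)

end Caratheodory

/-- Nonvanishing functions homotopic to a constant have logarithms. -/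
theorem hasLog_of_homotopy {X : Type*} [TopologicalSpace X] {V : Set X} {H : ℝ → X → ℂ}
    (hc : ContinuousOn (fun p : ℝ × X => H p.1 p.2) (Icc 0 1 ×ˢ V))
    (h0 : ∀ t ∈ Icc (0 : ℝ) 1, ∀ x ∈ V, H t x ≠ 0) {c : ℂ} (h1 : ∀ x ∈ V, H 0 x = c) :
    HasLog (H 1) V := by
  rcases V.eq_empty_or_nonempty with rfl | ⟨x₀, hx₀⟩
  · exact ⟨fun _ => 0, continuousOn_empty _, by simp⟩
  have hc0 : c ≠ 0 := h1 x₀ hx₀ ▸ h0 0 ⟨le_rfl, zero_le_one⟩ x₀ hx₀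
  let F : C(I × V, {z : ℂ // z ≠ 0}) :=
    ⟨fun p => ⟨H p.1 p.2, h0 p.1 p.1.2 p.2 p.2.2⟩, by
      refine Continuous.subtype_mk ?_ _
      exact hc.comp_continuous (f := fun p : I × V => ((p.1 : ℝ), (p.2 : X))) (by fun_prop)
        fun p => ⟨p.1.2, p.2.2⟩⟩
  have hF0 : ∀ a : V, F (0, a) = ⟨_, Complex.exp_ne_zero (Complex.log c)⟩ := fun a =>
    Subtype.ext ((h1 a a.2).trans (Complex.exp_log hc0).symm)
  let G := Complex.isCoveringMap_exp.liftHomotopy F (.const V (Complex.log c)) hF0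
  have hG : ∀ p, Complex.exp (G p) = F p := fun p =>
    congrArg Subtype.val (congr_fun (Complex.isCoveringMap_exp.liftHomotopy_lifts F (.const V (Complex.log c)) hF0) p)
  classical
  refine ⟨fun x => if h : x ∈ V then G (1, ⟨x, h⟩) else 0, ?_, fun x hx => ?_⟩
  · rw [continuousOn_iff_continuous_domRestrict]
    have : V.domRestrict (fun x => if h : x ∈ V then G (1, ⟨x, h⟩) else 0) =
        fun x : V => G (1, x) := by
      funext x
      simp [Set.domRestrict]
    rw [this]
    fun_prop
  · simp only [dif_pos hx]
    rw [hG]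
    rfl

/-- An arc has no winding around its endpoints. -/
theorem hasLog_compl_arc {γ : ℝ → ℂ} (hγ : ContinuousOn γ (Icc 0 1)) :
    HasLog (fun z => (z - γ 0) / (z - γ 1)) (γ '' Icc 0 1)ᶜ := by
  have hne : ∀ t ∈ Icc (0 : ℝ) 1, ∀ z ∈ (γ '' Icc 0 1)ᶜ, z - γ t ≠ 0 := fun t ht z hz h =>
    hz ⟨t, ht, (sub_eq_zero.1 h).symm⟩
  have h1 : (1 : ℝ) ∈ Icc (0 : ℝ) 1 := ⟨zero_le_one, le_rfl⟩
  have := hasLog_of_homotopy (V := (γ '' Icc 0 1)ᶜ) (c := 1)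
    (H := fun t z => (z - γ (1 - t)) / (z - γ 1)) ?_ ?_ ?_
  · simpa using this
  · have hm : MapsTo (fun p : ℝ × ℂ => 1 - p.1) (Icc (0 : ℝ) 1 ×ˢ (γ '' Icc 0 1)ᶜ) (Icc 0 1) :=
      fun p hp => ⟨by linarith [hp.1.2], by linarith [hp.1.1]⟩
    have h2 : ContinuousOn (fun p : ℝ × ℂ => γ (1 - p.1)) (Icc (0 : ℝ) 1 ×ˢ (γ '' Icc 0 1)ᶜ) :=
      hγ.comp (by fun_prop) hm
    exact (continuousOn_snd.sub h2).div (by fun_prop) fun p hp => hne 1 h1 _ hp.2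
  · exact fun t ht z hz => div_ne_zero (hne _ ⟨by linarith [ht.2], by linarith [ht.1]⟩ z hz)
      (hne 1 h1 z hz)
  · intro z hz
    rw [sub_zero]
    exact div_self (hne 1 h1 z hz)

theorem HasLog.union_open {X : Type*} [TopologicalSpace X] {f : X → ℂ} {U V : Set X}
    (hU : IsOpen U) (hV : IsOpen V) (hp : IsPreconnected (U ∩ V)) (h : HasLog f U)
    (h' : HasLog f V) : HasLog f (U ∪ V) := by
  classical
  obtain ⟨g, hg, he⟩ := h
  obtain ⟨g', hg', he'⟩ := h'
  obtain ⟨c, hc, hgc⟩ := log_unique hp (hg.mono inter_subset_left) (hg'.mono inter_subset_right)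
    fun x hx => (he x hx.1).trans (he' x hx.2).symm
  have h1 : EqOn (fun x => if x ∈ U then g x else g' x + c) g U := fun x hx => if_pos hx
  have h2 : EqOn (fun x => if x ∈ U then g x else g' x + c) (fun x => g' x + c) V := fun x hx => by
    by_cases hxU : x ∈ U
    · simp only [if_pos hxU]
      exact hgc x ⟨hxU, hx⟩
    · simp only [if_neg hxU]
  refine ⟨fun x => if x ∈ U then g x else g' x + c, ?_, ?_⟩
  · exact (hg.congr h1).union_of_isOpen ((hg'.add continuousOn_const).congr h2) hU hV
  · rintro x (hx | hx)
    · rw [h1 hx, he x hx]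
    · rw [h2 hx, Complex.exp_add, hc, mul_one, he' x hx]

/-- Half of the Jordan curve theorem. -/
theorem IsJordan.not_isPreconnected_compl_plane {C : Set ℂ} (hC : IsJordan C) :
    ¬ IsPreconnected Cᶜ := by
  intro hp
  obtain ⟨c, hc, hi, rfl⟩ := hC
  have harc : ∀ s : ℝ, ContinuousOn (fun t : ℝ => c (cis (s * (Real.pi * t)))) (Icc 0 1) := fun s =>
    hc.comp (continuous_cis.comp (by fun_prop)).continuousOn fun t _ => cis_mem _
  have h1 := hasLog_compl_arc (harc 1)
  have h2 := hasLog_compl_arc (harc (-1))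
  have hA := (isCompact_Icc.image_of_continuousOn (harc 1)).isClosed
  have hB := (isCompact_Icc.image_of_continuousOn (harc (-1))).isClosed
  simp only [mul_zero, mul_one, one_mul, neg_one_mul, cis_zero, cis_pi, cis_neg_pi] at h1 h2 hA hB
  set A := (fun t : ℝ => c (cis (Real.pi * t))) '' Icc 0 1
  set B := (fun t : ℝ => c (cis (-(Real.pi * t)))) '' Icc 0 1
  have hpi := Real.pi_pos
  have hAB : A ∪ B = c '' sphere 0 1 := by
    apply subset_antisymm
    · rintro _ (⟨t, -, rfl⟩ | ⟨t, -, rfl⟩) <;> exact ⟨_, cis_mem _, rfl⟩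
    · rintro _ ⟨z, hz, rfl⟩
      obtain ⟨t, ht, rfl⟩ := exists_cis_eq (mem_sphere_zero_iff_norm.1 hz) (-Real.pi)
      rcases le_total 0 t with h0 | h0
      · refine Or.inl ⟨t / Real.pi, ⟨by positivity, (div_le_one hpi).2 (by linarith [ht.2])⟩, ?_⟩
        simp only [mul_div_cancel₀ t hpi.ne']
      · refine Or.inr ⟨-t / Real.pi, ⟨div_nonneg (by linarith) hpi.le,
          (div_le_one hpi).2 (by linarith [ht.1])⟩, ?_⟩
        simp only [mul_div_cancel₀ (-t) hpi.ne', neg_neg]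
  have hABi : A ∩ B ⊆ {c 1, c (-1)} := by
    rintro x ⟨⟨s, hs, rfl⟩, ⟨t, ht, hst⟩⟩
    have h3 := hi (cis_mem _) (cis_mem _) hst
    simp only [mem_insert_iff, mem_singleton_iff]
    rcases eq_or_lt_of_le hs.2 with rfl | hs1
    · exact Or.inr (by rw [mul_one, cis_pi])
    · have h4 := cis_injOn_Ico (-Real.pi) ⟨by nlinarith [ht.2], by nlinarith [ht.1]⟩
        ⟨by nlinarith [hs.1], by nlinarith [hs.1]⟩ h3
      have : s = 0 := by
        have := mul_nonneg hpi.le hs.1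
        have := mul_nonneg hpi.le ht.1
        have h5 : Real.pi * s = 0 := by linarith
        exact (mul_eq_zero.1 h5).resolve_left hpi.ne'
      subst this
      exact Or.inl (by rw [mul_zero, cis_zero])
  have hlog := HasLog.union_open hA.isOpen_compl hB.isOpen_compl
    (by rwa [← compl_union, hAB]) h1 h2
  rw [← compl_inter] at hlog
  have hlog' := hlog.mono (compl_subset_compl.2 hABi)
  have hne : c 1 ≠ c (-1) := fun h => by
    have := hi (by simp) (by simp) h
    norm_num at this
  set p := c 1
  set q := c (-1)
  have hqp : 0 < ‖q - p‖ := norm_pos_iff.2 (sub_ne_zero.2 hne.symm)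
  set r := ‖q - p‖ / 2 with hrd
  have hr : 0 < r := half_pos hqp
  have hq : HasLog (fun w => p + w - q) (sphere 0 r) := by
    have h3 : HasLog (fun w => (p - q) * (1 + w / (p - q))) (sphere 0 r) := by
      refine (hasLog_const (sub_ne_zero.2 hne)).mul (hasLog_of_slitPlane (by fun_prop) ?_)
      intro w hw
      refine Complex.mem_slitPlane_of_norm_lt_one ?_
      rw [norm_div, mem_sphere_zero_iff_norm.1 hw, norm_sub_rev, div_lt_one hqp]
      exact half_lt_self hqp
    refine h3.congr fun w _ => ?_
    field_simp [sub_ne_zero.2 hne]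
    ring
  have hpq : HasLog (fun w => (p + w - p) / (p + w - q)) (sphere 0 r) := by
    refine hlog'.comp (φ := fun w => p + w) (by fun_prop) fun w hw => ?_
    have hw' := mem_sphere_zero_iff_norm.1 hw
    simp only [mem_compl_iff, mem_insert_iff, mem_singleton_iff, not_or]
    refine ⟨fun h => ?_, fun h => ?_⟩
    · rw [add_eq_left.1 h, norm_zero] at hw'
      linarith
    · rw [eq_sub_of_add_eq' h] at hw'
      linarith
  refine not_hasLog_circle hr ((hpq.mul hq).congr fun w hw => ?_)
  rw [div_mul_cancel₀ _ (hq.ne_zero hw), add_sub_cancel_left]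

theorem IsPreconnected.diff_singleton {X : Type*} [TopologicalSpace X] [T1Space X] {U B : Set X}
    {v : X} (hU : IsPreconnected U) (hB : IsOpen B) (hv : v ∈ B) (hBU : B ⊆ U)
    (hBv : IsPreconnected (B \ {v})) : IsPreconnected (U \ {v}) := by
  have key : ∀ P Q : Set X, IsOpen P → IsOpen Q → U \ {v} ⊆ P ∪ Q → U \ {v} ∩ (P ∩ Q) = ∅ →
      B \ {v} ⊆ P → U \ {v} ⊆ P ∨ U \ {v} ⊆ Q := by
    intro P Q hP hQ hPQ hd hBP
    have h1 := isPreconnected_iff_subset_of_disjoint.1 hU (P ∪ B) (Q \ {v}) (hP.union hB)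
      (hQ.sdiff isClosed_singleton) ?_ ?_
    · rcases h1 with h1 | h1
      · left
        rintro x ⟨hx, hxv⟩
        rcases h1 hx with h | h
        exacts [h, hBP ⟨h, hxv⟩]
      · exact absurd (h1 (hBU hv)).2 (by simp)
    · intro x hx
      by_cases hxv : x = v
      · exact Or.inl (Or.inr (hxv ▸ hv))
      · rcases hPQ ⟨hx, hxv⟩ with h | h
        exacts [Or.inl (Or.inl h), Or.inr ⟨h, hxv⟩]
    · rw [eq_empty_iff_forall_notMem]
      rintro x ⟨hx, h2, h3⟩
      refine eq_empty_iff_forall_notMem.1 hd x ⟨⟨hx, h3.2⟩, ?_, h3.1⟩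
      rcases h2 with h | h
      exacts [h, hBP ⟨h, h3.2⟩]
  rw [isPreconnected_iff_subset_of_disjoint]
  intro P Q hP hQ hPQ hd
  rcases isPreconnected_iff_subset_of_disjoint.1 hBv P Q hP hQ
    ((sdiff_subset_sdiff_left hBU).trans hPQ)
    (subset_eq_empty (inter_subset_inter_left _ (sdiff_subset_sdiff_left hBU)) hd) with h | h
  · exact key P Q hP hQ hPQ hd h
  · exact (key Q P hQ hP (by rwa [union_comm]) (by rwa [inter_comm Q]) h).symm

theorem isPreconnected_ball_diff (v : ℂ) (r : ℝ) : IsPreconnected (ball v r \ {v}) := by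
  have : ball v r \ {v} = (fun p : ℝ × ℝ => v + p.1 * cis p.2) '' (Ioo 0 r ×ˢ univ) := by
    ext z
    simp only [Set.mem_sdiff, mem_singleton_iff, mem_image, mem_prod, mem_univ, and_true, Prod.exists]
    constructor
    · rintro ⟨h1, h2⟩
      have h3 := norm_pos_iff.2 (sub_ne_zero.2 h2)
      refine ⟨‖z - v‖, (z - v).arg, ⟨h3, mem_ball_iff_norm.1 h1⟩, ?_⟩
      have := Complex.norm_mul_exp_arg_mul_I (z - v)
      rw [cis, this]
      ring
    · rintro ⟨a, b, ⟨h1, h2⟩, rfl⟩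
      refine ⟨?_, ?_⟩
      · rw [mem_ball_iff_norm, add_sub_cancel_left, norm_mul, norm_cis, mul_one, Complex.norm_real,
          Real.norm_eq_abs, abs_of_pos h1]
        exact h2
      · rw [add_eq_left]
        exact mul_ne_zero (Complex.ofReal_ne_zero.2 h1.ne') (cis_ne_zero b)
  rw [this]
  exact (isPreconnected_Ioo.prod isPreconnected_univ).image _
    (continuous_const.add ((Complex.continuous_ofReal.comp continuous_fst).mul
      (continuous_cis.comp continuous_snd))).continuousOn

/-- The complement of a complementary component of a connected closed set is connected. -/
theorem isPreconnected_compl_component {X : Type*} [TopologicalSpace X] [LocallyConnectedSpace X]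
    [PreconnectedSpace X] {C : Set X} (hC : IsClosed C) (hp : IsPreconnected C)
    (hne : C.Nonempty) (x : X) : IsPreconnected (connectedComponentIn Cᶜ x)ᶜ := by
  obtain ⟨c₀, hc₀⟩ := hne
  refine isPreconnected_of_forall c₀ fun y hy => ?_
  have hcW : C ⊆ (connectedComponentIn Cᶜ x)ᶜ := fun z hz hzW =>
    connectedComponentIn_subset _ _ hzW hz
  by_cases hyC : y ∈ C
  · exact ⟨C, hcW, hc₀, hyC, hp⟩
  set O := connectedComponentIn Cᶜ y
  have hyO : y ∈ O := mem_connectedComponentIn hyC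
  have hOW : O ⊆ (connectedComponentIn Cᶜ x)ᶜ := by
    intro z hz hzW
    have h1 := connectedComponentIn_eq hz
    have h2 := connectedComponentIn_eq hzW
    exact hy (by rw [h2, ← h1]; exact hyO)
  obtain ⟨c, hcO, hcC⟩ : (closure O ∩ C).Nonempty := by
    by_contra hcon
    have hfr : frontier O = ∅ := by
      rw [eq_empty_iff_forall_notMem]
      intro z hz
      have h1 := frontier_connectedComponentIn_subset hC.isOpen_compl y hz
      rw [frontier_compl] at h1
      exact hcon ⟨z, hz.1, hC.frontier_subset h1⟩
    rcases isClopen_iff.1 (isClopen_iff_frontier_eq_empty.2 hfr) with h | h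
    · rw [h] at hyO
      exact hyO
    · have : c₀ ∈ O := h ▸ mem_univ _
      exact connectedComponentIn_subset _ _ this hc₀
  have hOc : IsPreconnected (insert c O) := isPreconnected_connectedComponentIn.subset_closure
    (subset_insert _ _) (insert_subset hcO subset_closure)
  refine ⟨C ∪ insert c O, union_subset hcW (insert_subset (hcW hcC) hOW), Or.inl hc₀,
    Or.inr (Or.inr hyO), hp.union c hcC (mem_insert _ _) hOc⟩

theorem IsJordan.image {X Y : Type*} [TopologicalSpace X] [TopologicalSpace Y] {C : Set X}
    (hC : IsJordan C) {f : X → Y} (hf : ContinuousOn f C) (hi : InjOn f C) : IsJordan (f '' C) := by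
  obtain ⟨c, hc, hci, rfl⟩ := hC
  have hm : MapsTo c (sphere 0 1) (c '' sphere 0 1) := fun z hz => mem_image_of_mem c hz
  exact ⟨f ∘ c, hf.comp hc hm, hi.comp hci hm, image_comp _ _ _⟩

instance : Fact (Module.finrank ℝ (EuclideanSpace ℝ (Fin 3)) = 2 + 1) := ⟨by simp⟩

instance : PreconnectedSpace Sph :=
  isPreconnected_iff_preconnectedSpace.1 (isPreconnected_sphere
    (by exact_mod_cast Module.lt_rank_of_lt_finrank (n := 1) (by simp)) 0 1)

instance : LocallyConnectedSpace Sph :=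
  ChartedSpace.locallyConnectedSpace (EuclideanSpace ℝ (Fin 2)) Sph

/-- Stereographic projection from `v` to the complex plane. -/
def stereo (v : Sph) (x : Sph) : ℂ := Complex.orthonormalBasisOneI.repr.symm (stereographic' 2 v x)

/-- The inverse of `stereo v`. -/
def stereoInv (v : Sph) (z : ℂ) : Sph :=
  (stereographic' 2 v).symm (Complex.orthonormalBasisOneI.repr z)

variable {v x : Sph}

theorem continuousOn_stereo (v : Sph) : ContinuousOn (stereo v) {v}ᶜ := by
  have := (stereographic' 2 v).continuousOn
  rw [stereographic'_source] at this
  exact Complex.orthonormalBasisOneI.repr.symm.continuous.comp_continuousOn this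

theorem continuous_stereoInv (v : Sph) : Continuous (stereoInv v) := by
  have := (stereographic' 2 v).continuousOn_symm
  rw [stereographic'_target] at this
  exact (continuousOn_univ.1 this).comp Complex.orthonormalBasisOneI.repr.continuous

theorem stereoInv_stereo (h : x ≠ v) : stereoInv v (stereo v x) = x := by
  rw [stereoInv, stereo, LinearIsometryEquiv.apply_symm_apply]
  exact (stereographic' 2 v).left_inv (by rwa [stereographic'_source])

theorem stereo_stereoInv (v : Sph) (z : ℂ) : stereo v (stereoInv v z) = z := by
  rw [stereoInv, stereo, (stereographic' 2 v).right_inv (by rw [stereographic'_target]; trivial),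
    LinearIsometryEquiv.symm_apply_apply]

theorem stereoInv_ne (v : Sph) (z : ℂ) : stereoInv v z ≠ v := by
  have := (stereographic' 2 v).map_target (x := Complex.orthonormalBasisOneI.repr z)
    (by rw [stereographic'_target]; trivial)
  rwa [stereographic'_source] at this

theorem stereo_injOn (v : Sph) : InjOn (stereo v) {v}ᶜ := fun x hx y hy h => by
  rw [← stereoInv_stereo hx, h, stereoInv_stereo hy]

theorem image_stereo {A : Set Sph} (h : v ∉ A) : stereo v '' A = stereoInv v ⁻¹' A := by
  ext z
  constructor
  · rintro ⟨x, hx, rfl⟩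
    rwa [mem_preimage, stereoInv_stereo (ne_of_mem_of_not_mem hx h)]
  · exact fun hz => ⟨_, hz, stereo_stereoInv v z⟩

theorem image_stereo_diff {A : Set Sph} : stereo v '' (A \ {v}) = stereoInv v ⁻¹' A := by
  rw [image_stereo (fun h => h.2 rfl)]
  ext z
  exact ⟨fun h => h.1, fun h => ⟨h, stereoInv_ne v z⟩⟩

theorem IsPreconnected.diff_singleton_sph {U : Set Sph} (hU : IsPreconnected U) (hv : U ∈ 𝓝 v) :
    IsPreconnected (U \ {v}) := by
  have hne : v ≠ -v := ne_neg_of_mem_unit_sphere ℝ v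
  obtain ⟨r, hr, hrU⟩ := Metric.mem_nhds_iff.1 ((continuous_stereoInv (-v)).continuousAt
    (x := stereo (-v) v) (by rwa [stereoInv_stereo hne]))
  have him : stereoInv (-v) '' ball (stereo (-v) v) r =
      stereo (-v) ⁻¹' ball (stereo (-v) v) r ∩ {-v}ᶜ := by
    ext x
    constructor
    · rintro ⟨z, hz, rfl⟩
      exact ⟨by rwa [mem_preimage, stereo_stereoInv], stereoInv_ne _ _⟩
    · exact fun hx => ⟨_, hx.1, stereoInv_stereo hx.2⟩
  refine IsPreconnected.diff_singleton hU (B := stereoInv (-v) '' ball (stereo (-v) v) r) ?_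
    ⟨_, mem_ball_self hr, stereoInv_stereo hne⟩ (image_subset_iff.2 hrU) ?_
  · rw [him, inter_comm]
    exact (continuousOn_stereo _).isOpen_inter_preimage isClosed_singleton.isOpen_compl isOpen_ball
  · have := (isPreconnected_ball_diff (stereo (-v) v) r).image _ (continuous_stereoInv (-v)).continuousOn
    convert this using 1
    ext x
    constructor
    · rintro ⟨⟨z, hz, rfl⟩, hx⟩
      refine ⟨z, ⟨hz, fun h => hx ?_⟩, rfl⟩
      rw [mem_singleton_iff.1 h]
      exact stereoInv_stereo hne
    · rintro ⟨z, ⟨hz, hz'⟩, rfl⟩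
      refine ⟨⟨z, hz, rfl⟩, fun h => hz' ?_⟩
      rw [mem_singleton_iff, ← stereo_stereoInv (-v) z, mem_singleton_iff.1 h]

theorem isOpen_image_stereo {U : Set Sph} (hU : IsOpen U) (hv : v ∉ U) : IsOpen (stereo v '' U) := by
  rw [image_stereo hv]
  exact hU.preimage (continuous_stereoInv v)

theorem frontier_image_stereo {U : Set Sph} (hv : v ∉ U) :
    frontier (stereo v '' U) ⊆ stereoInv v ⁻¹' frontier U := by
  rw [image_stereo hv]
  exact (continuous_stereoInv v).frontier_preimage_subset U

theorem isCompact_image_stereo {K : Set Sph} (hK : IsClosed K) (hv : v ∉ K) :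
    IsCompact (stereo v '' K) :=
  hK.isCompact.image_of_continuousOn ((continuousOn_stereo v).mono (subset_compl_singleton_iff.2 hv))

theorem isBounded_image_stereo {K : Set Sph} (hv : Kᶜ ∈ 𝓝 v) :
    Bornology.IsBounded (stereo v '' K) := by
  rw [← mem_interior_iff_mem_nhds, interior_compl] at hv
  exact (isCompact_image_stereo isClosed_closure hv).isBounded.subset (image_mono subset_closure)

variable {C : Set Sph}

theorem IsJordan.isClosed (hC : IsJordan C) : IsClosed C := hC.isCompact.isClosed

theorem IsJordan.nonempty (hC : IsJordan C) : C.Nonempty := by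
  obtain ⟨c, -, -, rfl⟩ := hC
  exact ⟨c 1, 1, by simp, rfl⟩

theorem IsJordan.not_isPreconnected_compl (hC : IsJordan C) (hv : v ∉ C) :
    ¬ IsPreconnected Cᶜ := by
  intro hp
  have h1 : IsJordan (stereo v '' C) := IsJordan.image hC
    ((continuousOn_stereo v).mono (subset_compl_singleton_iff.2 hv))
    ((stereo_injOn v).mono (subset_compl_singleton_iff.2 hv))
  refine h1.not_isPreconnected_compl_plane ?_
  have h2 := (IsPreconnected.diff_singleton_sph hp (hC.isClosed.isOpen_compl.mem_nhds hv)).image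
    (stereo v) ((continuousOn_stereo v).mono fun x hx => hx.2)
  rwa [image_stereo_diff, preimage_compl, ← image_stereo hv] at h2

/-- The Schoenflies theorem on the sphere: closed complementary domains are discs. -/
theorem IsJordan.exists_disc (hC : IsJordan C) (hx : x ∉ C) :
    ∃ Φ : ℂ → Sph, ContinuousOn Φ (closedBall 0 1) ∧ InjOn Φ (closedBall 0 1) ∧
      Φ '' ball 0 1 = connectedComponentIn Cᶜ x ∧ Φ '' sphere 0 1 = C := by
  set W := connectedComponentIn Cᶜ x with hW
  have hWo : IsOpen W := hC.isClosed.isOpen_compl.connectedComponentIn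
  have hWC : W ⊆ Cᶜ := connectedComponentIn_subset _ _
  obtain ⟨v, hvC, hvW⟩ : ∃ v, v ∉ C ∧ v ∉ W := by
    by_contra! hcon
    refine hC.not_isPreconnected_compl hx ?_
    have : Cᶜ = W := subset_antisymm hcon hWC
    rw [this]
    exact isPreconnected_connectedComponentIn
  have hWv : Wᶜ ∈ 𝓝 v := by
    refine mem_of_superset (hC.isClosed.isOpen_compl.connectedComponentIn.mem_nhds
      (mem_connectedComponentIn (x := v) (F := Cᶜ) hvC)) fun y hy hyW => hvW ?_
    rw [hW, connectedComponentIn_eq hyW, ← connectedComponentIn_eq hy]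
    exact mem_connectedComponentIn hvC
  have hfr : frontier W ⊆ C := by
    have := frontier_connectedComponentIn_subset hC.isClosed.isOpen_compl x
    rw [frontier_compl] at this
    exact this.trans hC.isClosed.frontier_subset
  have hWs : W ⊆ {v}ᶜ := subset_compl_singleton_iff.2 hvW
  have hCs : C ⊆ {v}ᶜ := subset_compl_singleton_iff.2 hvC
  have hJ : JordanDomain (stereo v '' C) (stereo v '' W) :=
    { jordan := IsJordan.image hC ((continuousOn_stereo v).mono hCs) ((stereo_injOn v).mono hCs)
      isOpen := isOpen_image_stereo hWo hvW
      conn := isPreconnected_connectedComponentIn.image _ ((continuousOn_stereo v).mono hWs)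
      bdd := isBounded_image_stereo hWv
      disj := by
        rw [image_stereo hvW, image_stereo hvC]
        exact (disjoint_left.2 fun y hy => hWC hy).preimage _
      front := (frontier_image_stereo hvW).trans (by
        rw [image_stereo hvC]
        exact preimage_mono hfr) }
  obtain ⟨Φ, h1, h2, h3, h4⟩ := hJ.exists_disc
    ⟨_, mem_image_of_mem _ (mem_connectedComponentIn hx)⟩ (by
      rw [image_stereo hvW, ← preimage_compl, ← image_stereo_diff]
      refine IsPreconnected.image ?_ _ ((continuousOn_stereo v).mono fun x hx => hx.2)
      exact IsPreconnected.diff_singleton_sph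
        (isPreconnected_compl_component hC.isClosed hC.isPreconnected hC.nonempty x) hWv)
  have him : ∀ {A : Set Sph}, v ∉ A → stereoInv v '' (stereo v '' A) = A := fun {A} hA => by
    rw [image_image]
    exact (image_congr fun y hy => stereoInv_stereo (ne_of_mem_of_not_mem hy hA)).trans (image_id' A)
  refine ⟨stereoInv v ∘ Φ, (continuous_stereoInv v).comp_continuousOn h1, ?_, ?_, ?_⟩
  · intro a ha b hb hab
    refine h2 ha hb ?_
    rw [← stereo_stereoInv v (Φ a), ← stereo_stereoInv v (Φ b)]
    exact congrArg _ hab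
  · rw [image_comp, h3, him hvW]
  · rw [image_comp, h4, him hvC]

/-- A simple closed curve has at most two complementary components. -/
theorem IsJordan.mem_or_mem (hC : IsJordan C) {x y z : Sph} (hx : x ∉ C) (hy : y ∉ C) (hz : z ∉ C)
    (hxy : y ∉ connectedComponentIn Cᶜ x) :
    z ∈ connectedComponentIn Cᶜ x ∨ z ∈ connectedComponentIn Cᶜ y := by
  by_contra! hcon
  obtain ⟨hzx, hzy⟩ := hcon
  obtain ⟨Φ₁, h1, -, h3, h4⟩ := hC.exists_disc hx
  obtain ⟨Φ, g1, g2, g3, g4⟩ := hC.exists_disc hy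
  have hcb : closedBall (0 : ℂ) 1 = ball 0 1 ∪ sphere 0 1 := ball_union_sphere.symm
  have him1 : Φ₁ '' closedBall 0 1 = connectedComponentIn Cᶜ x ∪ C := by
    rw [hcb, image_union, h3, h4]
  have him : Φ '' closedBall 0 1 = connectedComponentIn Cᶜ y ∪ C := by
    rw [hcb, image_union, g3, g4]
  have hz1 : z ∉ Φ₁ '' closedBall 0 1 := by
    rw [him1]
    exact fun h => h.elim hzx hz
  have hz2 : z ∉ Φ '' closedBall 0 1 := by
    rw [him]
    exact fun h => h.elim hzy hz
  have hxx : x ∈ connectedComponentIn Cᶜ x := mem_connectedComponentIn hx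
  have hx2 : x ∉ Φ '' closedBall 0 1 := by
    rw [him]
    refine fun h => h.elim (fun h => hxy ?_) hx
    rw [← connectedComponentIn_eq h]
    exact mem_connectedComponentIn hy
  have hmap : MapsTo Φ (closedBall 0 1) {z}ᶜ := fun w hw h =>
    hz2 ⟨w, hw, h⟩
  have hc : ContinuousOn (fun w => stereo z (Φ w)) (closedBall 0 1) :=
    (continuousOn_stereo z).comp g1 hmap
  have hlog : HasLog (fun w => w - stereo z x) ((fun w => stereo z (Φ w)) '' closedBall 0 1) := by
    refine HasLog.image (isCompact_closedBall 0 1) hc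
      ((stereo_injOn z).comp g2 hmap)
      (hasLog_closedBall (hc.sub continuousOn_const) fun w hw => sub_ne_zero.2 fun h => hx2 ?_)
    refine ⟨w, hw, stereo_injOn z (hmap hw) ?_ h⟩
    rintro rfl
    exact hzx hxx
  have hfr : frontier (connectedComponentIn Cᶜ x) ⊆ C := by
    have := frontier_connectedComponentIn_subset hC.isClosed.isOpen_compl x
    rw [frontier_compl] at this
    exact this.trans hC.isClosed.frontier_subset
  refine not_hasLog_frontier (O := stereo z '' connectedComponentIn Cᶜ x) (a := stereo z x) ?_
    (mem_image_of_mem _ hxx) (hlog.mono ?_)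
  · refine (isCompact_image_stereo (v := z)
      ((isCompact_closedBall (0 : ℂ) 1).image_of_continuousOn h1).isClosed hz1).isBounded.subset
      (image_mono ?_)
    rw [him1]
    exact subset_union_left
  · rw [show (fun w => stereo z (Φ w)) '' closedBall 0 1 = stereo z '' (Φ '' closedBall 0 1) from
      image_comp (stereo z) Φ _, him]
    refine (frontier_image_stereo hzx).trans ?_
    rw [image_union, image_stereo hz]
    exact (preimage_mono hfr).trans subset_union_right

/-- Two maps with the same fibres differ by a homeomorphism. -/
theorem exists_homeomorph_of_fibers {X Y : Type*} [TopologicalSpace X] [TopologicalSpace Y]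
    [CompactSpace X] [CompactSpace Y] [T2Space Y] {P Q : X → Y} (hP : Continuous P)
    (hQ : Continuous Q) (hPs : Function.Surjective P) (hQs : Function.Surjective Q)
    (h : ∀ x x', P x = P x' ↔ Q x = Q x') : ∃ g : Y ≃ₜ Y, ∀ x, g (P x) = Q x := by
  have hq : IsQuotientMap P := hP.isClosedMap.isQuotientMap hP hPs
  let P' : C(X, Y) := ⟨P, hP⟩
  have hq' : IsQuotientMap P' := hq
  let g := hq'.lift ⟨Q, hQ⟩ fun x x' hx => (h x x').1 hx
  have hg : ∀ x, g (P x) = Q x := fun x =>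
    DFunLike.congr_fun (hq'.lift_comp ⟨Q, hQ⟩ fun x x' hx => (h x x').1 hx) x
  have hb : Function.Bijective g := by
    constructor
    · intro y y' hy
      obtain ⟨x, rfl⟩ := hPs y
      obtain ⟨x', rfl⟩ := hPs y'
      rw [hg, hg] at hy
      exact (h x x').2 hy
    · intro y
      obtain ⟨x, rfl⟩ := hQs y
      exact ⟨P x, hg x⟩
  exact ⟨Continuous.homeoOfEquivCompactToT2 (f := Equiv.ofBijective g hb) g.continuous, hg⟩

/-- The boundary parametrization of a closed disc can be prescribed. -/
theorem exists_disc_of_boundary {X : Type*} [TopologicalSpace X] [T2Space X] {Φ c : ℂ → X}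
    (hΦ : ContinuousOn Φ (closedBall 0 1)) (hΦi : InjOn Φ (closedBall 0 1))
    (hc : ContinuousOn c (sphere 0 1)) (hci : InjOn c (sphere 0 1))
    (him : c '' sphere 0 1 = Φ '' sphere 0 1) :
    ∃ Φ' : ℂ → X, ContinuousOn Φ' (closedBall 0 1) ∧ InjOn Φ' (closedBall 0 1) ∧
      Φ' '' ball 0 1 = Φ '' ball 0 1 ∧ EqOn Φ' c (sphere 0 1) := by
  have hss : sphere (0 : ℂ) 1 ⊆ closedBall 0 1 := sphere_subset_closedBall
  set k := Function.invFunOn Φ (sphere 0 1)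
  have hk : ContinuousOn k (Φ '' sphere 0 1) :=
    continuousOn_invFunOn (isCompact_sphere 0 1) (hΦ.mono hss) (hΦi.mono hss)
  set h := fun z => k (c z)
  have hcm : ∀ z ∈ sphere (0 : ℂ) 1, c z ∈ Φ '' sphere 0 1 := fun z hz => him ▸ mem_image_of_mem c hz
  have hhc : ContinuousOn h (sphere 0 1) := hk.comp hc hcm
  have hhm : ∀ z ∈ sphere (0 : ℂ) 1, h z ∈ sphere (0 : ℂ) 1 := fun z hz =>
    Function.invFunOn_mem (hcm z hz)
  have hhe : ∀ z ∈ sphere (0 : ℂ) 1, Φ (h z) = c z := fun z hz => Function.invFunOn_eq (hcm z hz)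
  have hhi : ∀ z ∈ sphere (0 : ℂ) 1, ∀ w ∈ sphere (0 : ℂ) 1, h z = h w → z = w :=
    fun z hz w hw hzw => hci hz hw (by rw [← hhe z hz, ← hhe w hw, hzw])
  have hhs : ∀ z ∈ sphere (0 : ℂ) 1, ∃ w ∈ sphere (0 : ℂ) 1, h w = z := fun z hz => by
    have : Φ z ∈ c '' sphere 0 1 := him ▸ mem_image_of_mem Φ hz
    obtain ⟨w, hw, hwz⟩ := this
    exact ⟨w, hw, hΦi (hss (hhm w hw)) (hss hz) ((hhe w hw).trans hwz)⟩
  set E : ℂ → ℂ := fun z => ‖z‖ * h (z / ‖z‖)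
  have hu : ∀ z : ℂ, z ≠ 0 → z / ‖z‖ ∈ sphere (0 : ℂ) 1 := fun z hz => by
    rw [mem_sphere_zero_iff_norm, norm_div, Complex.norm_real, norm_norm,
      div_self (norm_ne_zero_iff.2 hz)]
  have hE0 : E 0 = 0 := by simp [E]
  have hEn : ∀ z, ‖E z‖ = ‖z‖ := fun z => by
    rcases eq_or_ne z 0 with rfl | hz
    · rw [hE0]
    · rw [norm_mul, Complex.norm_real, norm_norm, mem_sphere_zero_iff_norm.1 (hhm _ (hu z hz)),
        mul_one]
  have hEc : Continuous E := by
    rw [continuous_iff_continuousAt]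
    intro z
    rcases eq_or_ne z 0 with rfl | hz
    · rw [ContinuousAt, hE0]
      refine squeeze_zero_norm (fun z => (hEn z).le) ?_
      have := continuous_norm.tendsto (0 : ℂ)
      rwa [norm_zero] at this
    · have h1 : ContinuousOn E {0}ᶜ := by
        have h2 : ContinuousOn (fun z : ℂ => z / (‖z‖ : ℂ)) {0}ᶜ :=
          continuousOn_id.div (by fun_prop) fun w hw =>
            Complex.ofReal_ne_zero.2 (norm_ne_zero_iff.2 hw)
        exact ContinuousOn.mul (by fun_prop) (hhc.comp h2 fun w hw => hu w hw)
      exact h1.continuousAt (isOpen_compl_singleton.mem_nhds hz)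
  have hEi : Function.Injective E := by
    intro z w hzw
    have hn : ‖z‖ = ‖w‖ := by rw [← hEn z, ← hEn w, hzw]
    rcases eq_or_ne z 0 with rfl | hz
    · rw [norm_zero] at hn
      exact (norm_eq_zero.1 hn.symm).symm
    have hn0 : (‖w‖ : ℂ) ≠ 0 := by
      rw [← hn]
      exact Complex.ofReal_ne_zero.2 (norm_ne_zero_iff.2 hz)
    have hw : w ≠ 0 := by
      rintro rfl
      simp at hn0
    simp only [E, hn] at hzw
    have h1 := hhi _ (hn ▸ hu z hz) _ (hu w hw) (mul_left_cancel₀ hn0 hzw)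
    exact (div_left_inj' hn0).1 h1
  have hEs : Function.Surjective E := by
    intro w
    rcases eq_or_ne w 0 with rfl | hw
    · exact ⟨0, hE0⟩
    have hw0 : (‖w‖ : ℂ) ≠ 0 := Complex.ofReal_ne_zero.2 (norm_ne_zero_iff.2 hw)
    obtain ⟨z, hz, hzw⟩ := hhs _ (hu w hw)
    refine ⟨‖w‖ * z, ?_⟩
    have hn : ‖(‖w‖ : ℂ) * z‖ = ‖w‖ := by
      rw [norm_mul, mem_sphere_zero_iff_norm.1 hz, mul_one, Complex.norm_real, norm_norm]
    simp only [E]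
    rw [hn, mul_div_cancel_left₀ _ hw0, hzw, mul_div_cancel₀ _ hw0]
  have hEm : MapsTo E (closedBall 0 1) (closedBall 0 1) := fun z hz => by
    rw [mem_closedBall_zero_iff] at hz ⊢
    rwa [hEn]
  refine ⟨Φ ∘ E, hΦ.comp hEc.continuousOn hEm, hΦi.comp hEi.injOn hEm, ?_, fun z hz => ?_⟩
  · rw [image_comp]
    congr 1
    ext w
    constructor
    · rintro ⟨z, hz, rfl⟩
      rw [mem_ball_zero_iff] at hz ⊢
      rwa [hEn]
    · intro hw
      obtain ⟨z, rfl⟩ := hEs w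
      rw [mem_ball_zero_iff, hEn] at hw
      exact ⟨z, mem_ball_zero_iff.2 hw, rfl⟩
  · have hz1 := mem_sphere_zero_iff_norm.1 hz
    simp only [Function.comp, E]
    rw [hz1, Complex.ofReal_one, div_one, one_mul, hhe z hz]

/-- The closed curve made of two arcs parametrized by `[0, 1]`. -/
def loop {X : Type*} (a b : ℝ → X) (z : ℂ) : X :=
  if 0 ≤ z.im then a (Real.arccos z.re / Real.pi) else b (Real.arccos z.re / Real.pi)

theorem arccos_div_mem (x : ℝ) : Real.arccos x / Real.pi ∈ Icc (0 : ℝ) 1 :=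
  ⟨div_nonneg (Real.arccos_nonneg x) Real.pi_pos.le,
    (div_le_one Real.pi_pos).2 (Real.arccos_le_pi x)⟩

theorem continuous_arccos_div : Continuous fun z : ℂ => Real.arccos z.re / Real.pi :=
  (Real.continuous_arccos.comp Complex.continuous_re).div_const _

theorem sq_add_sq_of_mem_sphere {z : ℂ} (hz : z ∈ sphere (0 : ℂ) 1) : z.re ^ 2 + z.im ^ 2 = 1 := by
  have := Complex.sq_norm z
  rw [mem_sphere_zero_iff_norm.1 hz, Complex.normSq_apply] at this
  nlinarith

theorem arccos_div_of_im {z : ℂ} (hz : z ∈ sphere (0 : ℂ) 1) (h : z.im = 0) :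
    Real.arccos z.re / Real.pi = 0 ∨ Real.arccos z.re / Real.pi = 1 := by
  have h1 := sq_add_sq_of_mem_sphere hz
  have h2 : (z.re - 1) * (z.re + 1) = 0 := by
    rw [h] at h1
    linarith
  rcases mul_eq_zero.1 h2 with h3 | h3
  · exact Or.inl (by rw [sub_eq_zero.1 h3]; simp)
  · exact Or.inr (by rw [eq_neg_of_add_eq_zero_left h3]; simp [Real.pi_ne_zero])

theorem arccos_div_injOn {z w : ℂ} (hz : z ∈ sphere (0 : ℂ) 1) (hw : w ∈ sphere (0 : ℂ) 1)
    (h : Real.arccos z.re / Real.pi = Real.arccos w.re / Real.pi) : z.re = w.re := by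
  have h1 := sq_add_sq_of_mem_sphere hz
  have h2 := sq_add_sq_of_mem_sphere hw
  exact Real.arccos_injOn ⟨by nlinarith, by nlinarith⟩ ⟨by nlinarith, by nlinarith⟩
    ((div_left_inj' Real.pi_ne_zero).1 h)

theorem cos_mem_im (t : ℝ) (ht : t ∈ Icc (0 : ℝ) 1) :
    Real.arccos (cis (Real.pi * t)).re / Real.pi = t ∧
      Real.arccos (cis (-(Real.pi * t))).re / Real.pi = t ∧ 0 ≤ (cis (Real.pi * t)).im ∧
      (cis (-(Real.pi * t))).im ≤ 0 := by
  have hp := Real.pi_pos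
  have h0 : 0 ≤ Real.pi * t := mul_nonneg hp.le ht.1
  have h1 : Real.pi * t ≤ Real.pi := mul_le_of_le_one_right hp.le ht.2
  simp only [cis, Complex.exp_ofReal_mul_I_re, Complex.exp_ofReal_mul_I_im, Real.cos_neg,
    Real.sin_neg, Real.arccos_cos h0 h1]
  have := Real.sin_nonneg_of_nonneg_of_le_pi h0 h1
  exact ⟨mul_div_cancel_left₀ t hp.ne', mul_div_cancel_left₀ t hp.ne', this, by linarith⟩

/-- Three arcs with common endpoints and disjoint interiors. -/
structure IsTheta (α : Fin 3 → ℝ → Sph) : Prop where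
  cont : ∀ s, ContinuousOn (α s) (Icc 0 1)
  zero : ∀ s t, α s 0 = α t 0
  one : ∀ s t, α s 1 = α t 1
  inj : ∀ s t, ∀ x ∈ Icc (0 : ℝ) 1, ∀ y ∈ Icc (0 : ℝ) 1, α s x = α t y →
    x = y ∧ (s = t ∨ x = 0 ∨ x = 1)

namespace IsTheta

variable {α β : Fin 3 → ℝ → Sph}

theorem eq_iff (h : IsTheta α) {s t : Fin 3} {x y : ℝ} (hx : x ∈ Icc (0 : ℝ) 1)
    (hy : y ∈ Icc (0 : ℝ) 1) : α s x = α t y ↔ x = y ∧ (s = t ∨ x = 0 ∨ x = 1) := by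
  refine ⟨h.inj s t x hx y hy, ?_⟩
  rintro ⟨rfl, rfl | rfl | rfl⟩
  exacts [rfl, h.zero s t, h.one s t]

theorem loop_of_nonpos (h : IsTheta α) (s t : Fin 3) {z : ℂ} (hz : z ∈ sphere (0 : ℂ) 1)
    (him : z.im ≤ 0) : loop (α s) (α t) z = α t (Real.arccos z.re / Real.pi) := by
  rw [loop]
  split_ifs with h0
  · exact (h.eq_iff (arccos_div_mem _) (arccos_div_mem _)).2
      ⟨rfl, Or.inr (arccos_div_of_im hz (le_antisymm him h0))⟩
  · rfl

theorem continuousOn_loop (h : IsTheta α) (s t : Fin 3) :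
    ContinuousOn (loop (α s) (α t)) (sphere 0 1) := by
  have hcov : sphere (0 : ℂ) 1 =
      (sphere 0 1 ∩ {z | 0 ≤ z.im}) ∪ (sphere 0 1 ∩ {z | z.im ≤ 0}) := by
    rw [← inter_union_distrib_left]
    exact (inter_eq_left.2 fun z _ => le_total 0 z.im).symm
  have hc1 : IsClosed {z : ℂ | 0 ≤ z.im} := isClosed_le continuous_const Complex.continuous_im
  have hc2 : IsClosed {z : ℂ | z.im ≤ 0} := isClosed_le Complex.continuous_im continuous_const
  rw [hcov]
  refine ContinuousOn.union_of_isClosed ?_ ?_ (isClosed_sphere.inter hc1) (isClosed_sphere.inter hc2)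
  · exact ((h.cont s).comp continuous_arccos_div.continuousOn fun z _ => arccos_div_mem _).congr
      fun z hz => if_pos hz.2
  · exact ((h.cont t).comp continuous_arccos_div.continuousOn fun z _ => arccos_div_mem _).congr
      fun z hz => h.loop_of_nonpos s t hz.1 hz.2

theorem eq_loop (z : ℂ) (s t : Fin 3) : ∃ u, loop (α s) (α t) z =
    α u (Real.arccos z.re / Real.pi) ∧ loop (β s) (β t) z = β u (Real.arccos z.re / Real.pi) := by
  by_cases h0 : 0 ≤ z.im
  · exact ⟨s, if_pos h0, if_pos h0⟩
  · exact ⟨t, if_neg h0, if_neg h0⟩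

theorem loop_eq_iff (h : IsTheta α) (h' : IsTheta β) {s t s' t' : Fin 3} {z w : ℂ} :
    loop (α s) (α t) z = loop (α s') (α t') w ↔ loop (β s) (β t) z = loop (β s') (β t') w := by
  obtain ⟨u, h1, h2⟩ := eq_loop (α := α) (β := β) z s t
  obtain ⟨u', h1', h2'⟩ := eq_loop (α := α) (β := β) w s' t'
  rw [h1, h2, h1', h2', h.eq_iff (arccos_div_mem _) (arccos_div_mem _),
    h'.eq_iff (arccos_div_mem _) (arccos_div_mem _)]

theorem injOn_loop (h : IsTheta α) {s t : Fin 3} (hst : s ≠ t) :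
    InjOn (loop (α s) (α t)) (sphere 0 1) := by
  intro z hz w hw hzw
  have hz1 := sq_add_sq_of_mem_sphere hz
  have hw1 := sq_add_sq_of_mem_sphere hw
  have key : ∀ u u', α u (Real.arccos z.re / Real.pi) = α u' (Real.arccos w.re / Real.pi) →
      z.re = w.re ∧ (u ≠ u' → z.im = w.im) := by
    intro u u' he
    obtain ⟨h1, h2⟩ := h.inj u u' _ (arccos_div_mem _) _ (arccos_div_mem _) he
    have h3 := arccos_div_injOn hz hw h1
    refine ⟨h3, fun hu => ?_⟩
    have h4 : z.re = 1 ∨ z.re = -1 := by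
      have hb : z.re ∈ Icc (-1 : ℝ) 1 := ⟨by nlinarith, by nlinarith⟩
      rcases h2.resolve_left hu with h5 | h5
      · left
        have h6 := (div_eq_zero_iff.1 h5).resolve_right Real.pi_ne_zero
        exact le_antisymm hb.2 (Real.arccos_eq_zero.1 h6)
      · right
        have h6 := (div_eq_one_iff_eq Real.pi_ne_zero).1 h5
        exact le_antisymm (Real.arccos_eq_pi.1 h6) hb.1
    have h5 : z.im ^ 2 = 0 := by rcases h4 with h4 | h4 <;> rw [h4] at hz1 <;> linarith
    have h6 : w.im ^ 2 = 0 := by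
      rw [← h3] at hw1
      rcases h4 with h4 | h4 <;> rw [h4] at hw1 <;> linarith
    rw [pow_eq_zero_iff two_ne_zero] at h5 h6
    rw [h5, h6]
  have hsq : z.re = w.re → (z.im - w.im) * (z.im + w.im) = 0 := fun h3 => by
    rw [h3] at hz1
    linarith
  by_cases h0 : 0 ≤ z.im <;> by_cases h0' : 0 ≤ w.im <;>
    simp only [loop, h0, h0', if_true, if_false] at hzw
  · obtain ⟨h1, -⟩ := key _ _ hzw
    refine Complex.ext h1 ?_
    rcases mul_eq_zero.1 (hsq h1) with h2 | h2 <;> linarith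
  · exact Complex.ext (key _ _ hzw).1 ((key _ _ hzw).2 hst)
  · exact Complex.ext (key _ _ hzw).1 ((key _ _ hzw).2 hst.symm)
  · obtain ⟨h1, -⟩ := key _ _ hzw
    refine Complex.ext h1 ?_
    push Not at h0 h0'
    rcases mul_eq_zero.1 (hsq h1) with h2 | h2 <;> linarith

theorem image_loop (h : IsTheta α) (s t : Fin 3) :
    loop (α s) (α t) '' sphere 0 1 = α s '' Icc 0 1 ∪ α t '' Icc 0 1 := by
  apply subset_antisymm
  · rintro _ ⟨z, hz, rfl⟩
    rw [loop]
    split_ifs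
    exacts [Or.inl ⟨_, arccos_div_mem _, rfl⟩, Or.inr ⟨_, arccos_div_mem _, rfl⟩]
  · rintro _ (⟨x, hx, rfl⟩ | ⟨x, hx, rfl⟩)
    · refine ⟨_, cis_mem (Real.pi * x), ?_⟩
      rw [loop, if_pos (cos_mem_im x hx).2.2.1, (cos_mem_im x hx).1]
    · refine ⟨_, cis_mem (-(Real.pi * x)), ?_⟩
      rw [h.loop_of_nonpos s t (cis_mem _) (cos_mem_im x hx).2.2.2, (cos_mem_im x hx).2.1]

end IsTheta

namespace IsTheta

variable {α β : Fin 3 → ℝ → Sph}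

/-- The cycle of a theta curve omitting the arc `i`. -/
def cycle (α : Fin 3 → ℝ → Sph) (i : Fin 3) : Set Sph :=
  α (i + 1) '' Icc 0 1 ∪ α (i + 2) '' Icc 0 1

/-- The complementary domain of the cycle omitting arc `i` that does not contain this arc. -/
def face (α : Fin 3 → ℝ → Sph) (i : Fin 3) : Set Sph :=
  (cycle α i)ᶜ \ connectedComponentIn (cycle α i)ᶜ (α i (1 / 2))

theorem add_one_ne_add_two (i : Fin 3) : i + 1 ≠ i + 2 := by decide +revert

theorem add_one_ne (i : Fin 3) : i + 1 ≠ i := by decide +revert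

theorem add_two_ne (i : Fin 3) : i + 2 ≠ i := by decide +revert

theorem eq_or_eq (i j : Fin 3) : j = i ∨ j = i + 1 ∨ j = i + 2 := by decide +revert

theorem image_loop_cycle (h : IsTheta α) (i : Fin 3) :
    loop (α (i + 1)) (α (i + 2)) '' sphere 0 1 = cycle α i := h.image_loop _ _

theorem isJordan_cycle (h : IsTheta α) (i : Fin 3) : IsJordan (cycle α i) :=
  ⟨_, h.continuousOn_loop _ _, h.injOn_loop (add_one_ne_add_two i), h.image_loop_cycle i⟩

theorem notMem_cycle (h : IsTheta α) {i : Fin 3} {t : ℝ} (ht : t ∈ Ioo (0 : ℝ) 1) :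
    α i t ∉ cycle α i := by
  have key : ∀ s, i ≠ s → α i t ∉ α s '' Icc 0 1 := by
    rintro s hs ⟨u, hu, he⟩
    obtain ⟨h1, h2⟩ := h.inj _ _ _ (Ioo_subset_Icc_self ht) _ hu he.symm
    rcases h2 with h2 | h2 | h2
    exacts [hs h2, ht.1.ne' h2, ht.2.ne h2]
  rintro (h1 | h1)
  · exact key _ (add_one_ne i).symm h1
  · exact key _ (add_two_ne i).symm h1

theorem mem_cycle {i j : Fin 3} (hij : j ≠ i) {t : ℝ} (ht : t ∈ Icc (0 : ℝ) 1) :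
    α j t ∈ cycle α i := by
  rcases eq_or_eq i j with rfl | rfl | rfl
  exacts [absurd rfl hij, Or.inl ⟨t, ht, rfl⟩, Or.inr ⟨t, ht, rfl⟩]

theorem half_mem : (1 / 2 : ℝ) ∈ Ioo (0 : ℝ) 1 := by norm_num

theorem mem_component (h : IsTheta α) {i : Fin 3} {t : ℝ} (ht : t ∈ Ioo (0 : ℝ) 1) :
    α i t ∈ connectedComponentIn (cycle α i)ᶜ (α i (1 / 2)) := by
  have h1 : IsPreconnected (α i '' Ioo 0 1) :=
    isPreconnected_Ioo.image _ ((h.cont i).mono Ioo_subset_Icc_self)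
  refine IsPreconnected.subset_connectedComponentIn h1 ⟨_, half_mem, rfl⟩ ?_ ⟨t, ht, rfl⟩
  rintro _ ⟨u, hu, rfl⟩
  exact h.notMem_cycle hu

theorem notMem_face (h : IsTheta α) (i s : Fin 3) {t : ℝ} (ht : t ∈ Icc (0 : ℝ) 1) :
    α s t ∉ face α i := by
  rintro ⟨h1, h2⟩
  by_cases hs : s = i
  · subst hs
    rcases eq_or_lt_of_le ht.1 with h0 | h0
    · subst h0
      rw [h.zero s (s + 1)] at h1
      exact h1 (mem_cycle (add_one_ne s) ht)
    rcases eq_or_lt_of_le ht.2 with h3 | h3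
    · subst h3
      rw [h.one s (s + 1)] at h1
      exact h1 (mem_cycle (add_one_ne s) ht)
    exact h2 (h.mem_component ⟨h0, h3⟩)
  · exact h1 (mem_cycle hs ht)

theorem face_eq (h : IsTheta α) {i : Fin 3} {x : Sph} (hx : x ∈ face α i) :
    face α i = connectedComponentIn (cycle α i)ᶜ x := by
  ext z
  constructor
  · intro hz
    exact (IsJordan.mem_or_mem (h.isJordan_cycle i) (h.notMem_cycle half_mem) hx.1 hz.1 hx.2).resolve_left
      hz.2
  · intro hz
    refine ⟨connectedComponentIn_subset _ _ hz, fun hz' => hx.2 ?_⟩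
    rw [connectedComponentIn_eq hz', ← connectedComponentIn_eq hz]
    exact mem_connectedComponentIn hx.1

theorem face_nonempty (h : IsTheta α) (i : Fin 3) : (face α i).Nonempty := by
  by_contra hne
  rw [not_nonempty_iff_eq_empty] at hne
  refine IsJordan.not_isPreconnected_compl (h.isJordan_cycle i) (h.notMem_cycle half_mem) ?_
  have : (cycle α i)ᶜ = connectedComponentIn (cycle α i)ᶜ (α i (1 / 2)) :=
    Subset.antisymm (sdiff_eq_empty.1 hne) (connectedComponentIn_subset _ _)
  rw [this]
  exact isPreconnected_connectedComponentIn

theorem isOpen_face (h : IsTheta α) (i : Fin 3) : IsOpen (face α i) := by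
  obtain ⟨x, hx⟩ := h.face_nonempty i
  rw [h.face_eq hx]
  exact (h.isJordan_cycle i).isClosed.isOpen_compl.connectedComponentIn

theorem isPreconnected_face (h : IsTheta α) (i : Fin 3) : IsPreconnected (face α i) := by
  obtain ⟨x, hx⟩ := h.face_nonempty i
  rw [h.face_eq hx]
  exact isPreconnected_connectedComponentIn

/-- A parametrization of the closed face `i`, standard on the boundary. -/
theorem exists_face_disc (h : IsTheta α) (i : Fin 3) :
    ∃ Φ : ℂ → Sph, ContinuousOn Φ (closedBall 0 1) ∧ InjOn Φ (closedBall 0 1) ∧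
      Φ '' ball 0 1 = face α i ∧ EqOn Φ (loop (α (i + 1)) (α (i + 2))) (sphere 0 1) := by
  obtain ⟨x, hx⟩ := h.face_nonempty i
  obtain ⟨Φ, h1, h2, h3, h4⟩ := IsJordan.exists_disc (h.isJordan_cycle i) hx.1
  obtain ⟨Ψ, h5, h6, h7, h8⟩ := exists_disc_of_boundary h1 h2 (h.continuousOn_loop _ _)
    (h.injOn_loop (add_one_ne_add_two i)) ((h.image_loop_cycle i).trans h4.symm)
  exact ⟨Ψ, h5, h6, by rw [h7, h3, h.face_eq hx], h8⟩

theorem cycle_subset_closure_face (h : IsTheta α) (i : Fin 3) :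
    cycle α i ⊆ closure (face α i) := by
  obtain ⟨Φ, h1, h2, h3, h4⟩ := h.exists_face_disc i
  rw [← h.image_loop_cycle i, ← h3, ← h4.image_eq]
  have h5 : closure (ball (0 : ℂ) 1) = closedBall 0 1 := closure_ball 0 one_ne_zero
  have h6 := ContinuousOn.image_closure (s := ball (0 : ℂ) 1) (f := Φ) (by rwa [h5])
  rw [h5] at h6
  exact (image_mono sphere_subset_closedBall).trans h6

theorem frontier_face_subset (i : Fin 3) (h : IsTheta α) : frontier (face α i) ⊆ cycle α i := by
  obtain ⟨x, hx⟩ := h.face_nonempty i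
  rw [h.face_eq hx]
  have := frontier_connectedComponentIn_subset (h.isJordan_cycle i).isClosed.isOpen_compl x
  rw [frontier_compl] at this
  exact this.trans (h.isJordan_cycle i).isClosed.frontier_subset

theorem disjoint_face (h : IsTheta α) {i j : Fin 3} (hij : i ≠ j) :
    Disjoint (face α i) (face α j) := by
  have key : ∀ {i j z}, z ∈ face α i → z ∈ face α j → face α i ⊆ face α j := by
    intro i j z h1 h2
    rw [h.face_eq h2]
    refine IsPreconnected.subset_connectedComponentIn (h.isPreconnected_face i) h1 fun w hw hw' => ?_
    rcases hw' with ⟨t, ht, rfl⟩ | ⟨t, ht, rfl⟩ <;> exact h.notMem_face _ _ ht hw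
  rw [Set.disjoint_left]
  intro z h1 h2
  have h3 : α j (1 / 2) ∈ closure (face α j) :=
    closure_mono (key h1 h2) (h.cycle_subset_closure_face i
      (mem_cycle hij.symm (Ioo_subset_Icc_self half_mem)))
  have h4 : IsOpen (connectedComponentIn (cycle α j)ᶜ (α j (1 / 2))) :=
    (h.isJordan_cycle j).isClosed.isOpen_compl.connectedComponentIn
  obtain ⟨w, hw, hw'⟩ := mem_closure_iff.1 h3 _ h4 (h.mem_component half_mem)
  exact hw'.2 hw

theorem inter_cycle (h : IsTheta α) : cycle α 1 ∩ cycle α 2 = α 0 '' Icc 0 1 := by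
  have e1 : cycle α 1 = α 2 '' Icc 0 1 ∪ α 0 '' Icc 0 1 := rfl
  have e2 : cycle α 2 = α 0 '' Icc 0 1 ∪ α 1 '' Icc 0 1 := rfl
  rw [e1, e2]
  ext z
  constructor
  · rintro ⟨h1 | h1, h2 | h2⟩
    · exact h2
    · obtain ⟨t, ht, rfl⟩ := h1
      obtain ⟨u, hu, he⟩ := h2
      obtain ⟨rfl, h3 | h3 | h3⟩ := h.inj _ _ _ hu _ ht he
      · exact absurd h3 (by decide)
      · exact ⟨u, hu, by rw [h3]; exact h.zero _ _⟩
      · exact ⟨u, hu, by rw [h3]; exact h.one _ _⟩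
    · exact h1
    · exact h1
  · exact fun hz => ⟨Or.inr hz, Or.inl hz⟩

/-- The faces of a theta curve cover its complement. -/
theorem exists_face (h : IsTheta α) {z : Sph} (hz : ∀ i, ∀ t ∈ Icc (0 : ℝ) 1, z ≠ α i t) :
    ∃ i, z ∈ face α i := by
  by_contra! hne
  have hzc : ∀ i, z ∉ cycle α i := by
    rintro i (⟨t, ht, he⟩ | ⟨t, ht, he⟩) <;> exact hz _ t ht he.symm
  have hzO : ∀ i, z ∈ connectedComponentIn (cycle α i)ᶜ (α i (1 / 2)) := fun i => by
    by_contra h1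
    exact hne i ⟨hzc i, h1⟩
  obtain ⟨y, hy⟩ := h.face_nonempty 0
  have hyO : ∀ i, i ≠ 0 → y ∈ connectedComponentIn (cycle α i)ᶜ (α i (1 / 2)) := fun i hi => by
    by_contra h1
    refine Set.disjoint_left.1 (h.disjoint_face hi) ⟨?_, h1⟩ hy
    rintro (⟨t, ht, rfl⟩ | ⟨t, ht, rfl⟩) <;> exact h.notMem_face _ _ ht hy
  have hO : ∀ i, IsOpen (connectedComponentIn (cycle α i)ᶜ (α i (1 / 2))) := fun i =>
    (h.isJordan_cycle i).isClosed.isOpen_compl.connectedComponentIn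
  have hN : ∀ᶠ v in 𝓝[≠] z, v ∈ ({z}ᶜ : Set Sph) ∧ ∀ i, v ∈ connectedComponentIn (cycle α i)ᶜ (α i (1 / 2)) :=
    Filter.Eventually.and (eventually_mem_nhdsWithin) (eventually_all.2 fun i =>
      mem_nhdsWithin_of_mem_nhds ((hO i).mem_nhds (hzO i)))
  have : ConnectedSpace Sph := { toNonempty := ⟨y⟩ }
  have : Nontrivial Sph := ⟨y, z, fun h1 => hne 0 (h1 ▸ hy)⟩
  obtain ⟨v, hvz, hv⟩ := hN.exists
  have hvc : ∀ i, v ∉ cycle α i := fun i => connectedComponentIn_subset _ _ (hv i)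
  have hyv : y ≠ v := by
    rintro rfl
    exact hy.2 (hv 0)
  have hvF : v ∉ face α 0 := fun h1 => h1.2 (hv 0)
  have hT : ∀ i, IsPreconnected (stereo v ''
      (connectedComponentIn (cycle α i)ᶜ (α i (1 / 2)) \ {v})) := fun i =>
    IsPreconnected.image (IsPreconnected.diff_singleton_sph isPreconnected_connectedComponentIn
      ((hO i).mem_nhds (hv i))) _ ((continuousOn_stereo v).mono fun x hx => hx.2)
  have hd : ∀ i, Disjoint (stereo v '' (connectedComponentIn (cycle α i)ᶜ (α i (1 / 2)) \ {v}))
      (stereo v '' cycle α i) := by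
    intro i
    rw [Set.disjoint_left]
    rintro _ ⟨x, hx, rfl⟩ ⟨x', hx', he⟩
    have hxv : x' ≠ v := by
      rintro rfl
      exact hvc i hx'
    have := stereo_injOn v hxv hx.2 he
    subst this
    exact connectedComponentIn_subset _ _ hx.1 hx'
  have hb : Bornology.IsBounded (stereo v '' face α 0) := by
    refine isBounded_image_stereo (mem_of_superset ((hO 0).mem_nhds (hv 0)) fun x hx hx' => hx'.2 hx)
  have hi : stereo v '' cycle α 1 ∩ stereo v '' cycle α 2 = stereo v '' (α 0 '' Icc 0 1) := by
    rw [← h.inter_cycle]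
    refine ((stereo_injOn v).image_inter ?_ ?_).symm
    · intro x hx hxv
      exact hvc 1 (hxv ▸ hx)
    · intro x hx hxv
      exact hvc 2 (hxv ▸ hx)
  have hva : v ∉ α 0 '' Icc 0 1 := fun h1 => hvc 1 (Or.inr h1)
  have hmem := janiszewski (isCompact_image_stereo (h.isJordan_cycle 1).isClosed (hvc 1))
    (isCompact_image_stereo (h.isJordan_cycle 2).isClosed (hvc 2))
    (by
      rw [hi]
      refine (isPreconnected_Icc.image _ (h.cont 0)).image _ ((continuousOn_stereo v).mono ?_)
      intro x hx hxv
      exact hva (hxv ▸ hx))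
    (hT 1) (hT 2) (hd 1) (hd 2) ⟨y, ⟨hyO 1 (by decide), hyv⟩, rfl⟩
    ⟨z, ⟨hzO 1, fun h1 => hvz h1.symm⟩, rfl⟩ ⟨y, ⟨hyO 2 (by decide), hyv⟩, rfl⟩
    ⟨z, ⟨hzO 2, fun h1 => hvz h1.symm⟩, rfl⟩ (isOpen_image_stereo (h.isOpen_face 0) hvF) hb
    (by
      refine (frontier_image_stereo hvF).trans ?_
      rw [image_stereo (hvc 1), image_stereo (hvc 2), ← preimage_union]
      refine preimage_mono ((frontier_face_subset 0 h).trans ?_)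
      rintro _ (⟨t, ht, rfl⟩ | ⟨t, ht, rfl⟩)
      · exact Or.inr (mem_cycle (by decide) ht)
      · exact Or.inl (mem_cycle (by decide) ht))
    ⟨y, hy, rfl⟩
  obtain ⟨w, hw, he⟩ := hmem
  have hwv : w ≠ v := by
    rintro rfl
    exact hvF hw
  have := stereo_injOn v hwv (fun h1 => hvz h1.symm) he
  exact hne 0 (this ▸ hw)

/-- Any two theta curves on the sphere are equivalent under a homeomorphism. -/
theorem exists_homeomorph (h : IsTheta α) (h' : IsTheta β) :
    ∃ g : Sph ≃ₜ Sph, ∀ s, ∀ t ∈ Icc (0 : ℝ) 1, g (α s t) = β s t := by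
  choose Φ hΦ hΦi hΦb hΦs using h.exists_face_disc
  choose Ψ hΨ hΨi hΨb hΨs using h'.exists_face_disc
  have hcont : ∀ {Φ : Fin 3 → ℂ → Sph}, (∀ i, ContinuousOn (Φ i) (closedBall 0 1)) →
      Continuous fun x : Fin 3 × closedBall (0 : ℂ) 1 => Φ x.1 x.2 := fun {Φ} hΦ =>
    continuous_prod_of_discrete_left.2 fun i =>
      continuousOn_iff_continuous_domRestrict.1 (hΦ i)
  have hpt : ∀ t ∈ Icc (0 : ℝ) 1, ∃ z ∈ closedBall (0 : ℂ) 1, ‖z‖ = 1 ∧ 0 ≤ z.im ∧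
      Real.arccos z.re / Real.pi = t := fun t ht =>
    ⟨cis (Real.pi * t), mem_closedBall_zero_iff.2 (norm_cis _).le, norm_cis _,
      (cos_mem_im t ht).2.2.1, (cos_mem_im t ht).1⟩
  have harc : ∀ {α : Fin 3 → ℝ → Sph} {Φ : Fin 3 → ℂ → Sph},
      (∀ i, EqOn (Φ i) (loop (α (i + 1)) (α (i + 2))) (sphere 0 1)) →
      ∀ s, ∀ t ∈ Icc (0 : ℝ) 1, Φ (s + 2) (cis (Real.pi * t)) = α s t := by
    intro α Φ hs s t ht
    rw [hs (s + 2) (cis_mem _), loop, if_pos (cos_mem_im t ht).2.2.1, (cos_mem_im t ht).1]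
    congr
    decide +revert
  have hsurj : ∀ {α : Fin 3 → ℝ → Sph} {Φ : Fin 3 → ℂ → Sph}, IsTheta α →
      (∀ i, EqOn (Φ i) (loop (α (i + 1)) (α (i + 2))) (sphere 0 1)) →
      (∀ i, Φ i '' ball 0 1 = face α i) →
      Function.Surjective fun x : Fin 3 × closedBall (0 : ℂ) 1 => Φ x.1 x.2 := by
    intro α Φ h hs hb z
    by_cases hz : ∀ i, ∀ t ∈ Icc (0 : ℝ) 1, z ≠ α i t
    · obtain ⟨i, hi⟩ := h.exists_face hz
      rw [← hb] at hi
      obtain ⟨w, hw, rfl⟩ := hi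
      exact ⟨(i, ⟨w, ball_subset_closedBall hw⟩), rfl⟩
    · push Not at hz
      obtain ⟨s, t, ht, rfl⟩ := hz
      exact ⟨(s + 2, ⟨cis (Real.pi * t), sphere_subset_closedBall (cis_mem _)⟩), harc hs s t ht⟩
  have hfib : ∀ {α β : Fin 3 → ℝ → Sph} {Φ Ψ : Fin 3 → ℂ → Sph}, IsTheta α → IsTheta β →
      (∀ i, InjOn (Φ i) (closedBall 0 1)) →
      (∀ i, EqOn (Φ i) (loop (α (i + 1)) (α (i + 2))) (sphere 0 1)) →
      (∀ i, EqOn (Ψ i) (loop (β (i + 1)) (β (i + 2))) (sphere 0 1)) →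
      (∀ i, Φ i '' ball 0 1 = face α i) →
      ∀ x x' : Fin 3 × closedBall (0 : ℂ) 1, Φ x.1 x.2 = Φ x'.1 x'.2 → Ψ x.1 x.2 = Ψ x'.1 x'.2 := by
    rintro α β Φ Ψ h h' hi hs hs' hb ⟨i, z, hz⟩ ⟨j, w, hw⟩ he
    simp only at he ⊢
    have hnot : ∀ i j z w, z ∈ ball (0 : ℂ) 1 → w ∈ sphere (0 : ℂ) 1 → Φ i z ≠ Φ j w := by
      intro i j z w hz hw he
      have h1 : Φ i z ∈ face α i := hb i ▸ mem_image_of_mem _ hz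
      rw [he, hs j hw, loop] at h1
      split_ifs at h1 <;> exact h.notMem_face _ _ (arccos_div_mem _) h1
    rcases lt_or_eq_of_le (mem_closedBall_zero_iff.1 hz) with hz1 | hz1 <;>
      rcases lt_or_eq_of_le (mem_closedBall_zero_iff.1 hw) with hw1 | hw1
    · have hij : i = j := by
        by_contra hij
        exact Set.disjoint_left.1 (h.disjoint_face hij)
          (hb i ▸ mem_image_of_mem _ (mem_ball_zero_iff.2 hz1))
          (by rw [he, ← hb j]; exact mem_image_of_mem _ (mem_ball_zero_iff.2 hw1))
      subst hij
      rw [hi i hz hw he]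
    · exact absurd he (hnot _ _ _ _ (mem_ball_zero_iff.2 hz1) (mem_sphere_zero_iff_norm.2 hw1))
    · exact absurd he.symm (hnot _ _ _ _ (mem_ball_zero_iff.2 hw1) (mem_sphere_zero_iff_norm.2 hz1))
    · have hz2 := mem_sphere_zero_iff_norm.2 hz1
      have hw2 := mem_sphere_zero_iff_norm.2 hw1
      rw [hs' i hz2, hs' j hw2, ← h.loop_eq_iff h', ← hs i hz2, ← hs j hw2, he]
  obtain ⟨g, hg⟩ := exists_homeomorph_of_fibers (hcont hΦ) (hcont hΨ) (hsurj h hΦs hΦb)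
    (hsurj h' hΨs hΨb) fun x x' => ⟨hfib h h' hΦi hΦs hΨs hΦb x x', hfib h' h hΨi hΨs hΦs hΨb x x'⟩
  refine ⟨g, fun s t ht => ?_⟩
  have h1 := hg (s + 2, ⟨cis (Real.pi * t), sphere_subset_closedBall (cis_mem _)⟩)
  rwa [harc hΦs s t ht, harc hΨs s t ht] at h1

end IsTheta

/-- The height of a point on the sphere. -/
def hgt (x : Sph) : ℝ := x.1 2

/-- The horizontal coordinates of a point on the sphere, as a complex number. -/
def zc (x : Sph) : ℂ := ⟨x.1 0, x.1 1⟩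

theorem continuous_hgt : Continuous hgt := by
  unfold hgt
  fun_prop

theorem continuous_zc : Continuous zc := by
  have : zc = fun x : Sph => Complex.equivRealProdCLM.symm (x.1 0, x.1 1) := rfl
  rw [this]
  fun_prop

theorem normSq_zc (x : Sph) : Complex.normSq (zc x) + hgt x ^ 2 = 1 := by
  have h := x.2
  rw [mem_sphere_zero_iff_norm, EuclideanSpace.norm_eq, Real.sqrt_eq_one, Fin.sum_univ_three] at h
  simp only [Real.norm_eq_abs, sq_abs] at h
  rw [Complex.normSq_apply, zc, hgt]
  simp only
  linarith

theorem zc_mul_conj (x : Sph) : zc x * (starRingEnd ℂ) (zc x) = (1 - hgt x) * (1 + hgt x) := by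
  rw [Complex.mul_conj]
  have := normSq_zc x
  rw [show Complex.normSq (zc x) = 1 - hgt x ^ 2 by linarith]
  push_cast
  ring

theorem sph_ext {x y : Sph} (h : zc x = zc y) (h' : hgt x = hgt y) : x = y := by
  apply Subtype.ext
  ext i
  have h1 := congrArg Complex.re h
  have h2 := congrArg Complex.im h
  fin_cases i
  exacts [h1, h2, h']

/-- The point of the sphere with given coordinates. -/
def mkS (z : ℂ) (t : ℝ) (h : Complex.normSq z + t ^ 2 = 1) : Sph :=
  ⟨!₂[z.re, z.im, t], by
    rw [mem_sphere_zero_iff_norm, EuclideanSpace.norm_eq, Real.sqrt_eq_one, Fin.sum_univ_three]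
    simp only [Real.norm_eq_abs, sq_abs]
    rw [Complex.normSq_apply] at h
    simp
    linarith⟩

@[simp] theorem zc_mkS {z : ℂ} {t : ℝ} (h : Complex.normSq z + t ^ 2 = 1) : zc (mkS z t h) = z := rfl

@[simp] theorem hgt_mkS {z : ℂ} {t : ℝ} (h : Complex.normSq z + t ^ 2 = 1) :
    hgt (mkS z t h) = t := rfl

theorem continuous_mkS {X : Type*} [TopologicalSpace X] {f : X → ℂ} {g : X → ℝ} (hf : Continuous f)
    (hg : Continuous g) (h : ∀ x, Complex.normSq (f x) + g x ^ 2 = 1) :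
    Continuous fun x => mkS (f x) (g x) (h x) := by
  refine Continuous.subtype_mk ?_ _
  refine (PiLp.continuous_toLp 2 _).comp (continuous_pi fun i => ?_)
  fin_cases i
  exacts [Complex.continuous_re.comp hf, Complex.continuous_im.comp hf, hg]

/-- The south pole. -/
def southPole : Sph := mkS 0 (-1) (by simp)

/-- The north pole. -/
def northPole : Sph := mkS 0 1 (by simp)

/-- Reflection in the horizontal plane. -/
def vflip (x : Sph) : Sph := mkS (zc x) (-hgt x) (by rw [neg_sq]; exact normSq_zc x)

@[simp] theorem zc_vflip (x : Sph) : zc (vflip x) = zc x := rfl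

@[simp] theorem hgt_vflip (x : Sph) : hgt (vflip x) = -hgt x := rfl

@[simp] theorem vflip_vflip (x : Sph) : vflip (vflip x) = x := sph_ext rfl (neg_neg _)

theorem continuous_vflip : Continuous vflip := continuous_mkS continuous_zc continuous_hgt.neg _

/-- Reflection in a vertical plane, as a function. -/
def reflectFun (x : Sph) : Sph :=
  mkS (starRingEnd ℂ (zc x)) (hgt x) (by rw [Complex.normSq_conj]; exact normSq_zc x)

theorem continuous_reflectFun : Continuous reflectFun :=
  continuous_mkS (Complex.continuous_conj.comp continuous_zc) continuous_hgt
    fun x => by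
      rw [Function.comp, Complex.normSq_conj]
      exact normSq_zc x

/-- Reflection in a vertical plane. -/
def reflect : Sph ≃ₜ Sph where
  toFun := reflectFun
  invFun := reflectFun
  left_inv x := sph_ext (by simp [reflectFun]) rfl
  right_inv x := sph_ext (by simp [reflectFun]) rfl
  continuous_toFun := continuous_reflectFun
  continuous_invFun := continuous_reflectFun

@[simp] theorem zc_reflect (x : Sph) : zc (reflect x) = starRingEnd ℂ (zc x) := rfl

@[simp] theorem hgt_reflect (x : Sph) : hgt (reflect x) = hgt x := rfl

theorem hgt_mem (x : Sph) : hgt x ∈ Icc (-1 : ℝ) 1 := by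
  have h1 := normSq_zc x
  have h2 := Complex.normSq_nonneg (zc x)
  exact ⟨by nlinarith, by nlinarith⟩

theorem hgt_eq_one_iff {x : Sph} : hgt x = 1 ↔ x = northPole := by
  refine ⟨fun h => sph_ext ?_ h, fun h => by rw [h]; rfl⟩
  have := normSq_zc x
  rw [h] at this
  exact Complex.normSq_eq_zero.1 (by linarith)

theorem hgt_eq_neg_one_iff {x : Sph} : hgt x = -1 ↔ x = southPole := by
  refine ⟨fun h => sph_ext ?_ h, fun h => by rw [h]; rfl⟩
  have := normSq_zc x
  rw [h] at this
  exact Complex.normSq_eq_zero.1 (by linarith)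

theorem zc_eq_zero_iff {x : Sph} : zc x = 0 ↔ x = southPole ∨ x = northPole := by
  constructor
  · intro h
    have h1 := normSq_zc x
    rw [h, map_zero, zero_add] at h1
    exact (sq_eq_one_iff.1 h1).symm.imp hgt_eq_neg_one_iff.1 hgt_eq_one_iff.1
  · rintro (rfl | rfl) <;> rfl

theorem vflip_northPole : vflip northPole = southPole := sph_ext rfl rfl

/-- Stereographic projection from the north pole. -/
def low (x : Sph) : ℂ := zc x / (1 - hgt x)

theorem one_sub_hgt_ne_zero {x : Sph} (h : x ≠ northPole) : (1 - hgt x : ℂ) ≠ 0 := by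
  intro h1
  apply h
  rw [← hgt_eq_one_iff]
  exact_mod_cast (sub_eq_zero.1 h1).symm

theorem one_add_hgt_ne_zero {x : Sph} (h : x ≠ southPole) : (1 + hgt x : ℂ) ≠ 0 := by
  intro h1
  apply h
  rw [← hgt_eq_neg_one_iff]
  have : (1 + hgt x : ℝ) = 0 := by exact_mod_cast h1
  linarith

theorem continuousOn_low : ContinuousOn low {northPole}ᶜ :=
  ContinuousOn.div continuous_zc.continuousOn
    (continuous_const.sub (Complex.continuous_ofReal.comp continuous_hgt)).continuousOn
    fun _ hx => one_sub_hgt_ne_zero hx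

/-- The inverse of stereographic projection from the north pole. -/
def lowInv (w : ℂ) : Sph :=
  mkS (((2 / (Complex.normSq w + 1) : ℝ) : ℂ) * w) ((Complex.normSq w - 1) / (Complex.normSq w + 1)) (by
    have := Complex.normSq_nonneg w
    rw [Complex.normSq_mul, Complex.normSq_ofReal]
    field_simp
    ring)

theorem continuous_lowInv : Continuous lowInv := by
  have h : ∀ w, Complex.normSq w + 1 ≠ 0 := fun w => by
    have := Complex.normSq_nonneg w
    positivity
  have h1 := Complex.continuous_normSq
  refine continuous_mkS ((Complex.continuous_ofReal.comp ?_).mul continuous_id) ?_ _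
  · exact continuous_const.div (h1.add continuous_const) h
  · exact (h1.sub continuous_const).div (h1.add continuous_const) h

theorem low_lowInv (w : ℂ) : low (lowInv w) = w := by
  have := Complex.normSq_nonneg w
  have h : (Complex.normSq w + 1 : ℝ) ≠ 0 := by positivity
  rw [low, lowInv, zc_mkS, hgt_mkS]
  have h1 : (1 : ℂ) - ((Complex.normSq w - 1) / (Complex.normSq w + 1) : ℝ) =
      ((2 / (Complex.normSq w + 1) : ℝ) : ℂ) := by
    norm_cast
    field_simp
    ring
  rw [h1, mul_div_cancel_left₀]
  exact_mod_cast div_ne_zero two_ne_zero h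

theorem normSq_low {x : Sph} (h : x ≠ northPole) :
    Complex.normSq (low x) = (1 + hgt x) / (1 - hgt x) := by
  have h1 : (1 - hgt x) ≠ 0 := by exact_mod_cast one_sub_hgt_ne_zero h
  have h2 := normSq_zc x
  rw [low, Complex.normSq_div, show Complex.normSq (zc x) = (1 + hgt x) * (1 - hgt x) by linarith]
  rw [show (1 - hgt x : ℂ) = ((1 - hgt x : ℝ) : ℂ) by push_cast; rfl, Complex.normSq_ofReal]
  field_simp

theorem lowInv_low {x : Sph} (h : x ≠ northPole) : lowInv (low x) = x := by
  have h1 : (1 - hgt x) ≠ 0 := by exact_mod_cast one_sub_hgt_ne_zero h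
  have h2 : Complex.normSq (low x) + 1 = 2 / (1 - hgt x) := by
    rw [normSq_low h]
    field_simp
    ring
  refine sph_ext ?_ ?_
  · rw [lowInv, zc_mkS, h2, low, div_div_cancel₀ two_ne_zero]
    push_cast
    rw [mul_div_cancel₀ _ (one_sub_hgt_ne_zero h)]
  · rw [lowInv, hgt_mkS, h2, normSq_low h]
    field_simp
    ring

theorem lowInv_ne (w : ℂ) : lowInv w ≠ northPole := by
  intro h
  have := Complex.normSq_nonneg w
  rw [← hgt_eq_one_iff, lowInv, hgt_mkS, div_eq_one_iff_eq (by positivity)] at h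
  linarith

theorem low_injOn : InjOn low {northPole}ᶜ := fun x hx y hy h => by
  rw [← lowInv_low hx, h, lowInv_low hy]

theorem low_eq_zero_iff {x : Sph} (h : x ≠ northPole) : low x = 0 ↔ x = southPole := by
  rw [low, div_eq_zero_iff, or_iff_left (one_sub_hgt_ne_zero h), zc_eq_zero_iff, or_iff_left h]

theorem low_southPole : low southPole = 0 := by simp [low, southPole]

/-- The two stereographic projections differ by an inversion. -/
theorem low_vflip {x : Sph} (h : x ≠ northPole) (h' : x ≠ southPole) :
    low (vflip x) = (starRingEnd ℂ (low x))⁻¹ := by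
  have h1 := one_sub_hgt_ne_zero h
  have h2 := one_add_hgt_ne_zero h'
  have h3 := zc_mul_conj x
  have h4 : zc x ≠ 0 := fun h0 => (zc_eq_zero_iff.1 h0).elim h' h
  rw [low, low, map_div₀, zc_vflip, hgt_vflip, map_sub, map_one, Complex.conj_ofReal, inv_div]
  push_cast
  rw [sub_neg_eq_add, div_eq_div_iff h2 ((map_ne_zero _).2 h4), h3]

theorem lowInv_inv_conj {w : ℂ} (hw : w ≠ 0) :
    vflip (lowInv (starRingEnd ℂ w)⁻¹) = lowInv w := by
  have h1 : lowInv w ≠ southPole := fun h => hw (by rw [← low_lowInv w, h, low_southPole])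
  have h2 := low_vflip (lowInv_ne w) h1
  rw [low_lowInv] at h2
  have h3 : vflip (lowInv w) ≠ northPole := fun h => h1 (by rw [← vflip_vflip (lowInv w), h, vflip_northPole])
  rw [← h2, lowInv_low h3, vflip_vflip]

/-- Maps of the sphere respecting the two poles are homotopic if they wind equally around the
equator. -/
theorem homotopic_of_hasLog {F G : C(Sph, Sph)} {A B : Set Sph} (hA : IsClosed A) (hB : IsClosed B)
    (hAB : A ∪ B = univ) (hFA : ∀ x ∈ A, F x ≠ northPole) (hGA : ∀ x ∈ A, G x ≠ northPole)
    (hFB : ∀ x ∈ B, F x ≠ southPole) (hGB : ∀ x ∈ B, G x ≠ southPole)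
    (hL : HasLog (fun x => low (G x) / low (F x)) (A ∩ B)) : F.Homotopic G := by
  obtain ⟨l, hl, hle⟩ := hL
  obtain ⟨L', hL'⟩ := ContinuousMap.exists_restrict_eq (hA.inter hB)
    ⟨(A ∩ B).domRestrict l, hl.domRestrict⟩
  have hLe : ∀ x ∈ A ∩ B, Complex.exp (L' x) = low (G x) / low (F x) := fun x hx => by
    refine Eq.trans ?_ (hle x hx)
    exact congrArg Complex.exp (congrArg (fun F : C((A ∩ B : Set Sph), ℂ) => F ⟨x, hx⟩) hL')
  have hLc := L'.continuous
  have hvS : ∀ {x : Sph}, x ≠ southPole → vflip x ≠ northPole := fun {x} h1 h2 =>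
    h1 (by rw [← vflip_vflip x, h2, vflip_northPole])
  have hF0 : ∀ x ∈ A ∩ B, low (F x) ≠ 0 := fun x hx h0 =>
    hFB x hx.2 ((low_eq_zero_iff (hFA x hx.1)).1 h0)
  have hG0 : ∀ x ∈ A ∩ B, low (G x) ≠ 0 := fun x hx h0 =>
    hGB x hx.2 ((low_eq_zero_iff (hGA x hx.1)).1 h0)
  have hGe : ∀ x ∈ A ∩ B, low (F x) * Complex.exp (L' x) = low (G x) := fun x hx => by
    rw [hLe x hx, mul_div_cancel₀ _ (hF0 x hx)]
  have hFv : ∀ x ∈ A ∩ B, low (vflip (F x)) = (starRingEnd ℂ (low (F x)))⁻¹ := fun x hx =>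
    low_vflip (hFA x hx.1) (hFB x hx.2)
  have hGv : ∀ x ∈ A ∩ B, low (vflip (G x)) = (starRingEnd ℂ (low (G x)))⁻¹ := fun x hx =>
    low_vflip (hGA x hx.1) (hGB x hx.2)
  set HA : I × Sph → Sph := fun p => lowInv (low (F p.2) * Complex.exp (((p.1 : ℝ) : ℂ) * L' p.2) +
    ((p.1 : ℝ) : ℂ) * (low (G p.2) - low (F p.2) * Complex.exp (L' p.2))) with hHA
  set HB : I × Sph → Sph := fun p => vflip (lowInv (low (vflip (F p.2)) *
    Complex.exp (-(((p.1 : ℝ) : ℂ) * starRingEnd ℂ (L' p.2))) +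
    ((p.1 : ℝ) : ℂ) * (low (vflip (G p.2)) - low (vflip (F p.2)) *
      Complex.exp (-starRingEnd ℂ (L' p.2))))) with hHB
  have hsnd : ∀ {φ : Sph → ℂ} {T : Set Sph}, ContinuousOn φ T →
      ContinuousOn (fun p : I × Sph => φ p.2) (Prod.snd ⁻¹' T) := fun hφ =>
    hφ.comp continuous_snd.continuousOn fun p hp => hp
  have hAc : ContinuousOn HA (Prod.snd ⁻¹' A) := by
    have h1 := hsnd (continuousOn_low.comp F.continuous.continuousOn hFA)
    have h2 := hsnd (continuousOn_low.comp G.continuous.continuousOn hGA)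
    refine continuous_lowInv.comp_continuousOn (ContinuousOn.add (ContinuousOn.mul h1 ?_)
      (ContinuousOn.mul ?_ (ContinuousOn.sub h2 (ContinuousOn.mul h1 ?_))))
    all_goals exact Continuous.continuousOn (by fun_prop)
  have hBc : ContinuousOn HB (Prod.snd ⁻¹' B) := by
    have h1 := hsnd (continuousOn_low.comp (continuous_vflip.comp F.continuous).continuousOn
      fun x hx => hvS (hFB x hx))
    have h2 := hsnd (continuousOn_low.comp (continuous_vflip.comp G.continuous).continuousOn
      fun x hx => hvS (hGB x hx))
    have h3 : Continuous fun p : I × Sph => starRingEnd ℂ (L' p.2) :=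
      Complex.continuous_conj.comp (hLc.comp continuous_snd)
    refine (continuous_vflip.comp continuous_lowInv).comp_continuousOn
      (ContinuousOn.add (ContinuousOn.mul h1 ?_)
      (ContinuousOn.mul ?_ (ContinuousOn.sub h2 (ContinuousOn.mul h1 ?_))))
    all_goals exact Continuous.continuousOn (by fun_prop)
  have hABe : ∀ p : I × Sph, p.2 ∈ A ∩ B → HB p = HA p := by
    rintro ⟨s, x⟩ hx
    simp only at hx
    have e1 : HA (s, x) = lowInv (low (F x) * Complex.exp (((s : ℝ) : ℂ) * L' x)) := by
      simp only [hHA]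
      rw [hGe x hx, sub_self, mul_zero, add_zero]
    have e2 : low (vflip (F x)) * Complex.exp (-(((s : ℝ) : ℂ) * starRingEnd ℂ (L' x))) =
        (starRingEnd ℂ (low (F x) * Complex.exp (((s : ℝ) : ℂ) * L' x)))⁻¹ := by
      rw [hFv x hx, map_mul, ← Complex.exp_conj, map_mul, Complex.conj_ofReal, Complex.exp_neg,
        mul_inv]
    have e3 : low (vflip (G x)) = low (vflip (F x)) * Complex.exp (-starRingEnd ℂ (L' x)) := by
      rw [hGv x hx, hFv x hx, ← hGe x hx, map_mul, ← Complex.exp_conj, Complex.exp_neg, mul_inv]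
    rw [e1, ← lowInv_inv_conj (mul_ne_zero (hF0 x hx) (Complex.exp_ne_zero _)), ← e2]
    simp only [hHB]
    rw [e3, sub_self, mul_zero, add_zero]
  classical
  let H : I × Sph → Sph := fun p => if p.2 ∈ A then HA p else HB p
  have hHA' : EqOn H HA (Prod.snd ⁻¹' A) := fun p hp => if_pos hp
  have hHB' : EqOn H HB (Prod.snd ⁻¹' B) := fun p hp => by
    by_cases h : p.2 ∈ A
    · exact (if_pos h).trans (hABe p ⟨h, hp⟩).symm
    · exact if_neg h
  have hHc : Continuous H := by
    rw [← continuousOn_univ, ← preimage_univ (f := Prod.snd), ← hAB, preimage_union]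
    exact (hAc.congr hHA').union_of_isClosed (hBc.congr hHB') (hA.preimage continuous_snd)
      (hB.preimage continuous_snd)
  have hmem : ∀ x, x ∈ A ∨ x ∈ B := fun x => by
    rw [← mem_union, hAB]
    trivial
  refine ⟨⟨⟨H, hHc⟩, fun x => ?_, fun x => ?_⟩⟩
  · change H (0, x) = F x
    rcases hmem x with hx | hx
    · rw [hHA' hx]
      simp only [hHA]
      simp [lowInv_low (hFA x hx)]
    · rw [hHB' hx]
      simp only [hHB]
      simp [lowInv_low (hvS (hFB x hx))]
  · change H (1, x) = G x
    rcases hmem x with hx | hx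
    · rw [hHA' hx]
      simp only [hHA]
      simp [lowInv_low (hGA x hx)]
    · rw [hHB' hx]
      simp only [hHB]
      simp [lowInv_low (hvS (hGB x hx))]

/-- The complex line in `ℂ²` represented by a point of the sphere. -/
def OnLine (x : Sph) (v : ℂ × ℂ) : Prop :=
  v.1 * (1 - hgt x) = v.2 * zc x ∧ v.1 * starRingEnd ℂ (zc x) = v.2 * (1 + hgt x)

/-- The pullbacks of the tautological line bundle under two maps are isomorphic. -/
def LineIso (F G : Sph → Sph) : Prop :=
  ∃ q : Sph → ℂ × ℂ → ℂ × ℂ, Continuous (fun p : Sph × ℂ × ℂ => q p.1 p.2) ∧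
    (∀ x (c : ℂ) v, q x (c • v) = c • q x v) ∧
    ∀ x v, OnLine (F x) v → v ≠ 0 → OnLine (G x) (q x v) ∧ q x v ≠ 0

theorem LineIso.trans {F G H : Sph → Sph} (h : LineIso F G) (h' : LineIso G H) : LineIso F H := by
  obtain ⟨q, h1, h2, h3⟩ := h
  obtain ⟨q', h1', h2', h3'⟩ := h'
  refine ⟨fun x v => q' x (q x v), h1'.comp (continuous_fst.prodMk h1), fun x c v => ?_,
    fun x v hv h0 => ?_⟩
  · simp only [h2, h2']
  · exact h3' x _ (h3 x v hv h0).1 (h3 x v hv h0).2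

theorem not_onLine_of_kernel {x y : Sph} {a b : ℂ} (hx : OnLine x (a, b)) (h0 : (a, b) ≠ 0)
    (h1 : (1 + hgt y) * a + zc y * b = 0) (h2 : starRingEnd ℂ (zc y) * a + (1 - hgt y) * b = 0) :
    zc x + zc y = 0 ∧ hgt x + hgt y = 0 := by
  obtain ⟨h3, h4⟩ := hx
  simp only at h3 h4
  by_cases hb : b = 0
  · subst hb
    have ha : a ≠ 0 := fun ha => h0 (by rw [ha]; rfl)
    rw [zero_mul, mul_eq_zero, or_iff_right ha] at h3 h4
    rw [mul_zero, add_zero, mul_eq_zero, or_iff_left ha] at h1 h2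
    rw [map_eq_zero] at h4 h2
    rw [h4, h2]
    refine ⟨add_zero _, ?_⟩
    have : (hgt x + hgt y : ℂ) = 0 := by linear_combination h1 - h3
    exact_mod_cast this
  · set u := a / b with hu
    have e1 : zc x = u * (1 - hgt x) := by
      rw [hu]
      field_simp
      linear_combination -h3
    have e2 : zc y = -(u * (1 + hgt y)) := by
      rw [hu]
      field_simp
      linear_combination h1
    have e3 : u * starRingEnd ℂ (zc x) = 1 + hgt x := by
      rw [hu]
      field_simp
      linear_combination h4
    have e4 : u * starRingEnd ℂ (zc y) = -(1 - hgt y) := by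
      rw [hu]
      field_simp
      linear_combination h2
    have hc : ∀ r : ℝ, starRingEnd ℂ (u * (1 - r)) = starRingEnd ℂ u * (1 - r) := fun r => by simp
    have hc' : ∀ r : ℝ, starRingEnd ℂ (-(u * (1 + r))) = -(starRingEnd ℂ u * (1 + r)) :=
      fun r => by simp
    rw [e1, hc, ← mul_assoc, Complex.mul_conj] at e3
    rw [e2, hc', mul_neg, ← mul_assoc, Complex.mul_conj] at e4
    have hn := Complex.normSq_nonneg u
    have e3' : Complex.normSq u * (1 - hgt x) = 1 + hgt x := by exact_mod_cast e3
    have e4' : -(Complex.normSq u * (1 + hgt y)) = -(1 - hgt y) := by exact_mod_cast e4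
    have e5 : (Complex.normSq u + 1) * (hgt x + hgt y) = 0 := by linarith
    have e6 := (mul_eq_zero.1 e5).resolve_left (by positivity)
    refine ⟨?_, e6⟩
    have e7 : (hgt x + hgt y : ℂ) = 0 := by exact_mod_cast e6
    rw [e1, e2]
    linear_combination -u * e7

theorem lineIso_of_ne {F G : Sph → Sph} (hG : Continuous G)
    (h : ∀ x, ¬ (zc (F x) + zc (G x) = 0 ∧ hgt (F x) + hgt (G x) = 0)) : LineIso F G := by
  refine ⟨fun x v => ((1 + hgt (G x)) * v.1 + zc (G x) * v.2,
    starRingEnd ℂ (zc (G x)) * v.1 + (1 - hgt (G x)) * v.2), ?_, ?_, ?_⟩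
  · have h1 : Continuous fun p : Sph × ℂ × ℂ => (hgt (G p.1) : ℂ) :=
      Complex.continuous_ofReal.comp (continuous_hgt.comp (hG.comp continuous_fst))
    have h2 : Continuous fun p : Sph × ℂ × ℂ => zc (G p.1) :=
      continuous_zc.comp (hG.comp continuous_fst)
    have h3 : Continuous fun p : Sph × ℂ × ℂ => starRingEnd ℂ (zc (G p.1)) :=
      Complex.continuous_conj.comp h2
    fun_prop
  · rintro x c ⟨a, b⟩
    ext <;> simp <;> ring
  · rintro x ⟨a, b⟩ hv h0
    refine ⟨⟨?_, ?_⟩, fun hq => h x ?_⟩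
    · simp only
      linear_combination -a * zc_mul_conj (G x)
    · simp only
      linear_combination b * zc_mul_conj (G x)
    · rw [Prod.mk_eq_zero] at hq
      exact not_onLine_of_kernel hv h0 hq.1 hq.2

theorem lineIso_of_homotopic {F G : C(Sph, Sph)} (h : F.Homotopic G) : LineIso F G := by
  obtain ⟨H⟩ := h
  have key : ∀ s : I, ∀ᶠ s' in 𝓝 s, LineIso (fun x => H (s, x)) (fun x => H (s', x)) ∧
      LineIso (fun x => H (s', x)) (fun x => H (s, x)) := by
    intro s
    have hc : Continuous fun p : I × Sph => ‖zc (H (s, p.2)) + zc (H p)‖ +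
        |hgt (H (s, p.2)) + hgt (H p)| := by
      have h1 : Continuous fun p : I × Sph => H (s, p.2) := by fun_prop
      exact ((continuous_zc.comp h1).add (continuous_zc.comp H.continuous)).norm.add
        ((continuous_hgt.comp h1).add (continuous_hgt.comp H.continuous)).abs
    have hpos : ∀ x ∈ (univ : Set Sph), ∀ᶠ p : I × Sph in 𝓝 (s, x),
        0 < ‖zc (H (s, p.2)) + zc (H (p.1, p.2))‖ + |hgt (H (s, p.2)) + hgt (H (p.1, p.2))| := by
      intro x _
      refine (hc.tendsto (s, x)).eventually (lt_mem_nhds ?_)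
      simp only
      by_contra h0
      have h1 := norm_nonneg (zc (H (s, x)) + zc (H (s, x)))
      have h2 := abs_nonneg (hgt (H (s, x)) + hgt (H (s, x)))
      have h3 : zc (H (s, x)) + zc (H (s, x)) = 0 := norm_eq_zero.1 (by linarith)
      have h4 : hgt (H (s, x)) + hgt (H (s, x)) = 0 := abs_eq_zero.1 (by linarith)
      rw [← two_mul, mul_eq_zero, or_iff_right two_ne_zero] at h3 h4
      have h5 := normSq_zc (H (s, x))
      rw [h3, h4] at h5
      simp at h5
    filter_upwards [isCompact_univ.eventually_forall_of_forall_eventually (P := fun s' x =>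
      0 < ‖zc (H (s, x)) + zc (H (s', x))‖ + |hgt (H (s, x)) + hgt (H (s', x))|) hpos] with s' hs'
    have hcs : ∀ s, Continuous fun x => H (s, x) := fun s => by fun_prop
    constructor
    · refine lineIso_of_ne (hcs s') fun x h0 => ?_
      have := hs' x trivial
      simp only [h0.1, h0.2, norm_zero, abs_zero, add_zero, lt_irrefl] at this
    · refine lineIso_of_ne (hcs s) fun x h0 => ?_
      have := hs' x trivial
      rw [add_comm (zc _), add_comm (hgt _)] at this
      simp only [h0.1, h0.2, norm_zero, abs_zero, add_zero, lt_irrefl] at this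
  have := PreconnectedSpace.induction₂' (fun s s' : I => LineIso (fun x => H (s, x)) fun x => H (s', x))
    key ⟨fun _ _ _ h h' => h.trans h'⟩ 0 1
  simpa using this

theorem onLine_lowInv (w : ℂ) : OnLine (lowInv w) (w, 1) := by
  have h := one_sub_hgt_ne_zero (lowInv_ne w)
  have h1 : zc (lowInv w) = w * (1 - hgt (lowInv w)) := by
    have := low_lowInv w
    rwa [low, div_eq_iff h] at this
  refine ⟨by simp only; rw [one_mul, h1], ?_⟩
  have h2 := zc_mul_conj (lowInv w)
  nth_rw 1 [h1] at h2
  simp only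
  apply mul_left_cancel₀ h
  linear_combination h2

theorem onLine_vflip_lowInv (w : ℂ) : OnLine (vflip (lowInv w)) (1, starRingEnd ℂ w) := by
  obtain ⟨h1, h2⟩ := onLine_lowInv w
  have h3 := congrArg (starRingEnd ℂ) h1
  have h4 := congrArg (starRingEnd ℂ) h2
  simp only [map_mul, map_sub, map_add, map_one, Complex.conj_ofReal, Complex.conj_conj] at h3 h4
  refine ⟨?_, ?_⟩ <;> simp only [zc_vflip, hgt_vflip] <;> push_cast
  · linear_combination -h4
  · linear_combination -h3

theorem not_hasLog_sq_circle : ¬ HasLog (fun z : ℂ => z ^ 2) (sphere 0 1) := by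
  rintro ⟨g, hg, hge⟩
  have hc : IsPreconnected (sphere (0 : ℂ) 1) := isPreconnected_sphere (by simp) 0 1
  have hh : ContinuousOn (fun z => Complex.exp (g z / 2)) (sphere (0 : ℂ) 1) :=
    Complex.continuous_exp.comp_continuousOn (hg.div_const 2)
  have hsq : EqOn ((fun z : ℂ => z) ^ 2) ((fun z => Complex.exp (g z / 2)) ^ 2) (sphere 0 1) := by
    intro z hz
    simp only [Pi.pow_apply]
    rw [← Complex.exp_nat_mul]
    refine (hge z hz).symm.trans (congrArg _ ?_)
    push_cast
    ring
  rcases hc.eq_or_eq_neg_of_sq_eq continuousOn_id hh hsq (fun _ => Complex.exp_ne_zero _) with h | h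
  · exact not_hasLog_circle one_pos ⟨fun z => g z / 2, hg.div_const 2, fun z hz => (h hz).symm⟩
  · refine not_hasLog_circle one_pos ⟨fun z => g z / 2 + Real.pi * Complex.I,
      (hg.div_const 2).add continuousOn_const, fun z hz => ?_⟩
    rw [Complex.exp_add, Complex.exp_pi_mul_I, mul_neg_one]
    exact (h hz).symm

theorem not_orientPres_reflect : ¬ OrientPres reflect := by
  intro h
  obtain ⟨q, hq, hl, hn⟩ := lineIso_of_homotopic h.symm
  simp only [ContinuousMap.coe_mk, ContinuousMap.id_apply] at hn
  set lA : ℂ → ℂ := fun w => (q (lowInv w) (w, 1)).2 with hlA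
  set lB : ℂ → ℂ := fun w => (q (vflip (lowInv w)) (1, starRingEnd ℂ w)).1 with hlB
  have hA : Continuous lA := continuous_snd.comp
    (hq.comp (continuous_lowInv.prodMk (continuous_id.prodMk continuous_const)))
  have hB : Continuous lB := continuous_fst.comp
    (hq.comp ((continuous_vflip.comp continuous_lowInv).prodMk
      (continuous_const.prodMk Complex.continuous_conj)))
  have hrN : ∀ w, reflect (lowInv w) ≠ northPole := fun w h0 => by
    rw [← hgt_eq_one_iff, hgt_reflect, hgt_eq_one_iff] at h0
    exact lowInv_ne w h0
  have nA : ∀ w, lA w ≠ 0 := fun w h0 => by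
    obtain ⟨⟨h1, -⟩, h2⟩ := hn (lowInv w) (w, 1) (onLine_lowInv w) (by simp)
    change _ = lA w * _ at h1
    rw [h0, zero_mul, mul_eq_zero, or_iff_left (one_sub_hgt_ne_zero (hrN w))] at h1
    exact h2 (Prod.ext h1 h0)
  have hrS : ∀ w, reflect (vflip (lowInv w)) ≠ southPole := fun w h0 => by
    rw [← hgt_eq_neg_one_iff, hgt_reflect, hgt_vflip, neg_inj, hgt_eq_one_iff] at h0
    exact lowInv_ne w h0
  have nB : ∀ w, lB w ≠ 0 := fun w h0 => by
    obtain ⟨⟨-, h1⟩, h2⟩ := hn _ (1, starRingEnd ℂ w) (onLine_vflip_lowInv w) (by simp)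
    change lB w * _ = _ at h1
    rw [h0, zero_mul, eq_comm, mul_eq_zero, or_iff_left (one_add_hgt_ne_zero (hrS w))] at h1
    exact h2 (Prod.ext h0 h1)
  have LA := (hasLog_closedBall hA.continuousOn fun x _ => nA x).mono sphere_subset_closedBall
  have LB := (hasLog_closedBall hB.continuousOn fun x _ => nB x).mono sphere_subset_closedBall
  refine not_hasLog_sq_circle ((LA.mul LB.inv).congr fun w hw => ?_)
  have hw1 : ‖w‖ = 1 := mem_sphere_zero_iff_norm.1 hw
  have hww : w * starRingEnd ℂ w = 1 := by
    rw [Complex.mul_conj, Complex.normSq_eq_norm_sq, hw1]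
    norm_num
  have h0 : hgt (lowInv w) = 0 := by
    rw [lowInv, hgt_mkS, Complex.normSq_eq_norm_sq, hw1]
    norm_num
  have hv : vflip (lowInv w) = lowInv w := sph_ext rfl (by rw [hgt_vflip, h0, neg_zero])
  have e1 : ((w, 1) : ℂ × ℂ) = w • (1, starRingEnd ℂ w) := by
    rw [Prod.smul_mk, smul_eq_mul, smul_eq_mul, mul_one, hww]
  have e2 := hl (lowInv w) w (1, starRingEnd ℂ w)
  rw [← e1] at e2
  have e3 : (q (lowInv w) (w, 1)).1 = w * lB w := by
    rw [e2, hlB]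
    simp only
    rw [hv, Prod.smul_fst, smul_eq_mul]
  obtain ⟨⟨h1, -⟩, -⟩ := hn (lowInv w) (w, 1) (onLine_lowInv w) (by simp)
  rw [e3, hgt_reflect, zc_reflect, h0] at h1
  have hz : zc (lowInv w) = w := by
    have := low_lowInv w
    rwa [low, h0, Complex.ofReal_zero, sub_zero, div_one] at this
  rw [hz] at h1
  change w * lB w * _ = lA w * _ at h1
  rw [← div_eq_mul_inv, div_eq_iff (nB w)]
  have := congrArg (· * w) h1
  push_cast at this
  linear_combination -this - lA w * hww

theorem cis_inj_of_abs {x y : ℝ} (h : cis x = cis y) (hxy : |x - y| < 2 * Real.pi) : x = y := by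
  rw [abs_lt] at hxy
  have hp := Real.pi_pos
  rcases le_total x y with h1 | h1
  · exact cis_injOn_Ico x ⟨le_rfl, by linarith⟩ ⟨h1, by linarith⟩ h
  · exact cis_injOn_Ico y ⟨h1, by linarith⟩ ⟨le_rfl, by linarith⟩ h

theorem cis_sub_two_pi (t : ℝ) : cis (t - 2 * Real.pi) = cis t := by
  rw [← cis_add_two_pi, sub_add_cancel]

/-- A logarithm descends along a compact parametrization once it is constant on the fibres. -/
theorem HasLog.image_of_fibers {X Y : Type*} [TopologicalSpace X] [TopologicalSpace Y] [T2Space Y]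
    {f : Y → ℂ} {φ : X → Y} {g : X → ℂ} {K : Set X} (hK : IsCompact K) (hφ : ContinuousOn φ K)
    (hg : ContinuousOn g K) (he : ∀ x ∈ K, Complex.exp (g x) = f (φ x))
    (hc : ∀ x ∈ K, ∀ y ∈ K, φ x = φ y → g x = g y) : HasLog f (φ '' K) := by
  rcases K.eq_empty_or_nonempty with rfl | ⟨x₀, -⟩
  · exact ⟨fun _ => 0, by simp, by simp⟩
  have : Nonempty X := ⟨x₀⟩
  have key : ∀ x ∈ K, g (Function.invFunOn φ K (φ x)) = g x := fun x hx =>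
    hc _ (Function.invFunOn_mem ⟨x, hx, rfl⟩) x hx (Function.invFunOn_eq ⟨x, hx, rfl⟩)
  refine ⟨fun y => g (Function.invFunOn φ K y), ?_, ?_⟩
  · rw [continuousOn_iff_isClosed]
    intro t ht
    obtain ⟨u, hu, hut⟩ := continuousOn_iff_isClosed.1 hg t ht
    refine ⟨φ '' (u ∩ K), ((hK.inter_left hu).image_of_continuousOn
      (hφ.mono inter_subset_right)).isClosed, ?_⟩
    rw [← hut]
    ext y
    constructor
    · rintro ⟨hy, x, hx, rfl⟩
      rw [mem_preimage, key x hx] at hy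
      exact ⟨⟨x, ⟨hy, hx⟩, rfl⟩, x, hx, rfl⟩
    · rintro ⟨⟨x, ⟨hxt, hx⟩, rfl⟩, -⟩
      refine ⟨?_, x, hx, rfl⟩
      rwa [mem_preimage, key x hx]
  · rintro y ⟨x, hx, rfl⟩
    simp only
    rw [key x hx, he x hx]

theorem angle_step {m : ℝ → ℝ} {a b p v : ℝ} (hab : a ≤ b) (hm : ContinuousOn m (Icc a b))
    (h1 : p < m a) (h2 : m a < v) (hav : ∀ t ∈ Ioo a b, m t ≠ p ∧ m t ≠ v)
    (hv : v - 2 * Real.pi < p) (hb : cis (m b) = cis v) : m b = v := by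
  have hp := Real.pi_pos
  have e1 : m b ≤ v := by
    by_contra! h
    obtain ⟨t, ht, hte⟩ := intermediate_value_Ioo hab hm ⟨h2, h⟩
    exact (hav t ht).2 hte
  have e2 : p ≤ m b := by
    by_contra! h
    obtain ⟨t, ht, hte⟩ := intermediate_value_Ioo' hab hm ⟨h, h1⟩
    exact (hav t ht).1 hte
  exact cis_inj_of_abs hb (by rw [abs_lt]; constructor <;> linarith)

/-- A planar embedding near the origin that respects the cyclic order of three rays winds once
around the origin. -/
theorem exists_hasLog_of_rays {f : ℂ → ℂ} {δ : ℝ} {θ θ' : Fin 3 → ℝ} (hδ : 0 < δ)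
    (hf : ContinuousOn f (closedBall 0 δ)) (hi : InjOn f (closedBall 0 δ)) (h0 : f 0 = 0)
    (hθ : θ 0 < θ 1 ∧ θ 1 < θ 2 ∧ θ 2 < θ 0 + 2 * Real.pi)
    (hθ' : θ' 0 < θ' 1 ∧ θ' 1 < θ' 2 ∧ θ' 2 < θ' 0 + 2 * Real.pi)
    (hr : ∀ s, ∀ r ∈ Icc 0 δ, f (r * cis (θ s)) = ‖f (r * cis (θ s))‖ * cis (θ' s)) :
    ∃ ε ∈ Ioo 0 δ, HasLog (fun z => f z / z) (sphere 0 ε) := by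
  have hp := Real.pi_pos
  have hnr : ∀ {r : ℝ} (t : ℝ), 0 ≤ r → ‖(r : ℂ) * cis t‖ = r := fun {r} t hr => by
    rw [norm_mul, norm_cis, mul_one, Complex.norm_real, Real.norm_of_nonneg hr]
  have hmem : ∀ {r : ℝ} (t : ℝ), r ∈ Icc 0 δ → (r : ℂ) * cis t ∈ closedBall (0 : ℂ) δ :=
    fun {r} t hr => by
      rw [mem_closedBall_zero_iff, hnr t hr.1]
      exact hr.2
  have h0m : (0 : ℂ) ∈ closedBall (0 : ℂ) δ := by simp [hδ.le]
  have hne : ∀ z ∈ closedBall (0 : ℂ) δ, z ≠ 0 → f z ≠ 0 := fun z hz hz0 h => hz0 (hi hz h0m (h.trans h0.symm))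
  obtain ⟨η, hη, hηs⟩ : ∃ η : ℝ, 0 < η ∧ ∀ s, η ≤ ‖f (δ * cis (θ s))‖ := by
    obtain ⟨s, -, hs⟩ := Finset.exists_min_image Finset.univ (fun s => ‖f (δ * cis (θ s))‖)
      ⟨0, Finset.mem_univ _⟩
    refine ⟨_, norm_pos_iff.2 (hne _ (hmem (θ s) ⟨hδ.le, le_rfl⟩) ?_), fun s' => hs s' (Finset.mem_univ _)⟩
    exact mul_ne_zero (Complex.ofReal_ne_zero.2 hδ.ne') (cis_ne_zero _)
  obtain ⟨ε, hε, hεf⟩ : ∃ ε ∈ Ioo 0 δ, ∀ z ∈ closedBall (0 : ℂ) ε, ‖f z‖ < η := by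
    have hc : ContinuousAt f 0 := hf.continuousAt (closedBall_mem_nhds 0 hδ)
    have : ∀ᶠ z in 𝓝 (0 : ℂ), ‖f z‖ < η := by
      refine hc.norm.eventually_lt continuousAt_const ?_
      simpa [h0] using hη
    obtain ⟨ε, hε, h⟩ := Metric.eventually_nhds_iff_ball.1 this
    refine ⟨min (ε / 2) (δ / 2), ⟨by positivity, (min_le_right _ _).trans_lt (by linarith)⟩,
      fun z hz => h z ?_⟩
    rw [mem_closedBall] at hz
    exact hz.trans_lt ((min_le_left _ _).trans_lt (by linarith))
  have hε' : ε ∈ Icc 0 δ := ⟨hε.1.le, hε.2.le⟩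
  have hε0 : (ε : ℂ) ≠ 0 := Complex.ofReal_ne_zero.2 hε.1.ne'
  have claim : ∀ t s, f (ε * cis t) = ‖f (ε * cis t)‖ * cis (θ' s) → cis t = cis (θ s) := by
    intro t s h
    have hcn : ContinuousOn (fun r : ℝ => ‖f (r * cis (θ s))‖) (Icc 0 δ) :=
      (hf.comp (Continuous.continuousOn (by fun_prop)) fun r hr => hmem _ hr).norm
    obtain ⟨r, hrm, hre⟩ := intermediate_value_Icc hδ.le hcn
      (show ‖f (ε * cis t)‖ ∈ Icc _ _ from ⟨by simp [h0],
        (hεf _ (by rw [mem_closedBall_zero_iff, hnr _ hε.1.le])).le.trans (hηs s)⟩)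
    simp only at hre
    have h1 : f (r * cis (θ s)) = f (ε * cis t) := by rw [hr s r hrm, hre, ← h]
    have h2 := hi (hmem _ hrm) (hmem _ hε') h1
    have h3 : r = ε := by
      have := congrArg norm h2
      rwa [hnr _ hrm.1, hnr _ hε.1.le] at this
    rw [h3] at h2
    exact (mul_left_cancel₀ hε0 h2).symm
  refine ⟨ε, hε, ?_⟩
  have hφc : Continuous fun t : ℝ => (ε : ℂ) * cis t := continuous_const.mul continuous_cis
  obtain ⟨l₀, hl₀, hle₀⟩ := hasLog_Icc (f := fun t => f (ε * cis t)) (a := θ 0)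
    (b := θ 0 + 2 * Real.pi) (hf.comp hφc.continuousOn fun t _ => hmem t hε')
    fun t _ => hne _ (hmem t hε') (mul_ne_zero hε0 (cis_ne_zero _))
  have hpol : ∀ z : ℂ, Complex.exp z = ‖Complex.exp z‖ * cis z.im := fun z => by
    rw [Complex.norm_exp, cis, Complex.ofReal_exp, ← Complex.exp_add, Complex.re_add_im]
  have hcan : ∀ {z w w' : ℂ}, z ≠ 0 → z = ‖z‖ * w → z = ‖z‖ * w' → w = w' := fun {z w w'} hz h h' =>
    mul_left_cancel₀ (Complex.ofReal_ne_zero.2 (norm_ne_zero_iff.2 hz)) (h.symm.trans h')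
  have hm0 : θ 0 ∈ Icc (θ 0) (θ 0 + 2 * Real.pi) := ⟨le_rfl, by linarith⟩
  have hm1 : θ 1 ∈ Icc (θ 0) (θ 0 + 2 * Real.pi) := ⟨by linarith, by linarith⟩
  have hm2 : θ 2 ∈ Icc (θ 0) (θ 0 + 2 * Real.pi) := ⟨by linarith, by linarith⟩
  have hm3 : θ 0 + 2 * Real.pi ∈ Icc (θ 0) (θ 0 + 2 * Real.pi) := ⟨by linarith, le_rfl⟩
  obtain ⟨l, hl, hle, hl0⟩ : ∃ l : ℝ → ℂ, ContinuousOn l (Icc (θ 0) (θ 0 + 2 * Real.pi)) ∧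
      (∀ t ∈ Icc (θ 0) (θ 0 + 2 * Real.pi), Complex.exp (l t) = f (ε * cis t)) ∧
      (l (θ 0)).im = θ' 0 := by
    have h1 := hle₀ _ hm0
    simp only at h1
    have h2 : cis (l₀ (θ 0)).im = cis (θ' 0) := by
      refine hcan (Complex.exp_ne_zero (l₀ (θ 0))) (hpol _) ?_
      rw [h1]
      exact hr 0 ε hε'
    rw [cis, cis, Complex.exp_eq_exp_iff_exists_int] at h2
    obtain ⟨n, hn⟩ := h2
    refine ⟨fun t => l₀ t - n * (2 * Real.pi * Complex.I), hl₀.sub continuousOn_const,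
      fun t ht => ?_, ?_⟩
    · rw [Complex.exp_sub, Complex.exp_int_mul_two_pi_mul_I, div_one]
      exact hle₀ t ht
    · have := congrArg Complex.im hn
      simp at this
      simp [this]
  have hav : ∀ t ∈ Icc (θ 0) (θ 0 + 2 * Real.pi), ∀ s, cis (l t).im = cis (θ' s) →
      cis t = cis (θ s) := by
    intro t ht s h
    refine claim t s ?_
    rw [← hle t ht, ← h]
    exact hpol _
  have hat : ∀ s, ∀ t ∈ Icc (θ 0) (θ 0 + 2 * Real.pi), cis t = cis (θ s) →
      cis (l t).im = cis (θ' s) := by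
    intro s t ht h
    refine hcan (Complex.exp_ne_zero (l t)) (hpol _) ?_
    rw [hle t ht, h]
    exact hr s ε hε'
  have hlim : ContinuousOn (fun t => (l t).im) (Icc (θ 0) (θ 0 + 2 * Real.pi)) :=
    Complex.continuous_im.comp_continuousOn hl
  have e1 : (l (θ 1)).im = θ' 1 := by
    refine angle_step (m := fun t => (l t).im) (p := θ' 2 - 2 * Real.pi) hθ.1.le (hlim.mono (Icc_subset_Icc le_rfl hm1.2))
      (by rw [hl0]; linarith) (by rw [hl0]; linarith) (fun t ht => ⟨fun h => ?_, fun h => ?_⟩)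
      (by linarith) (hat 1 _ hm1 rfl)
    · have := cis_inj_of_abs (hav t ⟨ht.1.le, by linarith [ht.2]⟩ 2 (by rw [h, cis_sub_two_pi]))
        (by rw [abs_lt]; constructor <;> linarith [ht.1, ht.2])
      linarith [ht.2]
    · have := cis_inj_of_abs (hav t ⟨ht.1.le, by linarith [ht.2]⟩ 1 (by rw [h]))
        (by rw [abs_lt]; constructor <;> linarith [ht.1, ht.2])
      linarith [ht.2]
  have e2 : (l (θ 2)).im = θ' 2 := by
    refine angle_step (m := fun t => (l t).im) (p := θ' 0) hθ.2.1.le (hlim.mono (Icc_subset_Icc hm1.1 hm2.2))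
      (by rw [e1]; linarith) (by rw [e1]; linarith) (fun t ht => ⟨fun h => ?_, fun h => ?_⟩)
      (by linarith) (hat 2 _ hm2 rfl)
    · have := cis_inj_of_abs (hav t ⟨by linarith [ht.1], by linarith [ht.2]⟩ 0 (by rw [h]))
        (by rw [abs_lt]; constructor <;> linarith [ht.1, ht.2])
      linarith [ht.1]
    · have := cis_inj_of_abs (hav t ⟨by linarith [ht.1], by linarith [ht.2]⟩ 2 (by rw [h]))
        (by rw [abs_lt]; constructor <;> linarith [ht.1, ht.2])
      linarith [ht.2]
  have e3 : (l (θ 0 + 2 * Real.pi)).im = θ' 0 + 2 * Real.pi := by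
    refine angle_step (m := fun t => (l t).im) (p := θ' 1) hθ.2.2.le (hlim.mono (Icc_subset_Icc hm2.1 le_rfl))
      (by rw [e2]; linarith) (by rw [e2]; linarith) (fun t ht => ⟨fun h => ?_, fun h => ?_⟩)
      (by linarith) (by rw [hat 0 _ hm3 (cis_add_two_pi _), cis_add_two_pi])
    · have := cis_inj_of_abs (hav t ⟨by linarith [ht.1], by linarith [ht.2]⟩ 1 (by rw [h]))
        (by rw [abs_lt]; constructor <;> linarith [ht.1, ht.2])
      linarith [ht.1]
    · have := cis_inj_of_abs (hav t ⟨by linarith [ht.1], by linarith [ht.2]⟩ 0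
        (by rw [h, cis_add_two_pi])) (by rw [abs_lt]; constructor <;> linarith [ht.1, ht.2])
      linarith [ht.1]
  have e4 : l (θ 0 + 2 * Real.pi) = l (θ 0) + 2 * Real.pi * Complex.I := by
    have h1 := congrArg norm ((hle _ hm3).trans (by rw [cis_add_two_pi] : _ = f (ε * cis (θ 0))))
    rw [← hle _ hm0, Complex.norm_exp, Complex.norm_exp, Real.exp_eq_exp] at h1
    apply Complex.ext
    · simp [h1]
    · simp [e3, hl0]
  have himg : sphere (0 : ℂ) ε = (fun t : ℝ => (ε : ℂ) * cis t) '' Icc (θ 0) (θ 0 + 2 * Real.pi) := by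
    ext z
    rw [mem_sphere_zero_iff_norm]
    constructor
    · intro hz
      obtain ⟨t, ht, hte⟩ := exists_cis_eq (z := z / ε) (by
        rw [norm_div, hz, Complex.norm_real, Real.norm_of_nonneg hε.1.le, div_self hε.1.ne']) (θ 0)
      exact ⟨t, ⟨ht.1, ht.2.le⟩, by simp only; rw [hte, mul_div_cancel₀ _ hε0]⟩
    · rintro ⟨t, -, rfl⟩
      exact hnr t hε.1.le
  rw [himg]
  have hwrap : ∀ x ∈ Icc (θ 0) (θ 0 + 2 * Real.pi), ∀ y ∈ Icc (θ 0) (θ 0 + 2 * Real.pi),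
      x < y → cis x = cis y → x = θ 0 ∧ y = θ 0 + 2 * Real.pi := by
    intro x hx y hy hxy h
    by_contra hn
    refine hxy.ne (cis_inj_of_abs h ?_)
    rw [abs_lt]
    refine ⟨?_, by linarith⟩
    by_contra! h1
    exact hn ⟨by linarith [hx.1, hy.2], by linarith [hx.1, hy.2]⟩
  refine HasLog.image_of_fibers (g := fun t => l t - (Real.log ε + t * Complex.I)) isCompact_Icc
    hφc.continuousOn (hl.sub (Continuous.continuousOn (by fun_prop))) (fun t ht => ?_)
    fun x hx y hy hxy => ?_
  · rw [Complex.exp_sub, hle t ht, Complex.exp_add, ← Complex.ofReal_exp, Real.exp_log hε.1]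
    rfl
  · have hxy' := mul_left_cancel₀ hε0 hxy
    rcases lt_trichotomy x y with h | h | h
    · obtain ⟨rfl, rfl⟩ := hwrap x hx y hy h hxy'
      rw [e4]
      push_cast
      ring
    · rw [h]
    · obtain ⟨rfl, rfl⟩ := hwrap y hy x hx h hxy'.symm
      rw [e4]
      push_cast
      ring

/-- The closed meridian at a given longitude. -/
def ray (θ : ℝ) : Set Sph := {x | ∃ r : ℝ, 0 ≤ r ∧ zc x = r * cis θ}

theorem lowInv_zero : lowInv 0 = southPole := by
  rw [← low_southPole, lowInv_low]
  intro h
  have := congrArg hgt h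
  simp only [southPole, northPole, hgt_mkS] at this
  norm_num at this

theorem southPole_ne_northPole : southPole ≠ northPole := by
  rw [← lowInv_zero]
  exact lowInv_ne 0

theorem lowInv_mem_ray {r : ℝ} (hr : 0 ≤ r) (θ : ℝ) : lowInv (r * cis θ) ∈ ray θ := by
  refine ⟨2 / (Complex.normSq (r * cis θ) + 1) * r, ?_, ?_⟩
  · have := Complex.normSq_nonneg (r * cis θ)
    positivity
  · rw [lowInv, zc_mkS]
    push_cast
    ring

theorem low_eq_of_mem_ray {x : Sph} {θ : ℝ} (hx : x ∈ ray θ) (hN : x ≠ northPole) :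
    low x = ‖low x‖ * cis θ := by
  obtain ⟨r, hr, h⟩ := hx
  have h1 := one_sub_hgt_ne_zero hN
  have h2 : 0 < 1 - hgt x := by
    have h3 := (hgt_mem x).2
    refine lt_of_le_of_ne (by linarith) (Ne.symm ?_)
    exact_mod_cast h1
  have h4 : low x = ((r / (1 - hgt x) : ℝ) : ℂ) * cis θ := by
    rw [low, h]
    push_cast
    ring
  have h5 : 0 ≤ r / (1 - hgt x) := by positivity
  rw [h4, norm_mul, norm_cis, mul_one, Complex.norm_real, Real.norm_of_nonneg h5]

/-- A homeomorphism of the sphere whose germ at a pole respects the cyclic order of three meridians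
preserves orientation. -/
theorem orientPres_of_rays {F : Sph ≃ₜ Sph} (hF : F southPole = southPole) {θ θ' : Fin 3 → ℝ}
    (hθ : θ 0 < θ 1 ∧ θ 1 < θ 2 ∧ θ 2 < θ 0 + 2 * Real.pi)
    (hθ' : θ' 0 < θ' 1 ∧ θ' 1 < θ' 2 ∧ θ' 2 < θ' 0 + 2 * Real.pi)
    {U : Set Sph} (hU : U ∈ 𝓝 southPole) (hr : ∀ s, ∀ x ∈ U, x ∈ ray (θ s) → F x ∈ ray (θ' s)) :
    OrientPres F := by
  have hV : lowInv ⁻¹' (U ∩ F ⁻¹' {northPole}ᶜ) ∈ 𝓝 (0 : ℂ) := by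
    refine continuous_lowInv.continuousAt.preimage_mem_nhds ?_
    rw [lowInv_zero]
    refine inter_mem hU ((isOpen_compl_singleton.preimage F.continuous).mem_nhds ?_)
    rw [mem_preimage, hF]
    exact southPole_ne_northPole
  obtain ⟨δ, hδ, hb⟩ := nhds_basis_closedBall.mem_iff.1 hV
  have hi : InjOn (fun w => low (F (lowInv w))) (closedBall 0 δ) := fun w hw w' hw' h => by
    have := F.injective (low_injOn (hb hw).2 (hb hw').2 h)
    rw [← low_lowInv w, this, low_lowInv]
  have h0 : low (F (lowInv 0)) = 0 := by rw [lowInv_zero, hF, low_southPole]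
  obtain ⟨ε, hε, hL⟩ := exists_hasLog_of_rays (f := fun w => low (F (lowInv w))) hδ
    (continuousOn_low.comp (F.continuous.comp continuous_lowInv).continuousOn fun w hw => (hb hw).2)
    hi h0 hθ hθ' fun s r hrm => by
      have hm : (r : ℂ) * cis (θ s) ∈ closedBall (0 : ℂ) δ := by
        rw [mem_closedBall_zero_iff, norm_mul, norm_cis, mul_one, Complex.norm_real,
          Real.norm_of_nonneg hrm.1]
        exact hrm.2
      exact low_eq_of_mem_ray (hr s _ (hb hm).1 (lowInv_mem_ray hrm.1 _)) (hb hm).2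
  have hε0 := hε.1
  have hN : hgt northPole = 1 := rfl
  have hS : hgt southPole = -1 := rfl
  have hAN : ∀ x : Sph, 1 + hgt x ≤ ε ^ 2 * (1 - hgt x) → x ≠ northPole := by
    rintro x hx rfl
    rw [hN] at hx
    linarith
  have hpos : ∀ x : Sph, x ≠ northPole → 0 < 1 - hgt x := fun x hx => by
    have h3 := (hgt_mem x).2
    refine lt_of_le_of_ne (by linarith) (Ne.symm ?_)
    exact_mod_cast one_sub_hgt_ne_zero hx
  have hBS : ∀ x : Sph, ε ^ 2 * (1 - hgt x) ≤ 1 + hgt x → x ≠ southPole := by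
    rintro x hx rfl
    rw [hS] at hx
    nlinarith
  have hh := continuous_hgt
  refine ContinuousMap.Homotopic.symm (homotopic_of_hasLog (F := ContinuousMap.id Sph)
    (G := ⟨F, F.continuous⟩)
    (isClosed_le (f := fun x => 1 + hgt x) (g := fun x => ε ^ 2 * (1 - hgt x)) (by fun_prop)
      (by fun_prop))
    (isClosed_le (f := fun x => ε ^ 2 * (1 - hgt x)) (g := fun x => 1 + hgt x) (by fun_prop)
      (by fun_prop)) ?_ hAN ?_ hBS ?_ ?_)
  · rw [eq_univ_iff_forall]
    exact fun x => le_total (1 + hgt x) _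
  · intro x hx
    have hxN := hAN x hx
    have hm : low x ∈ closedBall (0 : ℂ) δ := by
      rw [mem_closedBall_zero_iff]
      refine le_trans (le_of_sq_le_sq ?_ hε0.le) hε.2.le
      rw [← Complex.normSq_eq_norm_sq, normSq_low hxN, div_le_iff₀ (hpos x hxN)]
      exact hx
    have := (hb hm).2
    rwa [mem_preimage, lowInv_low hxN] at this
  · intro x hx h
    exact hBS x hx (F.injective (h.trans hF.symm))
  · have := hL.comp (φ := low) (L := {x : Sph | 1 + hgt x ≤ ε ^ 2 * (1 - hgt x)} ∩
      {x : Sph | ε ^ 2 * (1 - hgt x) ≤ 1 + hgt x}) (continuousOn_low.mono fun x hx => hAN x hx.1) ?_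
    · refine this.congr fun x hx => ?_
      simp only [ContinuousMap.coe_mk, ContinuousMap.id_apply]
      rw [lowInv_low (hAN x hx.1)]
    · intro x hx
      have hxN := hAN x hx.1
      rw [mem_sphere_zero_iff_norm, ← abs_of_nonneg (norm_nonneg (low x)), ← abs_of_pos hε0,
        ← sq_eq_sq_iff_abs_eq_abs, ← Complex.normSq_eq_norm_sq, normSq_low hxN,
        div_eq_iff (hpos x hxN).ne']
      exact le_antisymm hx.1 hx.2

theorem orientPres_trans {f g : Sph ≃ₜ Sph} (hf : OrientPres f) (hg : OrientPres g) :
    OrientPres (f.trans g) :=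
  ContinuousMap.Homotopic.comp hg hf

theorem orientPres_symm {f : Sph ≃ₜ Sph} (hf : OrientPres f) : OrientPres f.symm := by
  have h : ContinuousMap.Homotopic _ _ := ContinuousMap.Homotopic.comp (ContinuousMap.Homotopic.refl
    (⟨f.symm, f.symm.continuous⟩ : C(Sph, Sph))) hf
  have e : (⟨f.symm, f.symm.continuous⟩ : C(Sph, Sph)).comp ⟨f, f.continuous⟩ =
      ContinuousMap.id Sph := by
    ext1 x
    exact f.symm_apply_apply x
  rw [e, ContinuousMap.comp_id] at h
  exact h.symm

/-- Conjugation by an arbitrary homeomorphism preserves `OrientPres`. -/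
theorem orientPres_conj {f k : Sph ≃ₜ Sph} (hf : OrientPres f) :
    OrientPres ((k.trans f).trans k.symm) := by
  have h : ContinuousMap.Homotopic _ _ := ContinuousMap.Homotopic.comp (ContinuousMap.Homotopic.refl
    (⟨k.symm, k.symm.continuous⟩ : C(Sph, Sph))) (ContinuousMap.Homotopic.comp hf
    (ContinuousMap.Homotopic.refl (⟨k, k.continuous⟩ : C(Sph, Sph))))
  have e : (⟨k.symm, k.symm.continuous⟩ : C(Sph, Sph)).comp ((ContinuousMap.id Sph).comp
      ⟨k, k.continuous⟩) = ContinuousMap.id Sph := by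
    ext1 x
    exact k.symm_apply_apply x
  rw [e] at h
  exact h

theorem not_orientPres_of_rays {F : Sph ≃ₜ Sph} (hF : F southPole = southPole) {θ θ' : Fin 3 → ℝ}
    (hθ : θ 0 < θ 1 ∧ θ 1 < θ 2 ∧ θ 2 < θ 0 + 2 * Real.pi)
    (hθ' : θ' 1 < θ' 0 ∧ θ' 2 < θ' 1 ∧ θ' 0 < θ' 2 + 2 * Real.pi)
    {U : Set Sph} (hU : U ∈ 𝓝 southPole) (hr : ∀ s, ∀ x ∈ U, x ∈ ray (θ s) → F x ∈ ray (θ' s)) :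
    ¬ OrientPres F := by
  intro hop
  have h1 : OrientPres (F.trans reflect) := by
    refine orientPres_of_rays (θ := θ) (θ' := fun s => -θ' s) ?_ hθ
      ⟨by linarith, by linarith, by linarith⟩ hU fun s x hx hxr => ?_
    · rw [Homeomorph.trans_apply, hF]
      exact sph_ext (by simp [southPole]) rfl
    · obtain ⟨r, h0, h⟩ := hr s x hx hxr
      refine ⟨r, h0, ?_⟩
      rw [Homeomorph.trans_apply, zc_reflect, h, map_mul, Complex.conj_ofReal, cis, cis,
        ← Complex.exp_conj, map_mul, Complex.conj_ofReal, Complex.conj_I]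
      push_cast
      ring_nf
  have h2 := orientPres_trans (orientPres_symm hop) h1
  have e : F.symm.trans (F.trans reflect) = reflect := by
    ext1 x
    simp
  rw [e] at h2
  exact not_orientPres_reflect h2

/-- The meridian of longitude `ψ`, parametrized from the south pole to the north pole. -/
def merid (ψ t : ℝ) : Sph :=
  mkS ((Real.sin (Real.pi * t) : ℝ) * cis ψ) (-Real.cos (Real.pi * t)) (by
    rw [Complex.normSq_mul, Complex.normSq_ofReal, Complex.normSq_eq_norm_sq, norm_cis]
    have := Real.sin_sq_add_cos_sq (Real.pi * t)
    linarith)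

@[simp] theorem zc_merid (ψ t : ℝ) : zc (merid ψ t) = (Real.sin (Real.pi * t) : ℝ) * cis ψ := rfl

@[simp] theorem hgt_merid (ψ t : ℝ) : hgt (merid ψ t) = -Real.cos (Real.pi * t) := rfl

theorem continuous_merid {X : Type*} [TopologicalSpace X] {f g : X → ℝ} (hf : Continuous f)
    (hg : Continuous g) : Continuous fun x => merid (f x) (g x) := by
  refine continuous_mkS ?_ ?_ _
  · have := continuous_cis.comp hf
    exact (Complex.continuous_ofReal.comp (by fun_prop)).mul this
  · fun_prop

theorem merid_zero (ψ : ℝ) : merid ψ 0 = southPole := sph_ext (by simp [southPole]) (by simp [southPole])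

theorem merid_one (ψ : ℝ) : merid ψ 1 = northPole := sph_ext (by simp [northPole]) (by simp [northPole])

theorem pi_mul_mem {t : ℝ} (ht : t ∈ Icc (0 : ℝ) 1) : Real.pi * t ∈ Icc 0 Real.pi :=
  ⟨mul_nonneg Real.pi_pos.le ht.1, mul_le_of_le_one_right Real.pi_pos.le ht.2⟩

theorem sin_pi_mul_nonneg {t : ℝ} (ht : t ∈ Icc (0 : ℝ) 1) : 0 ≤ Real.sin (Real.pi * t) :=
  Real.sin_nonneg_of_mem_Icc (pi_mul_mem ht)

theorem sin_pi_mul_pos {t : ℝ} (ht : t ∈ Ioo (0 : ℝ) 1) : 0 < Real.sin (Real.pi * t) :=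
  Real.sin_pos_of_mem_Ioo ⟨mul_pos Real.pi_pos ht.1, mul_lt_of_lt_one_right Real.pi_pos ht.2⟩

theorem hgt_merid_inj {ψ ψ' t t' : ℝ} (ht : t ∈ Icc (0 : ℝ) 1) (ht' : t' ∈ Icc (0 : ℝ) 1)
    (h : merid ψ t = merid ψ' t') : t = t' := by
  have h1 := congrArg hgt h
  rw [hgt_merid, hgt_merid, neg_inj] at h1
  exact mul_left_cancel₀ Real.pi_ne_zero (Real.injOn_cos (pi_mul_mem ht) (pi_mul_mem ht') h1)

theorem cis_eq_of_merid_eq {ψ ψ' t t' : ℝ} (ht : t ∈ Ioo (0 : ℝ) 1) (ht' : t' ∈ Icc (0 : ℝ) 1)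
    (h : merid ψ t = merid ψ' t') : cis ψ = cis ψ' := by
  have h1 := hgt_merid_inj (Ioo_subset_Icc_self ht) ht' h
  have h2 := congrArg zc h
  rw [← h1, zc_merid, zc_merid] at h2
  exact mul_left_cancel₀ (Complex.ofReal_ne_zero.2 (sin_pi_mul_pos ht).ne') h2

theorem merid_mem_ray {t : ℝ} (ht : t ∈ Icc (0 : ℝ) 1) (ψ : ℝ) : merid ψ t ∈ ray ψ :=
  ⟨_, sin_pi_mul_nonneg ht, zc_merid ψ t⟩

theorem exists_merid {x : Sph} {ψ : ℝ} (hx : x ∈ ray ψ) : ∃ t ∈ Icc (0 : ℝ) 1, merid ψ t = x := by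
  obtain ⟨r, hr, h⟩ := hx
  have hp := Real.pi_pos
  have hm := hgt_mem x
  have e : Real.pi * (Real.arccos (-hgt x) / Real.pi) = Real.arccos (-hgt x) := by field_simp
  have hc : Real.cos (Real.arccos (-hgt x)) = -hgt x :=
    Real.cos_arccos (by linarith [hm.2]) (by linarith [hm.1])
  refine ⟨Real.arccos (-hgt x) / Real.pi, ⟨div_nonneg (Real.arccos_nonneg _) hp.le,
    (div_le_one hp).2 (Real.arccos_le_pi _)⟩, sph_ext ?_ ?_⟩
  · rw [zc_merid, e, h, Real.sin_arccos]
    have h1 := normSq_zc x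
    rw [h, Complex.normSq_mul, Complex.normSq_ofReal, Complex.normSq_eq_norm_sq, norm_cis] at h1
    rw [show 1 - (-hgt x) ^ 2 = r ^ 2 by linarith, Real.sqrt_sq hr]
  · rw [hgt_merid, e, hc, neg_neg]

/-- The angles of the three standard meridians. -/
def ang (s : Fin 3) : ℝ := 2 * Real.pi / 3 * (s : ℝ)

theorem ang_zero : ang 0 = 0 := by simp [ang]
theorem ang_one : ang 1 = 2 * Real.pi / 3 := by simp [ang]
theorem ang_two : ang 2 = 4 * Real.pi / 3 := by
  simp [ang]
  ring

theorem ang_mem (s : Fin 3) : ang s ∈ Ico 0 (0 + 2 * Real.pi) := by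
  have hp := Real.pi_pos
  have h : ∀ s, s = (0 : Fin 3) ∨ s = 1 ∨ s = 2 := by decide
  rcases h s with rfl | rfl | rfl
  · rw [ang_zero]
    constructor <;> linarith
  · rw [ang_one]
    constructor <;> linarith
  · rw [ang_two]
    constructor <;> linarith

theorem cis_ang_inj {s t : Fin 3} (h : cis (ang s) = cis (ang t)) : s = t := by
  have h1 := cis_injOn_Ico 0 (ang_mem s) (ang_mem t) h
  rw [ang, ang, mul_right_inj' (by positivity)] at h1
  exact Fin.ext (by exact_mod_cast h1)

/-- The standard theta curve. -/
theorem isTheta_merid : IsTheta fun s t => merid (ang s) t where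
  cont s := (continuous_merid continuous_const continuous_id).continuousOn
  zero s t := by simp only [merid_zero]
  one s t := by simp only [merid_one]
  inj s t x hx y hy h := by
    refine ⟨hgt_merid_inj hx hy h, ?_⟩
    by_contra! hn
    exact hn.1 (cis_ang_inj (cis_eq_of_merid_eq ⟨hx.1.lt_of_ne' hn.2.1, hx.2.lt_of_ne hn.2.2⟩ hy h))

theorem orientPres_of_germ {α : Fin 3 → ℝ → Sph} (hα : IsTheta α) {k : Sph ≃ₜ Sph}
    (h0 : k (α 0 0) = α 0 0) {U : Set Sph} (hU : U ∈ 𝓝 (α 0 0))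
    (h : ∀ s, ∀ t ∈ Icc (0 : ℝ) 1, α s t ∈ U → k (α s t) ∈ α s '' Icc 0 1) : OrientPres k := by
  obtain ⟨κ, hκ⟩ := hα.exists_homeomorph isTheta_merid
  have hz : (0 : ℝ) ∈ Icc (0 : ℝ) 1 := ⟨le_rfl, zero_le_one⟩
  have hκ0 : κ (α 0 0) = southPole := by rw [hκ 0 0 hz, merid_zero]
  have hp := Real.pi_pos
  have hop : OrientPres ((κ.symm.trans k).trans κ) := by
    have hang : ang 0 < ang 1 ∧ ang 1 < ang 2 ∧ ang 2 < ang 0 + 2 * Real.pi := by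
      rw [ang_zero, ang_one, ang_two]
      refine ⟨?_, ?_, ?_⟩ <;> linarith
    refine orientPres_of_rays (θ := ang) (θ' := ang) (U := κ.symm ⁻¹' U) ?_ hang hang ?_ fun s x hx hxr => ?_
    · rw [Homeomorph.trans_apply, Homeomorph.trans_apply, ← hκ0, κ.symm_apply_apply, h0]
    · refine κ.symm.continuous.continuousAt.preimage_mem_nhds ?_
      rwa [← hκ0, κ.symm_apply_apply]
    · obtain ⟨t, ht, rfl⟩ := exists_merid hxr
      have e : κ.symm (merid (ang s) t) = α s t := by rw [← hκ s t ht, κ.symm_apply_apply]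
      rw [mem_preimage, e] at hx
      obtain ⟨u, hu, hue⟩ := h s t ht hx
      rw [Homeomorph.trans_apply, Homeomorph.trans_apply, e, ← hue, hκ s u hu]
      exact merid_mem_ray hu _
  have := orientPres_conj (k := κ) hop
  have e : (κ.trans ((κ.symm.trans k).trans κ)).trans κ.symm = k := by
    ext1 x
    simp
  rwa [e] at this

/-- A homeomorphism matching two theta curves preserves orientation if its action at one vertex of the
theta curve is that of an orientation preserving homeomorphism. -/
theorem IsTheta.orientPres {α β : Fin 3 → ℝ → Sph} (hα : IsTheta α) {g h : Sph ≃ₜ Sph}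
    (hg : ∀ s, ∀ t ∈ Icc (0 : ℝ) 1, g (α s t) = β s t) (hh : OrientPres h)
    (h0 : h (α 0 0) = β 0 0) {U : Set Sph} (hU : U ∈ 𝓝 (α 0 0))
    (hU' : ∀ s, ∀ t ∈ Icc (0 : ℝ) 1, α s t ∈ U → h (α s t) ∈ β s '' Icc 0 1) : OrientPres g := by
  have hk : OrientPres (h.trans g.symm) := by
    refine orientPres_of_germ hα ?_ hU fun s t ht hts => ?_
    · rw [Homeomorph.trans_apply, h0, ← hg 0 0 ⟨le_rfl, zero_le_one⟩, g.symm_apply_apply]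
    · obtain ⟨u, hu, hue⟩ := hU' s t ht hts
      rw [Homeomorph.trans_apply, ← hue, ← hg s u hu, g.symm_apply_apply]
      exact mem_image_of_mem _ hu
  have := orientPres_trans (orientPres_symm hk) hh
  have e : (h.trans g.symm).symm.trans h = g := by
    ext1 x
    simp
  rwa [e] at this

/-- Concatenation of two arcs. -/
def concat (f g : ℝ → Sph) (t : ℝ) : Sph := if t ≤ 1 / 2 then f (2 * t) else g (2 * t - 1)

section Concat

variable {f g : ℝ → Sph}

theorem concat_left {t : ℝ} (h : t ≤ 1 / 2) : concat f g t = f (2 * t) := if_pos h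

theorem concat_right (hfg : f 1 = g 0) {t : ℝ} (h : 1 / 2 ≤ t) : concat f g t = g (2 * t - 1) := by
  rcases h.eq_or_lt with rfl | h
  · rw [concat_left le_rfl]
    norm_num [hfg]
  · exact if_neg (not_le.2 h)

theorem concat_zero : concat f g 0 = f 0 := by
  rw [concat_left (by norm_num), mul_zero]

theorem concat_one : concat f g 1 = g 1 := by
  rw [concat, if_neg (by norm_num)]
  norm_num

theorem concat_cases {t : ℝ} (ht : t ∈ Icc (0 : ℝ) 1) :
    (t ≤ 1 / 2 ∧ 2 * t ∈ Icc (0 : ℝ) 1 ∧ concat f g t = f (2 * t)) ∨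
      (1 / 2 < t ∧ 2 * t - 1 ∈ Icc (0 : ℝ) 1 ∧ concat f g t = g (2 * t - 1)) := by
  rcases le_or_gt t (1 / 2) with h | h
  · exact Or.inl ⟨h, ⟨by linarith [ht.1], by linarith⟩, concat_left h⟩
  · exact Or.inr ⟨h, ⟨by linarith, by linarith [ht.2]⟩, if_neg (not_le.2 h)⟩

theorem concat_mem {t : ℝ} (ht : t ∈ Icc (0 : ℝ) 1) :
    concat f g t ∈ f '' Icc 0 1 ∪ g '' Icc 0 1 := by
  rcases concat_cases (f := f) (g := g) ht with ⟨-, h, e⟩ | ⟨-, h, e⟩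
  · exact Or.inl ⟨_, h, e.symm⟩
  · exact Or.inr ⟨_, h, e.symm⟩

theorem continuousOn_concat (hf : ContinuousOn f (Icc 0 1)) (hg : ContinuousOn g (Icc 0 1))
    (hfg : f 1 = g 0) : ContinuousOn (concat f g) (Icc 0 1) := by
  have h1 : ContinuousOn (concat f g) (Icc 0 (1 / 2)) := by
    refine ContinuousOn.congr (f := fun t => f (2 * t)) ?_ fun t ht => concat_left ht.2
    exact hf.comp (Continuous.continuousOn (by fun_prop))
      fun t ht => ⟨by linarith [ht.1], by linarith [ht.2]⟩
  have h2 : ContinuousOn (concat f g) (Icc (1 / 2) 1) := by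
    refine ContinuousOn.congr (f := fun t => g (2 * t - 1)) ?_ fun t ht => concat_right hfg ht.1
    exact hg.comp (Continuous.continuousOn (by fun_prop))
      fun t ht => ⟨by linarith [ht.1], by linarith [ht.2]⟩
  rw [← Icc_union_Icc_eq_Icc (a := (0 : ℝ)) (b := 1 / 2) (c := 1) (by norm_num) (by norm_num)]
  exact h1.union_of_isClosed h2 isClosed_Icc isClosed_Icc

theorem injOn_concat (hf : InjOn f (Icc 0 1)) (hg : InjOn g (Icc 0 1))
    (hfg : ∀ x ∈ Icc (0 : ℝ) 1, ∀ y ∈ Icc (0 : ℝ) 1, f x = g y → y = 0) :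
    InjOn (concat f g) (Icc 0 1) := by
  intro x hx y hy h
  rcases concat_cases (f := f) (g := g) hx with ⟨-, h1, e1⟩ | ⟨h0, h1, e1⟩ <;>
    rcases concat_cases (f := f) (g := g) hy with ⟨-, h2, e2⟩ | ⟨h0', h2, e2⟩ <;> rw [e1, e2] at h
  · linarith [hf h1 h2 h]
  · linarith [hfg _ h1 _ h2 h]
  · linarith [hfg _ h2 _ h1 h.symm]
  · linarith [hg h1 h2 h]

end Concat

theorem isTheta_vec {A B C : ℝ → Sph} (cA : ContinuousOn A (Icc 0 1)) (cB : ContinuousOn B (Icc 0 1))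
    (cC : ContinuousOn C (Icc 0 1)) (iA : InjOn A (Icc 0 1)) (iB : InjOn B (Icc 0 1))
    (iC : InjOn C (Icc 0 1)) (zB : B 0 = A 0) (zC : C 0 = A 0) (oB : B 1 = A 1) (oC : C 1 = A 1)
    (hAB : ∀ x ∈ Ioo (0 : ℝ) 1, ∀ y ∈ Ioo (0 : ℝ) 1, A x ≠ B y)
    (hAC : ∀ x ∈ Ioo (0 : ℝ) 1, ∀ y ∈ Ioo (0 : ℝ) 1, A x ≠ C y)
    (hBC : ∀ x ∈ Ioo (0 : ℝ) 1, ∀ y ∈ Ioo (0 : ℝ) 1, B x ≠ C y) : IsTheta ![A, B, C] := by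
  have hz : ∀ s, ![A, B, C] s 0 = A 0 := by
    intro s
    fin_cases s
    exacts [rfl, zB, zC]
  have ho : ∀ s, ![A, B, C] s 1 = A 1 := by
    intro s
    fin_cases s
    exacts [rfl, oB, oC]
  have hi : ∀ s, InjOn (![A, B, C] s) (Icc 0 1) := by
    intro s
    fin_cases s
    exacts [iA, iB, iC]
  have hd : ∀ s t, s ≠ t → ∀ x ∈ Ioo (0 : ℝ) 1, ∀ y ∈ Ioo (0 : ℝ) 1,
      ![A, B, C] s x ≠ ![A, B, C] t y := by
    intro s t hst x hx y hy
    fin_cases s <;> fin_cases t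
    exacts [absurd rfl hst, hAB x hx y hy, hAC x hx y hy, (hAB y hy x hx).symm, absurd rfl hst,
      hBC x hx y hy, (hAC y hy x hx).symm, (hBC y hy x hx).symm, absurd rfl hst]
  have m0 : (0 : ℝ) ∈ Icc (0 : ℝ) 1 := ⟨le_rfl, zero_le_one⟩
  have m1 : (1 : ℝ) ∈ Icc (0 : ℝ) 1 := ⟨zero_le_one, le_rfl⟩
  refine ⟨fun s => ?_, fun s t => (hz s).trans (hz t).symm, fun s t => (ho s).trans (ho t).symm,
    fun s t x hx y hy h => ?_⟩
  · fin_cases s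
    exacts [cA, cB, cC]
  · by_cases hst : s = t
    · subst hst
      exact ⟨hi s hx hy h, Or.inl rfl⟩
    · rcases eq_or_ne x 0 with rfl | hx0
      · rw [(hz s).trans (hz t).symm] at h
        exact ⟨hi t m0 hy h, Or.inr (Or.inl rfl)⟩
      rcases eq_or_ne x 1 with rfl | hx1
      · rw [(ho s).trans (ho t).symm] at h
        exact ⟨hi t m1 hy h, Or.inr (Or.inr rfl)⟩
      rcases eq_or_ne y 0 with rfl | hy0
      · rw [(hz t).trans (hz s).symm] at h
        exact absurd (hi s hx m0 h) hx0
      rcases eq_or_ne y 1 with rfl | hy1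
      · rw [(ho t).trans (ho s).symm] at h
        exact absurd (hi s hx m1 h) hx1
      exact absurd h (hd s t hst x ⟨hx.1.lt_of_ne' hx0, hx.2.lt_of_ne hx1⟩ y
        ⟨hy.1.lt_of_ne' hy0, hy.2.lt_of_ne hy1⟩)

/-- Restricting a homeomorphism to an invariant set whose frontier is fixed. -/
theorem exists_homeomorph_piecewise {X : Type*} [TopologicalSpace X] (g : X ≃ₜ X) {F : Set X}
    (hF : g '' F = F) (hfr : ∀ x ∈ frontier F, g x = x) :
    ∃ k : X ≃ₜ X, (∀ x ∈ F, k x = g x) ∧ ∀ x ∉ F, k x = x := by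
  classical
  have hm : ∀ x ∈ F, g x ∈ F := fun x hx => hF ▸ mem_image_of_mem g hx
  have hm' : ∀ x ∈ F, g.symm x ∈ F := fun x hx => by
    rw [← hF] at hx
    obtain ⟨y, hy, rfl⟩ := hx
    rwa [g.symm_apply_apply]
  refine ⟨⟨⟨F.piecewise g id, F.piecewise g.symm id, fun x => ?_, fun x => ?_⟩, ?_, ?_⟩,
    fun x hx => piecewise_eq_of_mem _ _ _ hx, fun x hx => piecewise_eq_of_notMem _ _ _ hx⟩
  · by_cases hx : x ∈ F
    · rw [piecewise_eq_of_mem F g id hx, piecewise_eq_of_mem _ _ _ (hm x hx), g.symm_apply_apply]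
    · rw [piecewise_eq_of_notMem F g id hx, id, piecewise_eq_of_notMem _ _ _ hx, id]
  · by_cases hx : x ∈ F
    · rw [piecewise_eq_of_mem F g.symm id hx, piecewise_eq_of_mem _ _ _ (hm' x hx), g.apply_symm_apply]
    · rw [piecewise_eq_of_notMem F g.symm id hx, id, piecewise_eq_of_notMem _ _ _ hx, id]
  · exact Continuous.piecewise hfr g.continuous continuous_id
  · exact Continuous.piecewise (fun x hx => by
      rw [g.symm_apply_eq]
      exact (hfr x hx).symm) g.symm.continuous continuous_id

theorem cis_re (t : ℝ) : (cis t).re = Real.cos t := Complex.exp_ofReal_mul_I_re t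
theorem cis_im (t : ℝ) : (cis t).im = Real.sin t := Complex.exp_ofReal_mul_I_im t

theorem cos_two_pi_div_three : Real.cos (2 * Real.pi / 3) = -1 / 2 := by
  rw [show 2 * Real.pi / 3 = Real.pi - Real.pi / 3 by ring, Real.cos_pi_sub, Real.cos_pi_div_three]
  norm_num

theorem cos_ang_sub {s i : Fin 3} (h : s ≠ i) : Real.cos (ang s - ang i) = -1 / 2 := by
  have h1 := cos_two_pi_div_three
  have h2 : Real.cos (4 * Real.pi / 3) = -1 / 2 := by
    rw [show 4 * Real.pi / 3 = 2 * Real.pi - 2 * Real.pi / 3 by ring, Real.cos_two_pi_sub, h1]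
  have key : ∀ s i : Fin 3, s ≠ i → (s = 0 ∧ i = 1) ∨ (s = 0 ∧ i = 2) ∨ (s = 1 ∧ i = 0) ∨
      (s = 1 ∧ i = 2) ∨ (s = 2 ∧ i = 0) ∨ (s = 2 ∧ i = 1) := by decide
  rcases key s i h with ⟨rfl, rfl⟩ | ⟨rfl, rfl⟩ | ⟨rfl, rfl⟩ | ⟨rfl, rfl⟩ | ⟨rfl, rfl⟩ | ⟨rfl, rfl⟩ <;>
    simp only [ang_zero, ang_one, ang_two]
  · rw [zero_sub, Real.cos_neg, h1]
  · rw [zero_sub, Real.cos_neg, h2]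
  · rw [sub_zero, h1]
  · rw [← h1, ← Real.cos_neg]
    ring_nf
  · rw [sub_zero, h2]
  · rw [← h1]
    ring_nf

theorem cis_ang_add (i : Fin 3) : cis (ang i + 2 * Real.pi / 3) = cis (ang (i + 1)) := by
  have h : ∀ i : Fin 3, i = 0 ∨ i = 1 ∨ i = 2 := by decide
  rcases h i with rfl | rfl | rfl
  · rw [show (0 : Fin 3) + 1 = 1 from rfl, ang_zero, ang_one, zero_add]
  · rw [show (1 : Fin 3) + 1 = 2 from rfl, ang_one, ang_two]
    ring_nf
  · rw [show (2 : Fin 3) + 1 = 0 from rfl, ang_two, ang_zero, ← cis_add_two_pi 0]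
    ring_nf

theorem cis_ang_sub (i : Fin 3) : cis (ang i - 2 * Real.pi / 3) = cis (ang (i + 2)) := by
  have h := cis_ang_add (i + 2)
  rw [show i + 2 + 1 = i from by rw [add_assoc]; exact add_zero i] at h
  rw [sub_eq_add_neg, cis_add, ← h, ← cis_add]
  ring_nf

/-- The open sector between two standard meridians. -/
def sector (i : Fin 3) : Set Sph := {x | (zc x * cis (-ang i)).re < -‖zc x‖ / 2}

theorem merid_sector_re (i : Fin 3) {t : ℝ} (ht : t ∈ Icc (0 : ℝ) 1) (ψ : ℝ) :
    (zc (merid ψ t) * cis (-ang i)).re = ‖zc (merid ψ t)‖ * Real.cos (ψ - ang i) := by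
  rw [zc_merid, mul_assoc, ← cis_add, Complex.re_ofReal_mul, cis_re, norm_mul, norm_cis, mul_one,
    Complex.norm_real, Real.norm_of_nonneg (sin_pi_mul_nonneg ht), sub_eq_add_neg]

theorem merid_ang_notMem_sector (i s : Fin 3) {t : ℝ} (ht : t ∈ Icc (0 : ℝ) 1) :
    merid (ang s) t ∉ sector i := by
  intro h
  change (zc (merid (ang s) t) * cis (-ang i)).re < -‖zc (merid (ang s) t)‖ / 2 at h
  rw [merid_sector_re i ht] at h
  have hn := norm_nonneg (zc (merid (ang s) t))
  by_cases hs : s = i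
  · rw [hs, sub_self, Real.cos_zero] at h
    rw [hs] at hn
    linarith
  · rw [cos_ang_sub hs] at h
    linarith

theorem merid_mem_sector (i : Fin 3) {t : ℝ} (ht : t ∈ Ioo (0 : ℝ) 1) {d : ℝ}
    (hd : |d| < Real.pi / 3) : merid (ang i + Real.pi + d) t ∈ sector i := by
  change (zc (merid (ang i + Real.pi + d) t) * cis (-ang i)).re <
    -‖zc (merid (ang i + Real.pi + d) t)‖ / 2
  rw [merid_sector_re i (Ioo_subset_Icc_self ht)]
  have hn : 0 < ‖zc (merid (ang i + Real.pi + d) t)‖ := by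
    rw [zc_merid, norm_mul, norm_cis, mul_one, Complex.norm_real, Real.norm_eq_abs, abs_pos]
    exact (sin_pi_mul_pos ht).ne'
  have h1 : Real.cos (ang i + Real.pi + d - ang i) = -Real.cos |d| := by
    rw [Real.cos_abs, show ang i + Real.pi + d - ang i = d + Real.pi by ring, Real.cos_add_pi]
  have h2 : Real.cos (Real.pi / 3) < Real.cos |d| :=
    Real.cos_lt_cos_of_nonneg_of_le_pi (abs_nonneg d) (by linarith [Real.pi_pos]) hd
  rw [Real.cos_pi_div_three] at h2
  rw [h1]
  nlinarith

theorem mem_cycle_of_re_eq {i : Fin 3} {x : Sph} (h : (zc x * cis (-ang i)).re = -‖zc x‖ / 2) :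
    x ∈ IsTheta.cycle (fun s t => merid (ang s) t) i := by
  set v := zc x * cis (-ang i) with hv
  set r := ‖zc x‖ with hr
  have h1 : ‖v‖ = r := by rw [hv, norm_mul, norm_cis, mul_one]
  have h2 : v.re ^ 2 + v.im ^ 2 = r ^ 2 := by
    rw [← h1, ← Complex.normSq_eq_norm_sq, Complex.normSq_apply]
    ring
  have hs : Real.sin (2 * Real.pi / 3) = √3 / 2 := by
    rw [show 2 * Real.pi / 3 = Real.pi - Real.pi / 3 by ring, Real.sin_pi_sub,
      Real.sin_pi_div_three]
  have h3 : v.im ^ 2 = (r * (√3 / 2)) ^ 2 := by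
    rw [h] at h2
    have := Real.sq_sqrt (show (0 : ℝ) ≤ 3 by norm_num)
    rw [mul_pow, div_pow, this]
    linarith
  have hz : zc x = v * cis (ang i) := by
    rw [hv, mul_assoc, ← cis_add, neg_add_cancel, cis_zero, mul_one]
  have hr0 : 0 ≤ r := norm_nonneg _
  have hc := cos_two_pi_div_three
  rcases sq_eq_sq_iff_eq_or_eq_neg.1 h3 with h4 | h4
  · left
    have h5 : v = r * cis (2 * Real.pi / 3) := by
      apply Complex.ext
      · rw [Complex.re_ofReal_mul, cis_re, hc, h]
        ring
      · rw [Complex.im_ofReal_mul, cis_im, hs, h4]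
    refine exists_merid ⟨r, hr0, ?_⟩
    rw [hz, h5, mul_assoc, ← cis_add, add_comm, cis_ang_add]
  · right
    have h5 : v = r * cis (-(2 * Real.pi / 3)) := by
      apply Complex.ext
      · rw [Complex.re_ofReal_mul, cis_re, Real.cos_neg, hc, h]
        ring
      · rw [Complex.im_ofReal_mul, cis_im, Real.sin_neg, hs, h4]
        ring
    refine exists_merid ⟨r, hr0, ?_⟩
    rw [hz, h5, mul_assoc, ← cis_add, add_comm, ← sub_eq_add_neg, cis_ang_sub]

theorem sector_subset_face (i : Fin 3) :
    sector i ⊆ IsTheta.face (fun s t => merid (ang s) t) i := by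
  set μ : Fin 3 → ℝ → Sph := fun s t => merid (ang s) t with hμ
  have hcyc : ∀ x ∈ sector i, x ∉ IsTheta.cycle μ i := by
    rintro x hx (⟨t, ht, rfl⟩ | ⟨t, ht, rfl⟩)
    exacts [merid_ang_notMem_sector i _ ht hx, merid_ang_notMem_sector i _ ht hx]
  have hcont : Continuous fun x => (zc x * cis (-ang i)).re :=
    Complex.continuous_re.comp (continuous_zc.mul continuous_const)
  have hcont' : Continuous fun x => -‖zc x‖ / 2 := continuous_zc.norm.neg.div_const 2
  have ho : IsOpen (sector i) := isOpen_lt hcont hcont'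
  have ho' : IsOpen {x | -‖zc x‖ / 2 < (zc x * cis (-ang i)).re} := isOpen_lt hcont' hcont
  have hmid : μ i (1 / 2) ∈ {x | -‖zc x‖ / 2 < (zc x * cis (-ang i)).re} := by
    change -‖zc (merid (ang i) (1 / 2))‖ / 2 < (zc (merid (ang i) (1 / 2)) * cis (-ang i)).re
    rw [merid_sector_re i ⟨by norm_num, by norm_num⟩, sub_self, Real.cos_zero, zc_merid, norm_mul,
      norm_cis, mul_one, Complex.norm_real, show Real.pi * (1 / 2) = Real.pi / 2 by ring,
      Real.sin_pi_div_two]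
    norm_num
  have hcov : (IsTheta.cycle μ i)ᶜ ⊆
      {x | -‖zc x‖ / 2 < (zc x * cis (-ang i)).re} ∪ sector i := by
    intro x hx
    rcases lt_trichotomy (zc x * cis (-ang i)).re (-‖zc x‖ / 2) with h | h | h
    exacts [Or.inr h, absurd (mem_cycle_of_re_eq h) hx, Or.inl h]
  have hmc : μ i (1 / 2) ∈ (IsTheta.cycle μ i)ᶜ := isTheta_merid.notMem_cycle IsTheta.half_mem
  have hsub : connectedComponentIn (IsTheta.cycle μ i)ᶜ (μ i (1 / 2)) ⊆
      {x | -‖zc x‖ / 2 < (zc x * cis (-ang i)).re} := by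
    refine IsPreconnected.subset_left_of_subset_union ho' ho ?_
      ((connectedComponentIn_subset _ _).trans hcov)
      ⟨_, mem_connectedComponentIn hmc, hmid⟩ isPreconnected_connectedComponentIn
    rw [Set.disjoint_left]
    intro x hx (hx' : (zc x * cis (-ang i)).re < -‖zc x‖ / 2)
    exact lt_asymm hx hx'
  intro x hx
  refine ⟨hcyc x hx, fun h => ?_⟩
  have h1 := hsub h
  change (zc x * cis (-ang i)).re < -‖zc x‖ / 2 at hx
  exact lt_asymm h1 hx

/-- A simple arc from a point of a theta curve through a face back to the theta curve can be
straightened simultaneously with the theta curve. -/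
theorem exists_straighten_merid {γ : ℝ → Sph} (hγ : ContinuousOn γ (Icc 0 1))
    (hi : InjOn γ (Icc 0 1)) (h0 : γ 0 = southPole)
    (hd : ∀ y ∈ Ioo (0 : ℝ) 1, ∀ s : Fin 3, ∀ t ∈ Icc (0 : ℝ) 1, γ y ≠ merid (ang s) t)
    {s : Fin 3} {q : ℝ} (hq : q ∈ Ioo (0 : ℝ) 1) (h1 : γ 1 = merid (ang s) q) :
    ∃ k : Sph ≃ₜ Sph, (∀ s : Fin 3, ∀ t ∈ Icc (0 : ℝ) 1, k (merid (ang s) t) = merid (ang s) t) ∧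
      ∃ i : Fin 3, ∀ t ∈ Icc (0 : ℝ) (1 / 2), k (γ t) = merid (ang i + Real.pi) t := by
  set μ : Fin 3 → ℝ → Sph := fun s t => merid (ang s) t with hμ
  have hμT : IsTheta μ := isTheta_merid
  have hpi := Real.pi_pos
  have hq' := hq
  obtain ⟨hq0, hq1⟩ := hq'
  have hhalf : (1 / 2 : ℝ) ∈ Ioo (0 : ℝ) 1 := by norm_num
  obtain ⟨i, hii⟩ := hμT.exists_face (z := γ (1 / 2)) fun j t ht => hd _ hhalf j t ht
  have hγface : ∀ y ∈ Ioo (0 : ℝ) 1, γ y ∈ IsTheta.face μ i := by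
    have hc : IsPreconnected (γ '' Ioo 0 1) :=
      isPreconnected_Ioo.image _ (hγ.mono Ioo_subset_Icc_self)
    intro y hy
    rw [hμT.face_eq hii]
    refine hc.subset_connectedComponentIn (mem_image_of_mem _ hhalf) ?_ (mem_image_of_mem _ hy)
    rintro _ ⟨x, hx, rfl⟩ (⟨t, ht, e⟩ | ⟨t, ht, e⟩)
    exacts [hd x hx _ t ht e.symm, hd x hx _ t ht e.symm]
  have hsi : s ≠ i := by
    rintro rfl
    have hcl : γ 1 ∈ closure (IsTheta.face μ s) := by
      have h2 : γ 1 ∈ γ '' closure (Ioo 0 1) :=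
        ⟨1, by rw [closure_Ioo zero_ne_one]; exact ⟨zero_le_one, le_rfl⟩, rfl⟩
      have h3 : ContinuousOn γ (closure (Ioo 0 1)) := by rwa [closure_Ioo zero_ne_one]
      exact closure_mono (image_subset_iff.2 hγface) (h3.image_closure h2)
    have hfr : γ 1 ∈ frontier (IsTheta.face μ s) := by
      rw [frontier, (hμT.isOpen_face s).interior_eq]
      refine ⟨hcl, ?_⟩
      rw [h1]
      exact hμT.notMem_face s s (Ioo_subset_Icc_self hq)
    have := hμT.frontier_face_subset s hfr
    rw [h1] at this
    exact hμT.notMem_cycle hq this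
  obtain ⟨d, hdabs, hdcis⟩ : ∃ d : ℝ, |d| = Real.pi / 3 ∧ cis (ang i + Real.pi + d) = cis (ang s) := by
    rcases IsTheta.eq_or_eq i s with h | rfl | rfl
    · exact absurd h hsi
    · refine ⟨-(Real.pi / 3), by rw [abs_neg, abs_of_pos (by positivity)], ?_⟩
      rw [← cis_ang_add]
      ring_nf
    · refine ⟨Real.pi / 3, abs_of_pos (by positivity), ?_⟩
      rw [← cis_ang_sub, ← cis_add_two_pi (ang i - 2 * Real.pi / 3)]
      ring_nf
  obtain ⟨s', hs's, hs'⟩ : ∃ s' : Fin 3, s' ≠ s ∧ ({s, s'} : Set (Fin 3)) = {i + 1, i + 2} := by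
    rcases IsTheta.eq_or_eq i s with h | rfl | rfl
    · exact absurd h hsi
    · exact ⟨i + 2, (IsTheta.add_one_ne_add_two i).symm, rfl⟩
    · exact ⟨i + 1, IsTheta.add_one_ne_add_two i, pair_comm _ _⟩
  have mm : ∀ {t : ℝ}, t ∈ Icc (0 : ℝ) 1 → q * t ∈ Icc (0 : ℝ) 1 := fun {t} ht =>
    ⟨by nlinarith [ht.1], by nlinarith [ht.1, ht.2]⟩
  have mm' : ∀ {t : ℝ}, t ∈ Icc (0 : ℝ) 1 → 1 - t * (1 - q) ∈ Icc (0 : ℝ) 1 := fun {t} ht =>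
    ⟨by nlinarith [ht.1, ht.2], by nlinarith [ht.1, ht.2]⟩
  set A : ℝ → Sph := fun t => μ s (q * t) with hA
  set B : ℝ → Sph := concat (μ s') (fun t => μ s (1 - t * (1 - q))) with hB
  have hB1 : μ s' 1 = (fun t => μ s (1 - t * (1 - q))) 0 := by
    simp only [zero_mul, sub_zero]
    exact hμT.one _ _
  have hinj : ∀ s s', ∀ t ∈ Icc (0 : ℝ) 1, ∀ t' ∈ Icc (0 : ℝ) 1, μ s t = μ s' t' →
    t = t' ∧ (s = s' ∨ t = 0 ∨ t = 1) := hμT.inj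
  have build : ∀ {c : ℝ → Sph}, ContinuousOn c (Icc 0 1) → InjOn c (Icc 0 1) → c 0 = southPole →
      c 1 = μ s q → (∀ y ∈ Ioo (0 : ℝ) 1, ∀ s, ∀ t ∈ Icc (0 : ℝ) 1, c y ≠ μ s t) →
      IsTheta ![A, B, c] := by
    intro c hc hci hc0 hc1 hcd
    refine isTheta_vec ?_ ?_ hc ?_ ?_ hci ?_ ?_ ?_ ?_ ?_ ?_ ?_
    · exact (continuous_merid continuous_const (by fun_prop)).continuousOn
    · exact continuousOn_concat (hμT.cont s')
        (continuous_merid continuous_const (by fun_prop)).continuousOn hB1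
    · intro x hx y hy h
      exact mul_left_cancel₀ hq0.ne' (hinj s s _ (mm hx) _ (mm hy) h).1
    · refine injOn_concat (fun x hx y hy h => (hinj s' s' x hx y hy h).1) ?_ ?_
      · intro x hx y hy h
        have := (hinj s s _ (mm' hx) _ (mm' hy) h).1
        exact mul_right_cancel₀ (sub_pos.2 hq1).ne' (by linarith)
      · intro x hx y hy h
        obtain ⟨h2, h3⟩ := hinj s' s x hx _ (mm' hy) h
        rcases h3 with h3 | h3 | h3
        · exact absurd h3 hs's
        · exfalso
          nlinarith [hy.2, hy.1]
        · have : y * (1 - q) = 0 := by linarith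
          exact (mul_eq_zero.1 this).resolve_right (sub_pos.2 hq1).ne'
    · simp only [hB, hA, concat_zero, mul_zero]
      exact hμT.zero _ _
    · simp only [hA, mul_zero, hc0]
      exact (merid_zero _).symm
    · simp only [hB, hA, concat_one, mul_one, one_mul, sub_sub_cancel]
    · simp only [hA, mul_one, hc1]
    · intro x hx y hy h
      have hy' := Ioo_subset_Icc_self hy
      have hqx : 0 < q * x := mul_pos hq0 hx.1
      have hqx' : q * x < q := mul_lt_of_lt_one_right hq0 hx.2
      rcases concat_cases (f := μ s') (g := fun t => μ s (1 - t * (1 - q))) hy' with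
        ⟨h2, h3, e⟩ | ⟨h2, h3, e⟩
      · rw [hB, e] at h
        obtain ⟨h4, h5⟩ := hinj s s' _ (mm (Ioo_subset_Icc_self hx)) _ h3 h
        rcases h5 with h5 | h5 | h5
        exacts [hs's h5.symm, hqx.ne' h5, by linarith]
      · rw [hB, e] at h
        have h4 := (hinj s s _ (mm (Ioo_subset_Icc_self hx)) _ (mm' h3) h).1
        nlinarith [h3.2]
    · intro x hx y hy h
      exact hcd y hy s _ (mm (Ioo_subset_Icc_self hx)) h.symm
    · intro x hx y hy h
      rcases concat_mem (f := μ s') (g := fun t => μ s (1 - t * (1 - q)))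
        (Ioo_subset_Icc_self hx) with ⟨t, ht, e⟩ | ⟨t, ht, e⟩
      · exact hcd y hy s' t ht (h.symm.trans e.symm)
      · exact hcd y hy s _ (mm' ht) (h.symm.trans e.symm)
  set ψ := ang i + Real.pi with hψ
  set g₁ : ℝ → Sph := fun t => merid ψ (t / 2) with hg₁
  set g₂ : ℝ → Sph := fun t => merid (ψ + t * d) (1 / 2 + t * (q - 1 / 2)) with hg₂
  have hg12 : g₁ 1 = g₂ 0 := by simp [hg₁, hg₂]
  have mh : ∀ {t : ℝ}, t ∈ Icc (0 : ℝ) 1 → 1 / 2 + t * (q - 1 / 2) ∈ Ioo (0 : ℝ) 1 := fun {t} ht =>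
    ⟨by nlinarith [ht.1, ht.2], by nlinarith [ht.1, ht.2]⟩
  have mh' : ∀ {t : ℝ}, t ∈ Icc (0 : ℝ) 1 → t / 2 ∈ Icc (0 : ℝ) 1 := fun {t} ht =>
    ⟨by linarith [ht.1], by linarith [ht.2]⟩
  have hd0 : d ≠ 0 := by
    rintro rfl
    rw [abs_zero] at hdabs
    linarith
  have habs : ∀ {t : ℝ}, t ∈ Icc (0 : ℝ) 1 → |t * d| ≤ Real.pi / 3 := fun {t} ht => by
    rw [abs_mul, hdabs, abs_of_nonneg ht.1]
    exact mul_le_of_le_one_left (by positivity) ht.2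
  have hg2i : ∀ {x y : ℝ}, x ∈ Icc (0 : ℝ) 1 → y ∈ Icc (0 : ℝ) 1 →
      cis (ψ + x * d) = cis (ψ + y * d) → x = y := fun {x y} hx hy h => by
    refine mul_right_cancel₀ hd0 (add_left_cancel (cis_inj_of_abs h ?_))
    rw [add_sub_add_left_eq_sub]
    have h1 := abs_le.1 (habs hx)
    have h2 := abs_le.1 (habs hy)
    rw [abs_lt]
    constructor <;> linarith [h1.1, h1.2, h2.1, h2.2]
  have hsec : ∀ y ∈ Ioo (0 : ℝ) 1, concat g₁ g₂ y ∈ sector i := by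
    intro y hy
    rcases concat_cases (f := g₁) (g := g₂) (Ioo_subset_Icc_self hy) with ⟨h2, h3, e⟩ | ⟨h2, h3, e⟩
    · rw [e]
      have := merid_mem_sector i (t := 2 * y / 2) ⟨by linarith [hy.1], by linarith⟩ (d := 0)
        (by rw [abs_zero]; positivity)
      rwa [add_zero] at this
    · rw [e]
      refine merid_mem_sector i (mh h3) ?_
      rw [abs_mul, hdabs, abs_of_nonneg h3.1]
      exact mul_lt_of_lt_one_left (by positivity) (by linarith [hy.2])
  have T1 : IsTheta ![A, B, γ] := build hγ hi h0 h1 hd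
  have T2 : IsTheta ![A, B, concat g₁ g₂] := by
    refine build ?_ ?_ ?_ ?_ ?_
    · exact continuousOn_concat (continuous_merid continuous_const (by fun_prop)).continuousOn
        (continuous_merid (by fun_prop) (by fun_prop)).continuousOn hg12
    · refine injOn_concat ?_ ?_ ?_
      · intro x hx y hy h
        linarith [hgt_merid_inj (mh' hx) (mh' hy) h]
      · intro x hx y hy h
        exact hg2i hx hy (cis_eq_of_merid_eq (mh hx) (Ioo_subset_Icc_self (mh hy)) h)
      · intro x hx y hy h
        have h2 := cis_eq_of_merid_eq (mh hy) (mh' hx) h.symm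
        refine hg2i hy ⟨le_rfl, zero_le_one⟩ ?_
        rw [h2, zero_mul, add_zero]
    · rw [concat_zero]
      simp only [hg₁, zero_div, merid_zero]
    · rw [concat_one]
      simp only [hg₂, hμ]
      refine sph_ext ?_ ?_
      · rw [zc_merid, zc_merid, one_mul, one_mul, hψ, hdcis]
        ring_nf
      · rw [hgt_merid, hgt_merid]
        ring_nf
    · intro y hy s t ht h
      have h2 := hsec y hy
      rw [h] at h2
      exact merid_ang_notMem_sector i s ht h2
  obtain ⟨g, hg⟩ := T1.exists_homeomorph T2
  have hgA : ∀ t ∈ Icc (0 : ℝ) 1, g (A t) = A t := hg 0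
  have hgB : ∀ t ∈ Icc (0 : ℝ) 1, g (B t) = B t := hg 1
  have hgC : ∀ t ∈ Icc (0 : ℝ) 1, g (γ t) = concat g₁ g₂ t := hg 2
  have hfixs : ∀ t ∈ Icc (0 : ℝ) 1, g (μ s t) = μ s t := by
    intro t ht
    rcases le_total t q with h | h
    · have := hgA (t / q) ⟨div_nonneg ht.1 hq0.le, (div_le_one hq0).2 h⟩
      simp only [hA] at this
      rwa [mul_div_cancel₀ _ hq0.ne'] at this
    · have h2 : 0 < 1 - q := sub_pos.2 hq1
      have h3 : (1 - t) / (1 - q) ∈ Icc (0 : ℝ) 1 :=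
        ⟨div_nonneg (by linarith [ht.2]) h2.le, (div_le_one h2).2 (by linarith)⟩
      have h4 : ((1 - t) / (1 - q) + 1) / 2 ∈ Icc (0 : ℝ) 1 :=
        ⟨by linarith [h3.1], by linarith [h3.2]⟩
      have h5 : B (((1 - t) / (1 - q) + 1) / 2) = μ s t := by
        rw [hB, concat_right hB1 (by linarith [h3.1])]
        have h6 : 2 * (((1 - t) / (1 - q) + 1) / 2) - 1 = (1 - t) / (1 - q) := by ring
        rw [h6, div_mul_cancel₀ _ h2.ne', sub_sub_cancel]
      rw [← h5, hgB _ h4]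
  have hfixs' : ∀ t ∈ Icc (0 : ℝ) 1, g (μ s' t) = μ s' t := by
    intro t ht
    have h5 : B (t / 2) = μ s' t := by
      rw [hB, concat_left (by linarith [ht.2])]
      ring_nf
    rw [← h5, hgB _ ⟨by linarith [ht.1], by linarith [ht.2]⟩]
  have hfix : ∀ x ∈ IsTheta.cycle μ i, g x = x := by
    have hmem : ∀ j, j ∈ ({i + 1, i + 2} : Set (Fin 3)) → ∀ t ∈ Icc (0 : ℝ) 1, g (μ j t) = μ j t := by
      rw [← hs']
      rintro j (rfl | rfl)
      exacts [hfixs, hfixs']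
    rintro x (⟨t, ht, rfl⟩ | ⟨t, ht, rfl⟩)
    exacts [hmem _ (Or.inl rfl) t ht, hmem _ (Or.inr rfl) t ht]
  have hcyc : g '' IsTheta.cycle μ i = IsTheta.cycle μ i := by
    rw [image_congr hfix, image_id']
  have hface : g '' IsTheta.face μ i = IsTheta.face μ i := by
    have h2 : γ (1 / 2) ∈ (IsTheta.cycle μ i)ᶜ := hii.1
    rw [hμT.face_eq hii, Homeomorph.image_connectedComponentIn g h2, image_compl_eq g.bijective,
      hcyc, hgC _ (Ioo_subset_Icc_self hhalf),
      ← hμT.face_eq (sector_subset_face i (hsec _ hhalf)), hμT.face_eq hii]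
  obtain ⟨k, hk1, hk2⟩ := exists_homeomorph_piecewise g hface
    fun x hx => hfix x (hμT.frontier_face_subset i hx)
  refine ⟨k, fun j t ht => hk2 _ (hμT.notMem_face i j ht), i, fun t ht => ?_⟩
  rcases ht.1.eq_or_lt with rfl | ht0
  · rw [h0, merid_zero, ← merid_zero (ang 0)]
    exact hk2 _ (hμT.notMem_face i 0 ⟨le_rfl, zero_le_one⟩)
  · have ht1 : t ∈ Ioo (0 : ℝ) 1 := ⟨ht0, by linarith [ht.2]⟩
    rw [hk1 _ (hγface t ht1), hgC t (Ioo_subset_Icc_self ht1), concat_left ht.2]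
    simp only [hg₁, hψ]
    rw [mul_div_cancel_left₀ _ two_ne_zero]

/-- A simple arc from the initial point of a theta curve through a face back to the theta curve can
be straightened simultaneously with the theta curve. -/
theorem IsTheta.exists_straighten {α : Fin 3 → ℝ → Sph} (hα : IsTheta α) {γ : ℝ → Sph}
    (hγ : ContinuousOn γ (Icc 0 1)) (hi : InjOn γ (Icc 0 1)) (h0 : γ 0 = α 0 0)
    (hd : ∀ y ∈ Ioo (0 : ℝ) 1, ∀ s : Fin 3, ∀ t ∈ Icc (0 : ℝ) 1, γ y ≠ α s t)
    {s : Fin 3} {q : ℝ} (hq : q ∈ Ioo (0 : ℝ) 1) (h1 : γ 1 = α s q) :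
    ∃ k : Sph ≃ₜ Sph, (∀ s : Fin 3, ∀ t ∈ Icc (0 : ℝ) 1, k (α s t) = merid (ang s) t) ∧
      ∃ i : Fin 3, ∀ t ∈ Icc (0 : ℝ) (1 / 2), k (γ t) = merid (ang i + Real.pi) t := by
  obtain ⟨g, hg⟩ := hα.exists_homeomorph isTheta_merid
  obtain ⟨k, hk, i, hki⟩ := exists_straighten_merid (γ := fun t => g (γ t))
    (g.continuous.comp_continuousOn hγ) (fun x hx y hy h => hi hx hy (g.injective h))
    (by rw [h0, hg 0 0 ⟨le_rfl, zero_le_one⟩, merid_zero])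
    (fun y hy s t ht h => hd y hy s t ht (g.injective (h.trans (hg s t ht).symm))) hq
    (by rw [h1, hg s q (Ioo_subset_Icc_self hq)])
  refine ⟨g.trans k, fun s t ht => ?_, i, hki⟩
  rw [Homeomorph.trans_apply, hg s t ht, hk s t ht]

/-- Two of the four half-edges at a crossing belong to different edges. -/
abbrev Crosswise (a b : Fin 4) : Prop := a.val / 2 ≠ b.val / 2

theorem Crosswise.ne {a b : Fin 4} (h : Crosswise a b) : a ≠ b := fun hab => h (by rw [hab])

/-- The four half-edges `x a` at a crossing, together with the four further edges `e a b` joining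
end points of the two crossing edges. -/
structure CrossStar (x : Fin 4 → ℝ → Sph) (e : Fin 4 → Fin 4 → ℝ → Sph) : Prop where
  cont : ∀ a, ContinuousOn (x a) (Icc 0 1)
  zero : ∀ a b, x a 0 = x b 0
  inj : ∀ a b, ∀ t ∈ Icc (0 : ℝ) 1, ∀ u ∈ Icc (0 : ℝ) 1, x a t = x b u → t = u ∧ (a = b ∨ t = 0)
  edge_cont : ∀ a b, Crosswise a b → ContinuousOn (e a b) (Icc 0 1)
  edge_inj : ∀ a b, Crosswise a b → InjOn (e a b) (Icc 0 1)
  edge_zero : ∀ a b, Crosswise a b → e a b 0 = x a 1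
  edge_symm : ∀ a b, Crosswise a b → ∀ t, e b a t = e a b (1 - t)
  edge_half : ∀ a b c, Crosswise a b → ∀ t ∈ Icc (0 : ℝ) 1, ∀ u ∈ Icc (0 : ℝ) 1,
    e a b t = x c u → u = 1 ∧ (c = a ∧ t = 0 ∨ c = b ∧ t = 1)
  edge_edge : ∀ a b c, Crosswise a b → Crosswise a c → b ≠ c → ∀ t ∈ Icc (0 : ℝ) 1,
    ∀ u ∈ Icc (0 : ℝ) 1, e a b t = e a c u → t = 0 ∧ u = 0

theorem one_sub_mem {t : ℝ} (ht : t ∈ Icc (0 : ℝ) 1) : 1 - t ∈ Icc (0 : ℝ) 1 :=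
  ⟨by linarith [ht.2], by linarith [ht.1]⟩

theorem IsTheta.reverse {α : Fin 3 → ℝ → Sph} (h : IsTheta α) :
    IsTheta fun s t => α s (1 - t) where
  cont s := (h.cont s).comp (by fun_prop) fun _ => one_sub_mem
  zero s t := by simpa using h.one s t
  one s t := by simpa using h.zero s t
  inj s t u hu v hv huv := by
    obtain ⟨h1, h2⟩ := h.inj s t _ (one_sub_mem hu) _ (one_sub_mem hv) huv
    refine ⟨by linarith, h2.imp_right fun h2 => ?_⟩
    rcases h2 with h2 | h2
    exacts [Or.inr (by linarith), Or.inl (by linarith)]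

namespace CrossStar

variable {x y : Fin 4 → ℝ → Sph} {e f : Fin 4 → Fin 4 → ℝ → Sph} {a b c : Fin 4}

theorem injOn (h : CrossStar x e) (a : Fin 4) : InjOn (x a) (Icc 0 1) :=
  fun t ht u hu htu => (h.inj a a t ht u hu htu).1

theorem edge_one (h : CrossStar x e) (hab : Crosswise a b) : e a b 1 = x b 1 := by
  rw [h.edge_symm b a hab.symm, sub_self, h.edge_zero b a hab.symm]

/-- The half-edge `x a` and the two paths from the crossing through `b` and `c` to the end of
`x a`. -/
def tri (x : Fin 4 → ℝ → Sph) (e : Fin 4 → Fin 4 → ℝ → Sph) (a b c : Fin 4) : Fin 3 → ℝ → Sph :=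
  ![x a, concat (x b) (e b a), concat (x c) (e c a)]

theorem half_ne_path (h : CrossStar x e) (hab : Crosswise a b) {t u : ℝ} (ht : t ∈ Ioo (0 : ℝ) 1)
    (hu : u ∈ Ioo (0 : ℝ) 1) : x a t ≠ concat (x b) (e b a) u := by
  intro heq
  rcases concat_cases (f := x b) (g := e b a) (Ioo_subset_Icc_self hu) with ⟨h1, h2, h3⟩ | ⟨h1, h2, h3⟩
  · obtain ⟨h4, h5 | h5⟩ := h.inj a b t (Ioo_subset_Icc_self ht) _ h2 (heq.trans h3)
    exacts [hab.ne h5, ht.1.ne' h5]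
  · exact ht.2.ne (h.edge_half b a a hab.symm _ h2 t (Ioo_subset_Icc_self ht) (heq.trans h3).symm).1

theorem half_ne_edge (h : CrossStar x e) (hac : Crosswise a c) (hab : Crosswise a b) (hbc : b ≠ c)
    {t u : ℝ} (ht : t ∈ Icc (0 : ℝ) 1) (hu : u ∈ Icc (0 : ℝ) 1) : x b t ≠ e c a u := by
  intro heq
  obtain ⟨-, ⟨h5, -⟩ | ⟨h5, -⟩⟩ := h.edge_half c a b hac.symm u hu t ht heq.symm
  exacts [hbc h5, hab.ne h5.symm]

theorem path_ne_path (h : CrossStar x e) (hab : Crosswise a b) (hac : Crosswise a c) (hbc : b ≠ c)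
    {t u : ℝ} (ht : t ∈ Ioo (0 : ℝ) 1) (hu : u ∈ Ioo (0 : ℝ) 1) :
    concat (x b) (e b a) t ≠ concat (x c) (e c a) u := by
  intro heq
  rcases concat_cases (f := x b) (g := e b a) (Ioo_subset_Icc_self ht) with ⟨h1, h2, h3⟩ | ⟨h1, h2, h3⟩ <;>
    rcases concat_cases (f := x c) (g := e c a) (Ioo_subset_Icc_self hu) with
      ⟨k1, k2, k3⟩ | ⟨k1, k2, k3⟩ <;> rw [h3, k3] at heq
  · obtain ⟨-, h5 | h5⟩ := h.inj b c _ h2 _ k2 heq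
    exacts [hbc h5, by linarith [ht.1]]
  · exact h.half_ne_edge hac hab hbc h2 k2 heq
  · exact h.half_ne_edge hab hac hbc.symm k2 h2 heq.symm
  · rw [h.edge_symm a b hab, h.edge_symm a c hac] at heq
    linarith [(h.edge_edge a b c hab hac hbc _ (one_sub_mem h2) _ (one_sub_mem k2) heq).1, ht.2]

theorem continuousOn_path (h : CrossStar x e) (hab : Crosswise a b) :
    ContinuousOn (concat (x b) (e b a)) (Icc 0 1) :=
  continuousOn_concat (h.cont b) (h.edge_cont b a hab.symm) (h.edge_zero b a hab.symm).symm

theorem injOn_path (h : CrossStar x e) (hab : Crosswise a b) : InjOn (concat (x b) (e b a)) (Icc 0 1) := by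
  refine injOn_concat (h.injOn b) (h.edge_inj b a hab.symm) fun t ht u hu heq => ?_
  obtain ⟨-, ⟨-, h5⟩ | ⟨h5, -⟩⟩ := h.edge_half b a b hab.symm u hu t ht heq.symm
  exacts [h5, absurd h5.symm hab.ne]

theorem isTheta_tri (h : CrossStar x e) (hab : Crosswise a b) (hac : Crosswise a c) (hbc : b ≠ c) :
    IsTheta (tri x e a b c) :=
  isTheta_vec (h.cont a) (h.continuousOn_path hab) (h.continuousOn_path hac) (h.injOn a)
    (h.injOn_path hab) (h.injOn_path hac) (by rw [concat_zero, h.zero]) (by rw [concat_zero, h.zero])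
    (by rw [concat_one, h.edge_one hab.symm]) (by rw [concat_one, h.edge_one hac.symm])
    (fun _ ht _ hu => h.half_ne_path hab ht hu) (fun _ ht _ hu => h.half_ne_path hac ht hu)
    fun _ ht _ hu => h.path_ne_path hab hac hbc ht hu

/-- Two stars have the same germs of edges at the end of the half-edge `a`, up to an orientation
preserving homeomorphism. -/
def SameGerm (x y : Fin 4 → ℝ → Sph) (e f : Fin 4 → Fin 4 → ℝ → Sph) (a : Fin 4) : Prop :=
  ∃ h : Sph ≃ₜ Sph, OrientPres h ∧ h (x a 1) = y a 1 ∧ ∃ U ∈ 𝓝 (x a 1),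
    (∀ t ∈ Icc (0 : ℝ) 1, x a t ∈ U → ∃ b, h (x a t) ∈ y b '' Icc 0 1) ∧
    ∀ b, Crosswise a b → ∀ t ∈ Icc (0 : ℝ) 1, e a b t ∈ U → h (e a b t) ∈ f a b '' Icc 0 1

theorem compl_halves_mem_nhds (h : CrossStar x e) (a : Fin 4) :
    (⋃ b ∈ {b | b ≠ a}, x b '' Icc 0 1)ᶜ ∈ 𝓝 (x a 1) := by
  refine IsOpen.mem_nhds (IsClosed.isOpen_compl (self := ?_)) ?_
  · exact (Set.toFinite _).isClosed_biUnion fun b _ =>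
      (isCompact_Icc.image_of_continuousOn (h.cont b)).isClosed
  · simp only [mem_compl_iff, mem_iUnion, not_exists]
    rintro b hb ⟨t, ht, hxt⟩
    obtain ⟨h1, h2 | h2⟩ := h.inj b a t ht 1 ⟨zero_le_one, le_rfl⟩ hxt
    exacts [hb h2, by linarith]

theorem orientPres_of_tri (h : CrossStar x e) (h' : CrossStar y f) (hr : SameGerm x y e f a)
    (hab : Crosswise a b) (hac : Crosswise a c) (hbc : b ≠ c) {g : Sph ≃ₜ Sph}
    (hg : ∀ s, ∀ t ∈ Icc (0 : ℝ) 1, g (tri x e a b c s t) = tri y f a b c s t) : OrientPres g := by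
  obtain ⟨k, hk, hk0, U, hU, hUa, hUe⟩ := hr
  have hxa : tri x e a b c 0 (1 - 0) = x a 1 := by rw [sub_zero]; rfl
  have hya : tri y f a b c 0 (1 - 0) = y a 1 := by rw [sub_zero]; rfl
  have hV := h.compl_halves_mem_nhds a
  have hW : k ⁻¹' (⋃ b ∈ {b | b ≠ a}, y b '' Icc 0 1)ᶜ ∈ 𝓝 (x a 1) :=
    k.continuous.continuousAt.preimage_mem_nhds (by rw [hk0]; exact h'.compl_halves_mem_nhds a)
  have hpath : ∀ d, Crosswise a d → ∀ t ∈ Icc (0 : ℝ) 1, concat (x d) (e d a) (1 - t) ∈ U →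
      concat (x d) (e d a) (1 - t) ∈ (⋃ b ∈ {b | b ≠ a}, x b '' Icc 0 1)ᶜ →
      k (concat (x d) (e d a) (1 - t)) ∈ (fun t => concat (y d) (f d a) (1 - t)) '' Icc 0 1 := by
    intro d had t ht htU htV
    rcases concat_cases (f := x d) (g := e d a) (one_sub_mem ht) with ⟨-, h2, h3⟩ | ⟨-, h2, h3⟩
    · rw [h3] at htV
      exact absurd (mem_biUnion (show d ∈ {b | b ≠ a} from had.ne.symm) (mem_image_of_mem _ h2)) htV
    · rw [h3, h.edge_symm a d had] at htU ⊢
      obtain ⟨u, hu, hu'⟩ := hUe d had _ (one_sub_mem h2) htU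
      refine ⟨u / 2, ⟨by linarith [hu.1], by linarith [hu.2]⟩, ?_⟩
      simp only
      rw [concat_right (h'.edge_zero d a had.symm).symm (by linarith [hu.2]),
        h'.edge_symm a d had, ← hu']
      ring_nf
  refine (h.isTheta_tri hab hac hbc).reverse.orientPres (β := fun s t => tri y f a b c s (1 - t))
    (fun s t ht => hg s _ (one_sub_mem ht)) hk (by rw [hxa, hya, hk0])
    (U := U ∩ ((⋃ b ∈ {b | b ≠ a}, x b '' Icc 0 1)ᶜ ∩
      k ⁻¹' (⋃ b ∈ {b | b ≠ a}, y b '' Icc 0 1)ᶜ)) ?_ ?_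
  · rw [hxa]
    exact inter_mem hU (inter_mem hV hW)
  · intro s t ht hmem
    obtain ⟨htU, htV, htW⟩ := hmem
    fin_cases s
    · obtain ⟨d, u, hu, hu'⟩ := hUa _ (one_sub_mem ht) htU
      by_cases hda : d = a
      · subst hda
        refine ⟨1 - u, one_sub_mem hu, ?_⟩
        simp only [sub_sub_cancel]
        exact hu'
      · have hd := mem_image_of_mem (y d) hu
        rw [hu'] at hd
        exact absurd (mem_biUnion (show d ∈ {b | b ≠ a} from hda) hd) htW
    · exact hpath b hab t ht htU htV
    · exact hpath c hac t ht htU htV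

theorem exists_homeomorph_tri (h : CrossStar x e) (h' : CrossStar y f) (hr : SameGerm x y e f a)
    (hab : Crosswise a b) (hac : Crosswise a c) (hbc : b ≠ c) : ∃ g : Sph ≃ₜ Sph, OrientPres g ∧
      ∀ d, d = a ∨ d = b ∨ d = c → ∀ t ∈ Icc (0 : ℝ) 1, g (x d t) = y d t := by
  obtain ⟨g, hg⟩ := (h.isTheta_tri hab hac hbc).exists_homeomorph (h'.isTheta_tri hab hac hbc)
  have hpath : ∀ t ∈ Icc (0 : ℝ) 1, t / 2 ∈ Icc (0 : ℝ) 1 := fun t ht =>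
    ⟨by linarith [ht.1], by linarith [ht.2]⟩
  have hleft : ∀ (p q : ℝ → Sph), ∀ t ∈ Icc (0 : ℝ) 1, concat p q (t / 2) = p t := by
    intro p q t ht
    rw [concat_left (by linarith [ht.2]), mul_div_cancel₀ _ two_ne_zero]
  refine ⟨g, h.orientPres_of_tri h' hr hab hac hbc hg, ?_⟩
  rintro d (rfl | rfl | rfl) t ht
  · exact hg 0 t ht
  · rw [← hleft (x d) (e d a) t ht, ← hleft (y d) (f d a) t ht]
    exact hg 1 _ (hpath t ht)
  · rw [← hleft (x d) (e d a) t ht, ← hleft (y d) (f d a) t ht]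
    exact hg 2 _ (hpath t ht)

end CrossStar

namespace CrossStar

variable {x y : Fin 4 → ℝ → Sph} {e f : Fin 4 → Fin 4 → ℝ → Sph}

theorem exists_first_hit (h : CrossStar x e) : ∃ τ ∈ Ioc (0 : ℝ) 1,
    (e 1 2 τ ∈ insert (x 2 1) (e 3 0 '' Icc 0 1)) ∧
      ∀ t ∈ Ico 0 τ, e 1 2 t ∉ insert (x 2 1) (e 3 0 '' Icc 0 1) := by
  have h12 : Crosswise 1 2 := by decide
  have h30 : Crosswise 3 0 := by decide
  have hK : IsClosed (insert (x 2 1) (e 3 0 '' Icc 0 1)) := by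
    rw [insert_eq]
    exact isClosed_singleton.union
      (isCompact_Icc.image_of_continuousOn (h.edge_cont 3 0 h30)).isClosed
  have hS : IsCompact (Icc (0 : ℝ) 1 ∩ e 1 2 ⁻¹' insert (x 2 1) (e 3 0 '' Icc 0 1)) :=
    isCompact_Icc.of_isClosed_subset
      ((h.edge_cont 1 2 h12).preimage_isClosed_of_isClosed isClosed_Icc hK) inter_subset_left
  obtain ⟨τ, ⟨hτ, hτK⟩, hmin⟩ := hS.exists_isLeast
    ⟨1, ⟨zero_le_one, le_rfl⟩, Or.inl (h.edge_one h12)⟩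
  refine ⟨τ, ⟨hτ.1.lt_of_ne ?_, hτ.2⟩, hτK, fun t ht htK =>
    absurd (hmin ⟨⟨ht.1, ht.2.le.trans hτ.2⟩, htK⟩) (not_le.2 ht.2)⟩
  rintro rfl
  change e 1 2 0 ∈ insert (x 2 1) (e 3 0 '' Icc 0 1) at hτK
  rw [h.edge_zero 1 2 h12] at hτK
  have h1 : (1 : ℝ) ∈ Icc (0 : ℝ) 1 := ⟨zero_le_one, le_rfl⟩
  rcases hτK with h2 | ⟨t, ht, h2⟩
  · obtain ⟨-, h3 | h3⟩ := h.inj 1 2 1 h1 1 h1 h2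
    exacts [absurd h3 (by decide), one_ne_zero h3]
  · obtain ⟨-, ⟨h3, -⟩ | ⟨h3, -⟩⟩ := h.edge_half 3 0 1 h30 t ht 1 h1 h2
    exacts [absurd h3 (by decide), absurd h3 (by decide)]

/-- The directions of the straightened half-edges. -/
def dir (i : Fin 3) : Fin 4 → ℝ := ![ang 0, ang i + Real.pi, ang 1, ang 2]

/-- The speeds of the straightened half-edges. -/
def speed : Fin 4 → ℝ := ![1, 1 / 2, 1 / 2, 1 / 2]

theorem exists_straighten (h : CrossStar x e) : ∃ k : Sph ≃ₜ Sph,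
    (∀ s, ∀ t ∈ Icc (0 : ℝ) 1, k (tri x e 0 2 3 s t) = merid (ang s) t) ∧
      ∃ i, ∀ a, ∀ t ∈ Icc (0 : ℝ) 1, k (x a t) = merid (dir i a) (speed a * t) := by
  have h12 : Crosswise 1 2 := by decide
  have h30 : Crosswise 3 0 := by decide
  have h20 : Crosswise 2 0 := by decide
  have hT := h.isTheta_tri (a := 0) (b := 2) (c := 3) (by decide) (by decide) (by decide)
  obtain ⟨τ, hτ, hτK, hlt⟩ := h.exists_first_hit
  have hmul : ∀ {t : ℝ}, t ∈ Icc (0 : ℝ) 1 → τ * t ∈ Icc (0 : ℝ) 1 := fun {t} ht =>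
    ⟨mul_nonneg hτ.1.le ht.1, mul_le_one₀ hτ.2 ht.1 ht.2⟩
  have hjoin : x 1 1 = (fun t => e 1 2 (τ * t)) 0 := by
    simp only [mul_zero, h.edge_zero 1 2 h12]
  have hcont : ContinuousOn (concat (x 1) fun t => e 1 2 (τ * t)) (Icc 0 1) :=
    continuousOn_concat (h.cont 1) ((h.edge_cont 1 2 h12).comp (by fun_prop) fun _ => hmul) hjoin
  have hinj : InjOn (concat (x 1) fun t => e 1 2 (τ * t)) (Icc 0 1) := by
    refine injOn_concat (h.injOn 1) ?_ ?_
    · intro t ht u hu htu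
      exact mul_left_cancel₀ hτ.1.ne' (h.edge_inj 1 2 h12 (hmul ht) (hmul hu) htu)
    · intro t ht u hu htu
      obtain ⟨-, ⟨-, h3⟩ | ⟨h3, -⟩⟩ := h.edge_half 1 2 1 h12 _ (hmul hu) t ht htu.symm
      exacts [(mul_eq_zero.1 h3).resolve_left hτ.1.ne', absurd h3 (by decide)]
  have hd : ∀ u ∈ Ioo (0 : ℝ) 1, ∀ s : Fin 3, ∀ t ∈ Icc (0 : ℝ) 1,
      concat (x 1) (fun t => e 1 2 (τ * t)) u ≠ tri x e 0 2 3 s t := by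
    have hx1 : ∀ u ∈ Ioc (0 : ℝ) 1, ∀ b, b ≠ 1 → ∀ t ∈ Icc (0 : ℝ) 1, x 1 u ≠ x b t := by
      intro u hu b hb t ht heq
      obtain ⟨-, h3 | h3⟩ := h.inj 1 b u (Ioc_subset_Icc_self hu) t ht heq
      exacts [hb h3.symm, hu.1.ne' h3]
    have hxe : ∀ u ∈ Icc (0 : ℝ) 1, ∀ b, Crosswise b 0 → b ≠ 1 → ∀ t ∈ Icc (0 : ℝ) 1,
        x 1 u ≠ e b 0 t := by
      intro u hu b hb hb1 t ht heq
      obtain ⟨-, ⟨h3, -⟩ | ⟨h3, -⟩⟩ := h.edge_half b 0 1 hb t ht u hu heq.symm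
      exacts [hb1 h3.symm, absurd h3 (by decide)]
    have hex : ∀ u ∈ Ioo (0 : ℝ) 1, ∀ b, b ≠ 1 → ∀ t ∈ Icc (0 : ℝ) 1, e 1 2 (τ * u) ≠ x b t := by
      intro u hu b hb t ht heq
      obtain ⟨-, ⟨h3, -⟩ | ⟨-, h3⟩⟩ :=
        h.edge_half 1 2 b h12 _ (hmul (Ioo_subset_Icc_self hu)) t ht heq
      · exact hb h3
      · nlinarith [hu.1, hu.2, hτ.1, hτ.2]
    have hlt' : ∀ u ∈ Ioo (0 : ℝ) 1, e 1 2 (τ * u) ∉ insert (x 2 1) (e 3 0 '' Icc 0 1) :=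
      fun u hu => hlt _ ⟨(mul_pos hτ.1 hu.1).le, mul_lt_of_lt_one_right hτ.1 hu.2⟩
    intro u hu s t ht heq
    have hu' := Ioo_subset_Icc_self hu
    have key : ∀ v ∈ Icc (0 : ℝ) 1, concat (x 1) (fun t => e 1 2 (τ * t)) u ≠ e 3 0 v ∧
        concat (x 1) (fun t => e 1 2 (τ * t)) u ≠ e 2 0 v ∧
        ∀ b, b ≠ 1 → concat (x 1) (fun t => e 1 2 (τ * t)) u ≠ x b v := by
      intro v hv
      rcases concat_cases (f := x 1) (g := fun t => e 1 2 (τ * t)) hu' with ⟨h1, h2, h3⟩ | ⟨h1, h2, h3⟩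
      · rw [h3]
        exact ⟨hxe _ h2 3 h30 (by decide) v hv, hxe _ h2 2 h20 (by decide) v hv,
          fun b hb => hx1 _ ⟨by linarith [hu.1], h2.2⟩ b hb v hv⟩
      · have hw : 2 * u - 1 ∈ Ioo (0 : ℝ) 1 := ⟨by linarith, by linarith [hu.2]⟩
        rw [h3]
        refine ⟨fun heq => hlt' _ hw (Or.inr ⟨v, hv, heq.symm⟩), fun heq => ?_,
          fun b hb => hex _ hw b hb v hv⟩
        rw [h.edge_symm 2 1 h12.symm] at heq
        obtain ⟨h4, -⟩ := h.edge_edge 2 1 0 h12.symm h20 (by decide) _ (one_sub_mem (hmul h2)) v hv heq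
        nlinarith [hw.1, hw.2, hτ.1, hτ.2]
    fin_cases s
    · exact (key t ht).2.2 0 (by decide) heq
    · rcases concat_mem (f := x 2) (g := e 2 0) ht with ⟨v, hv, hv'⟩ | ⟨v, hv, hv'⟩
      exacts [(key v hv).2.2 2 (by decide) (heq.trans hv'.symm), (key v hv).2.1 (heq.trans hv'.symm)]
    · rcases concat_mem (f := x 3) (g := e 3 0) ht with ⟨v, hv, hv'⟩ | ⟨v, hv, hv'⟩
      exacts [(key v hv).2.2 3 (by decide) (heq.trans hv'.symm), (key v hv).1 (heq.trans hv'.symm)]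
  obtain ⟨s, q, hq, hend⟩ : ∃ s : Fin 3, ∃ q ∈ Ioo (0 : ℝ) 1,
      concat (x 1) (fun t => e 1 2 (τ * t)) 1 = tri x e 0 2 3 s q := by
    rw [concat_one, mul_one]
    rcases hτK with h1 | ⟨u, hu, h1⟩
    · refine ⟨1, 1 / 2, by norm_num, ?_⟩
      rw [h1]
      change x 2 1 = concat (x 2) (e 2 0) (1 / 2)
      rw [concat_left le_rfl]
      norm_num
    · have hone : (1 : ℝ) ∈ Icc (0 : ℝ) 1 := ⟨zero_le_one, le_rfl⟩
      have hx : ∀ b, b ≠ 1 → b ≠ 2 → e 3 0 u ≠ x b 1 := by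
        intro b hb1 hb2 h2
        obtain ⟨-, ⟨h3, -⟩ | ⟨h3, -⟩⟩ :=
          h.edge_half 1 2 b h12 τ (Ioc_subset_Icc_self hτ) 1 hone (h1.symm.trans h2)
        exacts [hb1 h3, hb2 h3]
      have hu0 : u ≠ 0 := by
        rintro rfl
        exact hx 3 (by decide) (by decide) (h.edge_zero 3 0 h30)
      have hu1 : u ≠ 1 := by
        rintro rfl
        exact hx 0 (by decide) (by decide) (h.edge_one h30)
      have hu0' : 0 < u := hu.1.lt_of_ne hu0.symm
      have hu1' : u < 1 := hu.2.lt_of_ne hu1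
      refine ⟨2, (u + 1) / 2, ⟨by linarith, by linarith⟩, ?_⟩
      change e 1 2 τ = concat (x 3) (e 3 0) ((u + 1) / 2)
      rw [concat_right (h.edge_zero 3 0 h30).symm (by linarith), ← h1]
      ring_nf
  obtain ⟨k, hk, i, hki⟩ := hT.exists_straighten hcont hinj
    (by rw [concat_zero]; exact h.zero 1 0) hd hq hend
  have hhalf : ∀ {t : ℝ}, t ∈ Icc (0 : ℝ) 1 → 1 / 2 * t ∈ Icc (0 : ℝ) (1 / 2) := fun {t} ht =>
    ⟨by linarith [ht.1], by linarith [ht.2]⟩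
  have hleft : ∀ (p q : ℝ → Sph), ∀ t ∈ Icc (0 : ℝ) 1, concat p q (1 / 2 * t) = p t := by
    intro p q t ht
    rw [concat_left (hhalf ht).2]
    ring_nf
  have hhalf' : ∀ {t : ℝ}, t ∈ Icc (0 : ℝ) 1 → 1 / 2 * t ∈ Icc (0 : ℝ) 1 := fun {t} ht =>
    ⟨(hhalf ht).1, (hhalf ht).2.trans (by norm_num)⟩
  refine ⟨k, hk, i, fun a t ht => ?_⟩
  fin_cases a
  · have := hk 0 t ht
    rw [← one_mul t] at this
    simpa [tri, dir, speed] using this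
  · have := hki _ (hhalf ht)
    rwa [hleft _ _ t ht] at this
  · have := hk 1 _ (hhalf' ht)
    rwa [show tri x e 0 2 3 1 (1 / 2 * t) = x 2 t from hleft _ _ t ht] at this
  · have := hk 2 _ (hhalf' ht)
    rwa [show tri x e 0 2 3 2 (1 / 2 * t) = x 3 t from hleft _ _ t ht] at this

end CrossStar

theorem ray_congr {ψ φ : ℝ} (h : cis ψ = cis φ) : ray ψ = ray φ := by
  simp only [ray, h]

theorem hgt_southPole : hgt southPole = -1 := hgt_eq_neg_one_iff.2 rfl

theorem lt_half_of_hgt_merid_neg {ψ t : ℝ} (ht : t ∈ Icc (0 : ℝ) 1) (h : hgt (merid ψ t) < 0) :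
    t < 1 / 2 := by
  by_contra! h2
  rw [hgt_merid] at h
  have hpi := Real.pi_pos
  have := Real.cos_nonpos_of_pi_div_two_le_of_le (x := Real.pi * t) (by nlinarith) (by nlinarith [ht.2])
  linarith

namespace CrossStar

variable {x y : Fin 4 → ℝ → Sph} {e f : Fin 4 → Fin 4 → ℝ → Sph}

theorem speed_mem (a : Fin 4) : speed a = 1 ∨ speed a = 1 / 2 := by
  fin_cases a
  exacts [Or.inl rfl, Or.inr rfl, Or.inr rfl, Or.inr rfl]

/-- Straightened half-edges cannot appear in opposite cyclic orders. -/
theorem false_of_opposite {k₁ k₂ g : Sph ≃ₜ Sph} {i₁ i₂ : Fin 3}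
    (h₁ : ∀ a, ∀ t ∈ Icc (0 : ℝ) 1, k₁ (x a t) = merid (dir i₁ a) (speed a * t))
    (h₂ : ∀ a, ∀ t ∈ Icc (0 : ℝ) 1, k₂ (y a t) = merid (dir i₂ a) (speed a * t))
    (hk : OrientPres (k₁.trans k₂.symm)) (hg : OrientPres g) {c : Fin 3 → Fin 4}
    (hgc : ∀ s, ∀ t ∈ Icc (0 : ℝ) 1, g (x (c s) t) = y (c s) t) (m m' : Fin 3 → ℤ)
    {θ θ' : Fin 3 → ℝ} (hc : θ = fun s => m s * (2 * Real.pi) + dir i₁ (c s))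
    (hc' : θ' = fun s => m' s * (2 * Real.pi) + dir i₂ (c s))
    (hθ : θ 0 < θ 1 ∧ θ 1 < θ 2 ∧ θ 2 < θ 0 + 2 * Real.pi)
    (hθ' : θ' 1 < θ' 0 ∧ θ' 2 < θ' 1 ∧ θ' 0 < θ' 2 + 2 * Real.pi) : False := by
  have hzero : (0 : ℝ) ∈ Icc (0 : ℝ) 1 := ⟨le_rfl, zero_le_one⟩
  have hF : k₁.symm.trans (g.trans k₂) =
      (k₂.symm.trans ((k₁.trans k₂.symm).symm.trans g)).trans k₂.symm.symm := by
    ext1 z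
    simp
  have hOP : OrientPres (k₁.symm.trans (g.trans k₂)) := by
    rw [hF]
    exact orientPres_conj (orientPres_trans (orientPres_symm hk) hg)
  have hmap : ∀ s, ∀ t ∈ Icc (0 : ℝ) 1, (k₁.symm.trans (g.trans k₂))
      (merid (dir i₁ (c s)) (speed (c s) * t)) = merid (dir i₂ (c s)) (speed (c s) * t) := by
    intro s t ht
    rw [← h₁ _ t ht, ← h₂ _ t ht]
    simp [hgc s t ht]
  refine not_orientPres_of_rays (U := {z | hgt z < 0}) ?_ hθ hθ' ?_ ?_ hOP
  · have := hmap 0 0 hzero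
    rwa [mul_zero, merid_zero, merid_zero] at this
  · exact (isOpen_Iio.preimage continuous_hgt).mem_nhds
      (by rw [mem_preimage, hgt_southPole]; norm_num)
  · intro s z hz hzr
    have hper : ∀ (n : ℤ) (t : ℝ), ray (n * (2 * Real.pi) + t) = ray t := fun n t =>
      ray_congr (by rw [cis_add, cis_two_pi_int, one_mul])
    rw [hc, hper] at hzr
    rw [hc', hper]
    obtain ⟨t, ht, rfl⟩ := exists_merid hzr
    have ht2 := lt_half_of_hgt_merid_neg ht hz
    obtain ⟨u, hu, rfl⟩ : ∃ u ∈ Icc (0 : ℝ) 1, t = speed (c s) * u := by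
      rcases speed_mem (c s) with h | h <;> rw [h]
      · exact ⟨t, ht, (one_mul t).symm⟩
      · exact ⟨2 * t, ⟨by linarith [ht.1], by linarith⟩, by ring⟩
    rw [hmap s u hu]
    exact merid_mem_ray ht _

theorem exists_homeomorph (h : CrossStar x e) (h' : CrossStar y f) (hr : ∀ a, SameGerm x y e f a) :
    ∃ g : Sph ≃ₜ Sph, OrientPres g ∧ ∀ a, ∀ t ∈ Icc (0 : ℝ) 1, g (x a t) = y a t := by
  obtain ⟨k₁, hk₁, i₁, h₁⟩ := h.exists_straighten
  obtain ⟨k₂, hk₂, i₂, h₂⟩ := h'.exists_straighten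
  have hk : OrientPres (k₁.trans k₂.symm) := by
    refine h.orientPres_of_tri h' (hr 0) (b := 2) (c := 3) (by decide) (by decide) (by decide)
      fun s t ht => ?_
    rw [Homeomorph.trans_apply, hk₁ s t ht, ← hk₂ s t ht, Homeomorph.symm_apply_apply]
  by_cases hi : i₁ = i₂
  · subst hi
    refine ⟨k₁.trans k₂.symm, hk, fun a t ht => ?_⟩
    rw [Homeomorph.trans_apply, h₁ a t ht, ← h₂ a t ht, Homeomorph.symm_apply_apply]
  exfalso
  have hpi := Real.pi_pos
  obtain ⟨g, hg, hgj⟩ := h.exists_homeomorph_tri h' (hr 1) (b := 2) (c := 3) (by decide) (by decide)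
    (by decide)
  obtain ⟨g', hg', hgk⟩ := h.exists_homeomorph_tri h' (hr 2) (b := 0) (c := 1) (by decide) (by decide)
    (by decide)
  have hcase : ∀ i₁ i₂ : Fin 3, i₁ ≠ i₂ →
      (i₁ = 0 ∧ i₂ = 1) ∨ (i₁ = 0 ∧ i₂ = 2) ∨ (i₁ = 1 ∧ i₂ = 0) ∨ (i₁ = 2 ∧ i₂ = 0) ∨
      (i₁ = 1 ∧ i₂ = 2) ∨ (i₁ = 2 ∧ i₂ = 1) := by decide
  have hj : ∀ d, d = 2 ∨ d = 1 ∨ d = 3 → ∀ t ∈ Icc (0 : ℝ) 1, g (x d t) = y d t := fun d hd =>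
    hgj d (by tauto)
  have hk' : ∀ d, d = 2 ∨ d = 1 ∨ d = 0 → ∀ t ∈ Icc (0 : ℝ) 1, g' (x d t) = y d t := fun d hd =>
    hgk d (by tauto)
  rcases hcase _ _ hi with ⟨rfl, rfl⟩ | ⟨rfl, rfl⟩ | ⟨rfl, rfl⟩ | ⟨rfl, rfl⟩ | ⟨rfl, rfl⟩ | ⟨rfl, rfl⟩
  · refine false_of_opposite h₁ h₂ hk hg (c := ![2, 1, 3]) (fun s => hj _ (by fin_cases s <;> simp))
      0 ![1, 0, 0] rfl rfl ?_ ?_ <;>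
    refine ⟨?_, ?_, ?_⟩ <;> simp [dir, ang] <;> linarith
  · refine false_of_opposite h₁ h₂ hk hg (c := ![2, 1, 3]) (fun s => hj _ (by fin_cases s <;> simp))
      0 ![0, -1, -1] rfl rfl ?_ ?_ <;>
    refine ⟨?_, ?_, ?_⟩ <;> simp [dir, ang] <;> linarith
  · refine false_of_opposite h₁ h₂ hk hg (c := ![3, 1, 2]) (fun s => hj _ (by fin_cases s <;> simp))
      ![0, 0, 1] 0 rfl rfl ?_ ?_ <;>
    refine ⟨?_, ?_, ?_⟩ <;> simp [dir, ang] <;> linarith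
  · refine false_of_opposite h₁ h₂ hk hg (c := ![3, 1, 2]) (fun s => hj _ (by fin_cases s <;> simp))
      ![0, 0, 1] 0 rfl rfl ?_ ?_ <;>
    refine ⟨?_, ?_, ?_⟩ <;> simp [dir, ang] <;> linarith
  · refine false_of_opposite h₁ h₂ hk hg' (c := ![2, 1, 0]) (fun s => hk' _ (by fin_cases s <;> simp))
      ![0, 0, 1] ![0, -1, 0] rfl rfl ?_ ?_ <;>
    refine ⟨?_, ?_, ?_⟩ <;> simp [dir, ang] <;> linarith
  · refine false_of_opposite h₁ h₂ hk hg' (c := ![0, 1, 2]) (fun s => hk' _ (by fin_cases s <;> simp))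
      ![0, -1, 0] ![1, 0, 0] rfl rfl ?_ ?_ <;>
    refine ⟨?_, ?_, ?_⟩ <;> simp [dir, ang] <;> linarith

end CrossStar

end PlaneTop

namespace SphereDrawing

open PlaneTop

variable {n : ℕ} (D : SphereDrawing n)

/-- The parametrization of the edge from `u` to `w`, extended to the real line. -/
def par (u w : Fin n) : ℝ → Sph :=
  if h : u ≠ w then (D.edge u w h).extend else fun _ => D.vert u

variable {D} {u w w' : Fin n}

theorem par_of_ne (h : u ≠ w) : D.par u w = (D.edge u w h).extend := dif_pos h

theorem continuous_par (h : u ≠ w) : Continuous (D.par u w) := by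
  rw [par_of_ne h]
  exact (D.edge u w h).continuous_extend

theorem par_zero (h : u ≠ w) : D.par u w 0 = D.vert u := by
  rw [par_of_ne h, Path.extend_zero]

theorem par_one (h : u ≠ w) : D.par u w 1 = D.vert w := by
  rw [par_of_ne h, Path.extend_one]

theorem injOn_par (h : u ≠ w) : InjOn (D.par u w) (Icc 0 1) := by
  intro s hs t ht hst
  rw [par_of_ne h, Path.extend_apply _ hs, Path.extend_apply _ ht] at hst
  exact congrArg Subtype.val (D.edge_inj u w h hst)

theorem arc_of_ne (h : u ≠ w) : D.arc u w = range (D.edge u w h) :=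
  Subset.antisymm (iUnion_subset fun _ => Subset.rfl)
    (subset_iUnion (fun h : u ≠ w => range (D.edge u w h)) h)

theorem image_par (h : u ≠ w) : D.par u w '' Icc 0 1 = D.arc u w := by
  rw [par_of_ne h, arc_of_ne h]
  ext z
  constructor
  · rintro ⟨t, ht, rfl⟩
    exact ⟨⟨t, ht⟩, (Path.extend_apply _ ht).symm⟩
  · rintro ⟨t, rfl⟩
    exact ⟨t, t.2, Path.extend_apply _ t.2⟩

theorem par_symm (h : u ≠ w) (t : ℝ) : D.par w u t = D.par u w (1 - t) := by
  rw [par_of_ne h, par_of_ne h.symm, D.edge_symm u w h, Path.extend_symm_apply]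

theorem arc_comm (h : u ≠ w) : D.arc u w = D.arc w u := by
  rw [← image_par h, ← image_par h.symm]
  ext z
  constructor <;> rintro ⟨t, ht, rfl⟩ <;> refine ⟨1 - t, one_sub_mem ht, ?_⟩
  · rw [par_symm h, sub_sub_cancel]
  · rw [par_symm h]

theorem eq_or_eq_of_mem_arc (h : u ≠ w) {v : Fin n} (hv : D.vert v ∈ D.arc u w) :
    v = u ∨ v = w := by
  rw [arc_of_ne h] at hv
  have hmem : D.vert v ∈ ({D.vert u, D.vert w} : Set Sph) := by
    rw [← D.edge_vert u w h]
    exact ⟨hv, v, rfl⟩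
  rcases hmem with h1 | h1
  exacts [Or.inl (D.vert_inj h1), Or.inr (D.vert_inj h1)]

theorem IsGood.eq_vert (hD : D.IsGood) (h : u ≠ w) (h' : u ≠ w') (hw : w ≠ w') {z : Sph}
    (hz : z ∈ D.arc u w) (hz' : z ∈ D.arc u w') : z = D.vert u := by
  by_cases hv : z ∈ range D.vert
  · obtain ⟨v, rfl⟩ := hv
    rcases eq_or_eq_of_mem_arc h hz with rfl | rfl
    · rfl
    · rcases eq_or_eq_of_mem_arc h' hz' with rfl | rfl
      exacts [rfl, absurd rfl hw]
  · have hmem : z ∈ D.inner u w ∩ D.inner u w' := ⟨⟨hz, hv⟩, hz', hv⟩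
    rw [hD.adj u w w' hw] at hmem
    exact hmem.elim

/-- The opposite half-edge at a crossing. -/
def opp : Fin 4 → Fin 4 := ![1, 0, 3, 2]

theorem IsGood.exists_crossStar (hD : D.IsGood) {v : Fin 4 → Fin n} (hv : Function.Injective v)
    {p : Sph} (hp : ∀ a, p ∈ D.inner (v a) (v (opp a))) :
    ∃ x, CrossStar x (fun a b => D.par (v a) (v b)) ∧ (∀ a, x a 0 = p) ∧
      (∀ a, x a 1 = D.vert (v a)) ∧
      ∀ a, D.arc (v a) (v (opp a)) = x a '' Icc 0 1 ∪ x (opp a) '' Icc 0 1 := by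
  have h0 : (0 : ℝ) ∈ Icc (0 : ℝ) 1 := ⟨le_rfl, zero_le_one⟩
  have h1 : (1 : ℝ) ∈ Icc (0 : ℝ) 1 := ⟨zero_le_one, le_rfl⟩
  have hopp : ∀ a, a ≠ opp a := by decide
  have hoo : ∀ a, opp (opp a) = a := by decide
  have hcases : ∀ a b, b = a ∨ b = opp a ∨ Crosswise a b := by decide
  have hne : ∀ a, v a ≠ v (opp a) := fun a => hv.ne (hopp a)
  have hs : ∀ a, ∃ s ∈ Icc (0 : ℝ) 1, D.par (v a) (v (opp a)) s = p := fun a => by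
    have := (hp a).1
    rwa [← image_par (hne a)] at this
  choose s hs hsp using hs
  have hs0 : ∀ a, 0 < s a := fun a => (hs a).1.lt_of_ne fun h => (hp a).2
    ⟨v a, by rw [← hsp a, ← h, par_zero (hne a)]⟩
  have hs1 : ∀ a, s a < 1 := fun a => (hs a).2.lt_of_ne fun h => (hp a).2
    ⟨v (opp a), by rw [← hsp a, h, par_one (hne a)]⟩
  have hso : ∀ a, s (opp a) = 1 - s a := fun a => by
    refine injOn_par (D := D) (hne (opp a)) (hs _) (one_sub_mem (hs a)) ?_
    rw [hsp, hoo, par_symm (hne a), sub_sub_cancel, hsp]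
  have hmem : ∀ a, ∀ t ∈ Icc (0 : ℝ) 1, s a * (1 - t) ∈ Icc (0 : ℝ) 1 := fun a t ht =>
    ⟨mul_nonneg (hs a).1 (one_sub_mem ht).1, mul_le_one₀ (hs a).2 (one_sub_mem ht).1 (one_sub_mem ht).2⟩
  let x : Fin 4 → ℝ → Sph := fun a t => D.par (v a) (v (opp a)) (s a * (1 - t))
  have hx0 : ∀ a, x a 0 = p := fun a => by simp only [x, sub_zero, mul_one, hsp]
  have hx1 : ∀ a, x a 1 = D.vert (v a) := fun a => by
    simp only [x, sub_self, mul_zero, par_zero (hne a)]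
  have hxarc : ∀ a, ∀ t ∈ Icc (0 : ℝ) 1, x a t ∈ D.arc (v a) (v (opp a)) := fun a t ht => by
    rw [← image_par (hne a)]
    exact mem_image_of_mem _ (hmem a t ht)
  have hxopp : ∀ a t, x (opp a) t = D.par (v a) (v (opp a)) (1 - (1 - s a) * (1 - t)) :=
    fun a t => by
      simp only [x]
      rw [hoo, par_symm (hne a), hso]
  have hxi : ∀ a, InjOn (x a) (Icc 0 1) := fun a t ht u hu htu => by
    have := mul_left_cancel₀ (hs0 a).ne' (injOn_par (hne a) (hmem a t ht) (hmem a u hu) htu)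
    linarith
  have hinj : ∀ a b, ∀ t ∈ Icc (0 : ℝ) 1, ∀ u ∈ Icc (0 : ℝ) 1, x a t = x b u →
      t = u ∧ (a = b ∨ t = 0) := by
    intro a b t ht u hu htu
    rcases hcases a b with rfl | rfl | hab
    · exact ⟨hxi _ ht hu htu, Or.inl rfl⟩
    · rw [hxopp] at htu
      have h2 := hmem (opp a) u hu
      rw [hso] at h2
      have h3 := injOn_par (hne a) (hmem a t ht) (one_sub_mem h2) htu
      have h4 : s a * t = 0 ∧ (1 - s a) * u = 0 := by
        have h5 := mul_nonneg (hs0 a).le ht.1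
        have h6 := mul_nonneg (sub_pos.2 (hs1 a)).le hu.1
        constructor <;> nlinarith
      have h5 := (mul_eq_zero.1 h4.1).resolve_left (hs0 a).ne'
      have h6 := (mul_eq_zero.1 h4.2).resolve_left (sub_pos.2 (hs1 a)).ne'
      exact ⟨h5.trans h6.symm, Or.inr h5⟩
    · have hdist : ∀ a b, Crosswise a b → a ≠ b ∧ a ≠ opp b ∧ opp a ≠ b ∧ opp a ≠ opp b := by decide
      obtain ⟨d1, d2, d3, d4⟩ := hdist a b hab
      have hb := hxarc b u hu
      rw [← htu] at hb
      by_cases hvert : x a t ∈ range D.vert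
      · obtain ⟨q, hq⟩ := hvert
        have ha := hxarc a t ht
        rw [← hq] at ha hb
        rcases eq_or_eq_of_mem_arc (hne a) ha with rfl | rfl <;>
          rcases eq_or_eq_of_mem_arc (hne b) hb with h | h
        exacts [absurd (hv h) d1, absurd (hv h) d2, absurd (hv h) d3, absurd (hv h) d4]
      · have hsub := hD.indep (v a) (v (opp a)) (v b) (v (opp b)) (by
          simp [hv.eq_iff, hopp, d1, d2, d3, d4])
        have hp' : x a t = p := hsub ⟨⟨hxarc a t ht, hvert⟩, hb, hvert⟩ ⟨hp a, hp b⟩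
        have ht0 := hxi a ht h0 (hp'.trans (hx0 a).symm)
        have hu0 := hxi b hu h0 ((htu.symm.trans hp').trans (hx0 b).symm)
        exact ⟨ht0.trans hu0.symm, Or.inr ht0⟩
  have hmemarc : ∀ a b, Crosswise a b → ∀ t ∈ Icc (0 : ℝ) 1,
      D.par (v a) (v b) t ∈ D.arc (v a) (v b) := fun a b hab t ht => by
    rw [← image_par (hv.ne hab.ne)]
    exact mem_image_of_mem _ ht
  have hcorner : ∀ a b, Crosswise a b → ∀ z ∈ D.arc (v a) (v b), z ∈ D.arc (v a) (v (opp a)) →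
      z = D.vert (v a) := fun a b hab z hz hz' => by
    have hd : ∀ a b, Crosswise a b → b ≠ opp a := by decide
    exact hD.eq_vert (hv.ne hab.ne) (hne a) (hv.ne (hd a b hab)) hz hz'
  have hxcorner : ∀ a c, c = a ∨ c = opp a → ∀ u ∈ Icc (0 : ℝ) 1, x c u = D.vert (v a) →
      u = 1 ∧ c = a := by
    intro a c hc u hu h
    rw [← hx1 a] at h
    obtain ⟨h2, h3 | h3⟩ := hinj c a u hu 1 h1 h
    exacts [⟨h2, h3⟩, by linarith]
  have hxarc' : ∀ a c, c = a ∨ c = opp a → ∀ u ∈ Icc (0 : ℝ) 1,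
      x c u ∈ D.arc (v a) (v (opp a)) := by
    rintro a c (rfl | rfl) u hu
    · exact hxarc _ u hu
    · rw [arc_comm (hne a)]
      have := hxarc (opp a) u hu
      rwa [hoo] at this
  refine ⟨x, ⟨fun a => ?_, fun a b => by rw [hx0, hx0], hinj,
    fun a b hab => (continuous_par (hv.ne hab.ne)).continuousOn,
    fun a b hab => injOn_par (hv.ne hab.ne), fun a b hab => ?_,
    fun a b hab => par_symm (hv.ne hab.ne), ?_, ?_⟩, hx0, hx1, fun a => ?_⟩
  · have := continuous_par (D := D) (hne a)
    exact Continuous.continuousOn (by fun_prop)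
  · rw [hx1, par_zero (hv.ne hab.ne)]
  · intro a b c hab t ht u hu h
    have hc : ∀ a b c, Crosswise a b → (c = a ∨ c = opp a) ∨ c = b ∨ c = opp b := by decide
    have hz := hmemarc a b hab t ht
    rcases hc a b c hab with hc | hc
    · have hva := hcorner a b hab _ hz (by rw [h]; exact hxarc' a c hc u hu)
      obtain ⟨hu1, hca⟩ := hxcorner a c hc u hu (h.symm.trans hva)
      exact ⟨hu1, Or.inl ⟨hca, injOn_par (hv.ne hab.ne) ht h0
        (hva.trans (par_zero (hv.ne hab.ne)).symm)⟩⟩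
    · rw [arc_comm (hv.ne hab.ne)] at hz
      have hvb := hcorner b a hab.symm _ hz (by rw [h]; exact hxarc' b c hc u hu)
      obtain ⟨hu1, hcb⟩ := hxcorner b c hc u hu (h.symm.trans hvb)
      exact ⟨hu1, Or.inr ⟨hcb, injOn_par (hv.ne hab.ne) ht h1
        (hvb.trans (par_one (hv.ne hab.ne)).symm)⟩⟩
  · intro a b c hab hac hbc t ht u hu h
    have hz := hmemarc a b hab t ht
    have hz' := hmemarc a c hac u hu
    rw [← h] at hz'
    have hva := hD.eq_vert (hv.ne hab.ne) (hv.ne hac.ne) (hv.ne hbc) hz hz'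
    exact ⟨injOn_par (hv.ne hab.ne) ht h0 (hva.trans (par_zero (hv.ne hab.ne)).symm),
      injOn_par (hv.ne hac.ne) hu h0 ((h.symm.trans hva).trans (par_zero (hv.ne hac.ne)).symm)⟩
  · refine Subset.antisymm ?_ (union_subset ?_ ?_)
    · rw [← image_par (hne a)]
      rintro _ ⟨t, ht, rfl⟩
      rcases le_total t (s a) with h | h
      · refine Or.inl ⟨1 - t / s a, one_sub_mem ⟨div_nonneg ht.1 (hs0 a).le, (div_le_one (hs0 a)).2 h⟩, ?_⟩
        simp only [x]
        rw [sub_sub_cancel, mul_div_cancel₀ _ (hs0 a).ne']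
      · have hs1' := sub_pos.2 (hs1 a)
        refine Or.inr ⟨1 - (1 - t) / (1 - s a), one_sub_mem
          ⟨div_nonneg (one_sub_mem ht).1 hs1'.le, (div_le_one hs1').2 (by linarith)⟩, ?_⟩
        rw [hxopp, sub_sub_cancel, mul_div_cancel₀ _ hs1'.ne', sub_sub_cancel]
    · rintro _ ⟨t, ht, rfl⟩
      exact hxarc' a a (Or.inl rfl) t ht
    · rintro _ ⟨t, ht, rfl⟩
      exact hxarc' a (opp a) (Or.inr rfl) t ht

end SphereDrawing

open SphereDrawing PlaneTop

/-- In good drawings of `K_n` with the same rotation scheme, the direction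
of each crossing of independent edges is the same: there is an orientation-preserving
homeomorphism of the sphere carrying the (labelled, hence oriented) two arcs and their
crossing point of `D1` onto those of `D2`.  Since the homeomorphism preserves the labels
of the endpoints, it preserves the traversal directions of both edges, so it witnesses
that `f` crosses `e` with the same sign (left-to-right vs. right-to-left) in both. -/
theorem crossing_direction_determined_by_rotation {n : ℕ}
    (D1 D2 : SphereDrawing n) (h1 : D1.IsGood) (h2 : D2.IsGood)
    (hrot : SameRotation D1 D2)
    (i j k l : Fin n) (hnd : ([i, j, k, l] : List (Fin n)).Nodup)
    (hcr : D1.Cross i j k l)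
    (p1 p2 : Sph) (hp1 : p1 ∈ D1.inner i j ∩ D1.inner k l)
    (hp2 : p2 ∈ D2.inner i j ∩ D2.inner k l) :
    ∃ h : Sph ≃ₜ Sph, OrientPres h ∧
      h (D1.vert i) = D2.vert i ∧ h (D1.vert j) = D2.vert j ∧
      h (D1.vert k) = D2.vert k ∧ h (D1.vert l) = D2.vert l ∧
      h '' (D1.arc i j) = D2.arc i j ∧ h '' (D1.arc k l) = D2.arc k l ∧
      h p1 = p2 := by
  have hone : (1 : ℝ) ∈ Icc (0 : ℝ) 1 := ⟨zero_le_one, le_rfl⟩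
  have hv : Function.Injective ![i, j, k, l] := by
    have := List.nodup_ofFn.1 (show (List.ofFn ![i, j, k, l]).Nodup by simpa using hnd)
    exact this
  have hij : i ≠ j := hv.ne (show (0 : Fin 4) ≠ 1 by decide)
  have hkl : k ≠ l := hv.ne (show (2 : Fin 4) ≠ 3 by decide)
  have hinner : ∀ {D : SphereDrawing n} {p : Sph}, p ∈ D.inner i j ∩ D.inner k l →
      ∀ a, p ∈ D.inner (![i, j, k, l] a) (![i, j, k, l] (opp a)) := by
    intro D p hp a
    fin_cases a
    · exact hp.1
    · exact ⟨(arc_comm hij).subset hp.1.1, hp.1.2⟩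
    · exact hp.2
    · exact ⟨(arc_comm hkl).subset hp.2.1, hp.2.2⟩
  obtain ⟨x, hx, hx0, hx1, hxa⟩ := h1.exists_crossStar hv (hinner hp1)
  obtain ⟨y, hy, hy0, hy1, hya⟩ := h2.exists_crossStar hv (hinner hp2)
  obtain ⟨g, hg, hgx⟩ := hx.exists_homeomorph hy fun a => by
    obtain ⟨h, hh, hhv, U, hU, hUa⟩ := hrot (![i, j, k, l] a)
    refine ⟨h, hh, by rw [hx1, hy1, hhv], U, by rwa [hx1], fun t ht htU => ?_, fun b hab t ht htU => ?_⟩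
    · have hopp : ∀ a, opp a ≠ a := by decide
      have hxt : x a t ∈ D1.arc (![i, j, k, l] a) (![i, j, k, l] (opp a)) := by
        rw [hxa]
        exact Or.inl (mem_image_of_mem _ ht)
      have := hUa _ (hv.ne (hopp a)) (mem_image_of_mem h ⟨hxt, htU⟩)
      rw [hya] at this
      exact this.elim (fun h => ⟨_, h⟩) fun h => ⟨_, h⟩
    · have hne := hv.ne hab.ne
      have hmem : D1.par (![i, j, k, l] a) (![i, j, k, l] b) t ∈
          D1.arc (![i, j, k, l] a) (![i, j, k, l] b) := by
        rw [← image_par hne]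
        exact mem_image_of_mem _ ht
      rw [image_par hne]
      exact hUa _ hne.symm (mem_image_of_mem h ⟨hmem, htU⟩)
  have hvert : ∀ a, g (D1.vert (![i, j, k, l] a)) = D2.vert (![i, j, k, l] a) := fun a => by
    rw [← hx1, ← hy1, hgx a 1 hone]
  have harc : ∀ a, g '' D1.arc (![i, j, k, l] a) (![i, j, k, l] (opp a)) =
      D2.arc (![i, j, k, l] a) (![i, j, k, l] (opp a)) := fun a => by
    have him : ∀ b, g '' (x b '' Icc 0 1) = y b '' Icc 0 1 := fun b => by
      rw [image_image]
      exact image_congr (hgx b)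
    rw [hxa, hya, image_union, him, him]
  refine ⟨g, hg, hvert 0, hvert 1, hvert 2, hvert 3, harc 0, harc 2, ?_⟩
  rw [← hx0 0, ← hy0 0, hgx 0 0 ⟨le_rfl, zero_le_one⟩]
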